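/- Let α, β, γ, δ ∈ ℂ be algebraically independent over ℚ. Let L be a differential field extension of ℂ(t) with derivation D, K a differential subfield of L, n ≥ 2, and let y₁, …, yₙ ∈ L be solutions (with each yᵢ ∉ {0, 1, t}) of the sixth Painlevé equation y'' = (1/2)(1/y + 1/(y−1) + 1/(y−t))(y')² − (1/t + 1/(t−1) + 1/(y−t))y' + (y(y−1)(y−t)/(t²(t−1)²))·(α + β·t/y² + γ·(t−1)/(y−1)² + δ·t(t−1)/(y−t)²). If the 2n elements y₁, y₁', …, yₙ, yₙ' are NOT algebraically independent over K, then there exist 1 ≤ i < j ≤ n such that yᵢ, yᵢ', yⱼ, yⱼ' are not algebraically independent over K. (Geometric triviality part of Proposition 3.18 for generic P_VI.) -/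

import Mathlib

namespace PainleveVI

open Polynomial

/-- A derivation of a commutative ring into itself. -/
structure Der (A : Type*) [CommRing A] where
  toFun : A → A
  add' : ∀ a b, toFun (a + b) = toFun a + toFun b
  mul' : ∀ a b, toFun (a * b) = a * toFun b + b * toFun a

namespace Der
variable {A : Type*} [CommRing A]

instance : FunLike (Der A) A A where
  coe := toFun
  coe_injective := by rintro ⟨f, _, _⟩ ⟨g, _, _⟩ h; congr

instance : AddMonoidHomClass (Der A) A A where
  map_add := add'
  map_zero δ := by
    have h : δ.toFun 0 = 0 := by simpa using δ.add' 0 0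
    exact h

lemma leibniz (δ : Der A) (a b : A) : δ (a * b) = a * δ b + b * δ a := δ.mul' a b

@[simp] lemma map_one (δ : Der A) : δ 1 = 0 := by simpa using δ.leibniz 1 1

lemma leibniz_pow (δ : Der A) (a : A) (n : ℕ) : δ (a ^ n) = n * a ^ (n - 1) * δ a := by
  induction n with
  | zero => simp
  | succ n ih =>
    rw [pow_succ, leibniz, ih]
    rcases n with _ | n
    · simp
    · simp only [Nat.add_sub_cancel, pow_succ]; push_cast; ring

@[simp] lemma map_natCast (δ : Der A) (n : ℕ) : δ n = 0 := by
  induction n with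
  | zero => simp
  | succ n ih => simp [ih]

@[simp] lemma map_ofNat (δ : Der A) (n : ℕ) [n.AtLeastTwo] : δ (OfNat.ofNat n) = 0 :=
  δ.map_natCast n

@[simp] lemma map_intCast (δ : Der A) (n : ℤ) : δ n = 0 := by
  rcases n with n | n
  · simp
  · have := δ.map_natCast (n + 1)
    rw [Int.cast_negSucc, map_neg, this, neg_zero]

end Der

/-- The derivation of `A[X]` acting on coefficients by `δ` and killing `X`. -/
noncomputable def coeffDeriv {A : Type*} [CommRing A] (δ : Der A) : Der A[X] where
  toFun f := f.sum fun n a => monomial n (δ a)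
  add' f g := sum_add_index f g _ (by simp) (by simp)
  mul' f g := by
    have hc (f : A[X]) (n : ℕ) : (f.sum fun n a => monomial n (δ a)).coeff n = δ (f.coeff n) := by
      simp only [sum_def, finsetSum_coeff, coeff_monomial]
      rw [Finset.sum_ite_eq']
      split_ifs with h
      · rfl
      · rw [notMem_support_iff.1 h, map_zero]
    ext n
    simp only [coeff_add, coeff_mul, hc, map_sum, Der.leibniz, Finset.sum_add_distrib]
    congr 1
    rw [← Finset.Nat.sum_antidiagonal_swap]
    simp

section
variable {A : Type*} [CommRing A]

@[simp] lemma coeff_coeffDeriv (δ : Der A) (f : A[X]) (n : ℕ) :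
    (coeffDeriv δ f).coeff n = δ (f.coeff n) := by
  change (f.sum fun n a => monomial n (δ a)).coeff n = δ (f.coeff n)
  simp only [sum_def, finsetSum_coeff, coeff_monomial]
  rw [Finset.sum_ite_eq']
  split_ifs with h
  · rfl
  · rw [notMem_support_iff.1 h, map_zero]

@[simp] lemma coeffDeriv_C (δ : Der A) (a : A) : coeffDeriv δ (C a) = C (δ a) := by
  ext n; simp only [coeff_coeffDeriv, coeff_C]; split_ifs <;> simp

@[simp] lemma coeffDeriv_X (δ : Der A) : coeffDeriv δ (X : A[X]) = 0 := by
  ext n; simp only [coeff_coeffDeriv, coeff_X]; split_ifs <;> simp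

/-- Differentiation of polynomials as a derivation. -/
noncomputable def polyDeriv (A : Type*) [CommRing A] : Der A[X] where
  toFun := derivative
  add' _ _ := derivative_add
  mul' f g := by rw [derivative_mul]; ring

@[simp] lemma polyDeriv_apply (f : A[X]) : polyDeriv A f = derivative f := rfl

/-- The vector field `d + Q ∂ + P ∂/∂p + U ∂/∂u` on `A[p][u]`, where `d` and `∂` act on
coefficients. -/
noncomputable def vectorField (d e : Der A) (Q P U : A[X][X]) : Der A[X][X] where
  toFun f := coeffDeriv (coeffDeriv d) f + Q * coeffDeriv (coeffDeriv e) f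
      + P * coeffDeriv (polyDeriv A) f + U * derivative f
  add' f g := by simp only [map_add]; ring
  mul' f g := by simp only [Der.leibniz, derivative_mul]; ring

lemma vectorField_apply (d e : Der A) (Q P U f : A[X][X]) :
    vectorField d e Q P U f = coeffDeriv (coeffDeriv d) f + Q * coeffDeriv (coeffDeriv e) f
      + P * coeffDeriv (polyDeriv A) f + U * derivative f := rfl

@[simp] lemma vectorField_C_C (d e : Der A) (Q P U : A[X][X]) (a : A) :
    vectorField d e Q P U (C (C a)) = C (C (d a)) + Q * C (C (e a)) := by
  simp [vectorField_apply]

@[simp] lemma vectorField_C_X (d e : Der A) (Q P U : A[X][X]) :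
    vectorField d e Q P U (C X) = P := by
  simp [vectorField_apply]

@[simp] lemma vectorField_X (d e : Der A) (Q P U : A[X][X]) :
    vectorField d e Q P U X = U := by
  simp [vectorField_apply]

/-- A ring homomorphism out of a polynomial ring intertwines two derivations once it does so on
constants and on the variable. -/
lemma intertwine {S : Type*} [CommRing S] (Ψ : A[X] →+* S) (D₁ : Der A[X])
    (D₂ : Der S) (hC : ∀ a, D₂ (Ψ (C a)) = Ψ (D₁ (C a)))
    (hX : D₂ (Ψ X) = Ψ (D₁ X)) (f : A[X]) : D₂ (Ψ f) = Ψ (D₁ f) := by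
  induction f using Polynomial.induction_on' with
  | add p q hp hq => simp [hp, hq]
  | monomial n a =>
    rw [← C_mul_X_pow_eq_monomial]
    simp [Der.leibniz, Der.leibniz_pow, hC, hX]

/-- Intertwining for ring homomorphisms out of a polynomial ring in two variables. -/
lemma intertwine₂ {S : Type*} [CommRing S] (Ψ : A[X][X] →+* S)
    (D₁ : Der A[X][X])
    (D₂ : Der S) (hC : ∀ a, D₂ (Ψ (C (C a))) = Ψ (D₁ (C (C a))))
    (hX : D₂ (Ψ (C X)) = Ψ (D₁ (C X)))
    (hY : D₂ (Ψ X) = Ψ (D₁ X)) (f : A[X][X]) : D₂ (Ψ f) = Ψ (D₁ f) := by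
  refine intertwine Ψ D₁ D₂ (fun a => ?_) hY f
  induction a using Polynomial.induction_on' with
  | add p q hp hq => simp [hp, hq]
  | monomial n a =>
    rw [← C_mul_X_pow_eq_monomial]
    simp [Der.leibniz, Der.leibniz_pow, hC, hX]

/-- Coefficients indexed by integers, extended by zero. -/
noncomputable def zcoeff (f : A[X]) (n : ℤ) : A := if 0 ≤ n then f.coeff n.toNat else 0

lemma zcoeff_natCast (f : A[X]) (n : ℕ) : zcoeff f n = f.coeff n := by simp [zcoeff]

lemma zcoeff_of_neg (f : A[X]) {n : ℤ} (h : n < 0) : zcoeff f n = 0 := by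
  simp [zcoeff, h]

@[simp] lemma zcoeff_zero (n : ℤ) : zcoeff (0 : A[X]) n = 0 := by simp [zcoeff]

@[simp] lemma zcoeff_add (f g : A[X]) (n : ℤ) : zcoeff (f + g) n = zcoeff f n + zcoeff g n := by
  simp only [zcoeff]; split_ifs <;> simp

@[simp] lemma zcoeff_sub (f g : A[X]) (n : ℤ) : zcoeff (f - g) n = zcoeff f n - zcoeff g n := by
  simp only [zcoeff]; split_ifs <;> simp

@[simp] lemma zcoeff_C_mul (a : A) (f : A[X]) (n : ℤ) : zcoeff (C a * f) n = a * zcoeff f n := by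
  simp only [zcoeff]; split_ifs <;> simp

@[simp] lemma zcoeff_X_mul (f : A[X]) (n : ℤ) : zcoeff (X * f) n = zcoeff f (n - 1) := by
  rcases lt_trichotomy n 0 with h | rfl | h
  · rw [zcoeff_of_neg _ h, zcoeff_of_neg _ (by omega)]
  · simp [zcoeff]
  · obtain ⟨m, rfl⟩ : ∃ m : ℕ, n = (m + 1 : ℕ) := ⟨(n - 1).toNat, by omega⟩
    rw [zcoeff_natCast, show ((m + 1 : ℕ) : ℤ) - 1 = (m : ℕ) by push_cast; ring, zcoeff_natCast,
      coeff_X_mul]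

@[simp] lemma zcoeff_X_pow_mul (f : A[X]) (k : ℕ) (n : ℤ) :
    zcoeff (X ^ k * f) n = zcoeff f (n - k) := by
  induction k generalizing n with
  | zero => simp
  | succ k ih => rw [pow_succ', mul_assoc, zcoeff_X_mul, ih]; congr 1; push_cast; ring

lemma zcoeff_derivative (f : A[X]) (n : ℤ) :
    zcoeff (derivative f) n = (n + 1) * zcoeff f (n + 1) := by
  rcases lt_or_ge n 0 with h | h
  · rw [zcoeff_of_neg _ h]
    rcases eq_or_ne n (-1) with rfl | h'
    · simp
    · rw [zcoeff_of_neg f (by omega), mul_zero]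
  · lift n to ℕ using h
    rw [zcoeff_natCast, show (n : ℤ) + 1 = (n + 1 : ℕ) by push_cast; ring, zcoeff_natCast,
      coeff_derivative]
    push_cast; ring

lemma zcoeff_coeffDeriv (δ : Der A) (f : A[X]) (n : ℤ) :
    zcoeff (coeffDeriv δ f) n = δ (zcoeff f n) := by
  simp only [zcoeff]; split_ifs <;> simp

/-- The coefficient of `p ^ j * u ^ k`. -/
noncomputable def zcoeff₂ (f : A[X][X]) (j k : ℤ) : A := zcoeff (zcoeff f k) j

lemma zcoeff₂_of_neg_left (f : A[X][X]) {j : ℤ} (k : ℤ) (h : j < 0) : zcoeff₂ f j k = 0 :=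
  zcoeff_of_neg _ h

lemma zcoeff₂_of_neg_right (f : A[X][X]) (j : ℤ) {k : ℤ} (h : k < 0) : zcoeff₂ f j k = 0 := by
  simp [zcoeff₂, zcoeff_of_neg _ h]

lemma zcoeff₂_natCast (f : A[X][X]) (j k : ℕ) : zcoeff₂ f j k = (f.coeff k).coeff j := by
  simp [zcoeff₂, zcoeff_natCast]

section
variable (f g : A[X][X]) (j k : ℤ)
@[simp] lemma zcoeff₂_add : zcoeff₂ (f + g) j k = zcoeff₂ f j k + zcoeff₂ g j k := by
  simp [zcoeff₂]
@[simp] lemma zcoeff₂_sub : zcoeff₂ (f - g) j k = zcoeff₂ f j k - zcoeff₂ g j k := by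
  simp [zcoeff₂]
@[simp] lemma zcoeff₂_C_C_mul (a : A) : zcoeff₂ (C (C a) * f) j k = a * zcoeff₂ f j k := by
  simp [zcoeff₂]
@[simp] lemma zcoeff₂_C_X_mul : zcoeff₂ (C X * f) j k = zcoeff₂ f (j - 1) k := by
  simp [zcoeff₂]
@[simp] lemma zcoeff₂_X_mul : zcoeff₂ (X * f) j k = zcoeff₂ f j (k - 1) := by
  simp [zcoeff₂]
lemma zcoeff_intCast_mul (f : A[X]) (n m : ℤ) : zcoeff ((m : A[X]) * f) n = m * zcoeff f n := by
  simpa using zcoeff_C_mul (m : A) f n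
@[simp] lemma zcoeff₂_derivative :
    zcoeff₂ (derivative f) j k = (k + 1) * zcoeff₂ f j (k + 1) := by
  rw [zcoeff₂, zcoeff_derivative, zcoeff₂]
  simpa using zcoeff_intCast_mul (zcoeff f (k + 1)) j (k + 1)
@[simp] lemma zcoeff₂_coeffDeriv_polyDeriv :
    zcoeff₂ (coeffDeriv (polyDeriv A) f) j k = (j + 1) * zcoeff₂ f (j + 1) k := by
  rw [zcoeff₂, zcoeff_coeffDeriv, polyDeriv_apply, zcoeff_derivative, zcoeff₂]
@[simp] lemma zcoeff₂_coeffDeriv_coeffDeriv (δ : Der A) :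
    zcoeff₂ (coeffDeriv (coeffDeriv δ) f) j k = δ (zcoeff₂ f j k) := by
  rw [zcoeff₂, zcoeff_coeffDeriv, zcoeff_coeffDeriv, zcoeff₂]
end

end

section weight
variable {A : Type*} [CommRing A]

/-- The substitution `p ↦ p T`, `u ↦ u T`, recording total degrees in the variable `T`. -/
noncomputable def weightHom (A : Type*) [CommRing A] : A[X][X] →+* A[X][X][X] :=
  eval₂RingHom (eval₂RingHom ((C : A[X][X] →+* A[X][X][X]).comp ((C : A[X] →+* A[X][X]).comp C))
    (C (C X) * X : A[X][X][X])) (C X * X : A[X][X][X])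

lemma weightHom_monomial (j k : ℕ) (a : A) :
    weightHom A (monomial k (monomial j a)) = monomial (j + k) (monomial k (monomial j a)) := by
  simp only [weightHom, coe_eval₂RingHom, eval₂_monomial, RingHom.comp_apply]
  simp only [← C_mul_X_pow_eq_monomial, C_mul, C_pow]
  ring

lemma coeff_weightHom (f : A[X][X]) (n j k : ℕ) :
    (((weightHom A f).coeff n).coeff k).coeff j = if j + k = n then (f.coeff k).coeff j else 0 := by
  induction f using Polynomial.induction_on' with
  | add p q hp hq => simp only [map_add, coeff_add, hp, hq]; split_ifs <;> simp
  | monomial k' b =>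
    induction b using Polynomial.induction_on' with
    | add p q hp hq =>
      simp only [map_add, coeff_add, hp, hq]; split_ifs <;> simp
    | monomial j' a =>
      rw [weightHom_monomial]
      simp only [coeff_monomial]
      by_cases hn : j' + k' = n
      · rw [if_pos hn, coeff_monomial]
        by_cases hk : k' = k
        · by_cases hj : j' = j
          · subst hk hj; simp [hn]
          · simp [hk, hj, coeff_monomial]
        · simp [hk]
      · rw [if_neg hn]
        by_cases hk : k' = k
        · by_cases hj : j' = j
          · subst hk hj; simp [hn]
          · simp [hk, hj, coeff_monomial]
        · simp [hk]

lemma weightHom_injective : Function.Injective (weightHom A) := by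
  rw [injective_iff_map_eq_zero]
  intro f hf
  ext k j
  have := coeff_weightHom f (j + k) j k
  simpa [hf] using this.symm

/-- The total degree in the two polynomial variables. -/
noncomputable def weight (f : A[X][X]) : ℕ := (weightHom A f).natDegree

lemma weight_le_iff (f : A[X][X]) (n : ℕ) :
    weight f ≤ n ↔ ∀ j k : ℤ, n < j + k → zcoeff₂ f j k = 0 := by
  rw [weight, natDegree_le_iff_coeff_eq_zero]
  constructor
  · intro h j k hjk
    rcases lt_or_ge j 0 with hj | hj
    · exact zcoeff₂_of_neg_left _ _ hj
    rcases lt_or_ge k 0 with hk | hk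
    · exact zcoeff₂_of_neg_right _ _ hk
    lift j to ℕ using hj
    lift k to ℕ using hk
    have := coeff_weightHom f (j + k) j k
    rw [h (j + k) (by exact_mod_cast hjk)] at this
    simpa [zcoeff₂_natCast] using this.symm
  · intro h m hm
    ext k j
    rw [coeff_weightHom]
    split_ifs with hjk
    · rw [← zcoeff₂_natCast, h _ _ (by exact_mod_cast hjk ▸ hm)]; simp
    · simp

lemma exists_zcoeff₂_weight_ne_zero {f : A[X][X]} (hf : f ≠ 0) :
    ∃ k : ℤ, zcoeff₂ f (weight f - k) k ≠ 0 := by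
  by_contra! h
  have h1 : weightHom A f ≠ 0 := (map_ne_zero_iff _ weightHom_injective).2 hf
  apply leadingCoeff_ne_zero.2 h1
  rw [leadingCoeff]
  ext k j
  rw [coeff_weightHom]
  split_ifs with hjk
  · rw [← zcoeff₂_natCast, show (j : ℤ) = weight f - k by rw [weight, ← hjk]; push_cast; ring, h k]
    rfl
  · simp

lemma weight_mul [IsDomain A] {f g : A[X][X]} (hf : f ≠ 0) (hg : g ≠ 0) :
    weight (f * g) = weight f + weight g := by
  rw [weight, map_mul, natDegree_mul ((map_ne_zero_iff _ weightHom_injective).2 hf)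
    ((map_ne_zero_iff _ weightHom_injective).2 hg)]
  rfl

lemma weight_le_one_form {f : A[X][X]} (h : weight f ≤ 1) :
    f = C (C (zcoeff₂ f 1 0)) * C X + C (C (zcoeff₂ f 0 0)) + C (C (zcoeff₂ f 0 1)) * X := by
  rw [weight_le_iff] at h
  ext k j
  rw [← zcoeff₂_natCast]
  rcases k with _ | _ | k <;> rcases j with _ | _ | j <;>
    simp [coeff_X, coeff_C] <;>
    first | rfl | exact h _ _ (by push_cast <;> omega)

end weight

/-- Derivations along a ring homomorphism extend through formally smooth algebras. -/
lemma exists_extend_derivation {A B N : Type*} [CommRing A] [CommRing B] [CommRing N] [Algebra A B]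
    [Algebra.FormallySmooth A B] (φ : B →+* N) (δ : A → N)
    (hadd : ∀ a b, δ (a + b) = δ a + δ b)
    (hmul : ∀ a b, δ (a * b) = φ (algebraMap A B a) * δ b + φ (algebraMap A B b) * δ a) :
    ∃ δ' : B → N, (∀ a b, δ' (a + b) = δ' a + δ' b) ∧
      (∀ a b, δ' (a * b) = φ a * δ' b + φ b * δ' a) ∧ ∀ a, δ' (algebraMap A B a) = δ a := by
  have h0 : δ 0 = 0 := by simpa using hadd 0 0
  have h1 : δ 1 = 0 := by simpa using hmul 1 1
  let F : A →+* TrivSqZeroExt N N :=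
    { toFun := fun a => TrivSqZeroExt.inl (φ (algebraMap A B a)) + TrivSqZeroExt.inr (δ a)
      map_one' := by ext <;> simp [h1]
      map_mul' := fun a b => by ext <;> simp [hmul, mul_comm]
      map_zero' := by ext <;> simp [h0]
      map_add' := fun a b => by ext <;> simp [hadd] }
  let _ : Algebra A N := (φ.comp (algebraMap A B)).toAlgebra
  let _ : Algebra A (TrivSqZeroExt N N) := F.toAlgebra
  let f : B →ₐ[A] N := { φ with commutes' := fun _ => rfl }
  let g : TrivSqZeroExt N N →ₐ[A] N :=
    { (TrivSqZeroExt.fstHom N N N).toRingHom with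
      commutes' := fun a => by
        change TrivSqZeroExt.fst (F a) = φ (algebraMap A B a)
        simp [F] }
  have hg : Function.Surjective g := fun x => ⟨TrivSqZeroExt.inl x, TrivSqZeroExt.fst_inl N x⟩
  have hk : IsNilpotent (RingHom.ker (g : TrivSqZeroExt N N →+* N)) := by
    refine ⟨2, (sq (RingHom.ker (g : TrivSqZeroExt N N →+* N))).trans
      (eq_bot_iff.2 (Ideal.mul_le.2 fun r hr s hs => ?_))⟩
    have hr' : TrivSqZeroExt.fst r = 0 := hr
    have hs' : TrivSqZeroExt.fst s = 0 := hs
    rw [Ideal.mem_bot]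
    ext <;> simp [hr', hs']
  let ψ := Algebra.FormallySmooth.liftOfSurjective f g hg hk
  have hψ (x : B) : (ψ x).fst = φ x :=
    Algebra.FormallySmooth.liftOfSurjective_apply f g hg hk x
  refine ⟨fun x => (ψ x).snd, fun a b => by simp, fun a b => ?_, fun a => ?_⟩
  · simp [hψ, mul_comm]
  · change (ψ _).snd = _
    rw [ψ.commutes]
    change TrivSqZeroExt.snd (F a) = δ a
    simp [F]

/-- A derivation of a domain extends to its fraction field. -/
lemma exists_extend_fractionRing {A : Type*} [CommRing A] [IsDomain A] (δ : Der A) :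
    ∃ δ' : Der (FractionRing A), ∀ a, δ' (algebraMap A (FractionRing A) a) =
      algebraMap A (FractionRing A) (δ a) := by
  have : Algebra.FormallySmooth A (FractionRing A) := .of_isLocalization (nonZeroDivisors A)
  obtain ⟨δ', h1, h2, h3⟩ := exists_extend_derivation (RingHom.id (FractionRing A))
    (fun a => algebraMap A (FractionRing A) (δ a)) (by simp) (by simp [Der.leibniz])
  exact ⟨⟨δ', h1, h2⟩, h3⟩

lemma formallySmooth_of_charZero (F L : Type*) [Field F] [CharZero F] [Field L] [Algebra F L] :
    Algebra.FormallySmooth F L := by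
  obtain ⟨s, hs⟩ := exists_isTranscendenceBasis F L
  have := hs.isAlgebraic_field
  exact .of_algebraicIndependent_of_isSeparable hs.1

/-- If `x` is transcendental over a field `F`, some derivation of `L` kills `F` and maps `x` to
`1`. -/
lemma exists_der_of_transcendental {F L : Type*} [Field F] [CharZero F] [Field L] [Algebra F L]
    {x : L} (hx : Transcendental F x) :
    ∃ δ : Der L, (∀ a : F, δ (algebraMap F L a) = 0) ∧ δ x = 1 := by
  let φ : FractionRing F[X] →+* L :=
    IsLocalization.lift (M := nonZeroDivisors F[X]) (g := (aeval x : F[X] →ₐ[F] L).toRingHom)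
      fun y => by
        refine IsUnit.mk0 _ fun h => ?_
        exact nonZeroDivisors.ne_zero y.2 ((transcendental_iff.1 hx) _ h)
  have hφ (f : F[X]) : φ (algebraMap _ _ f) = aeval x f := IsLocalization.lift_eq _ f
  have : Algebra.FormallySmooth F[X] (FractionRing F[X]) := .of_isLocalization (nonZeroDivisors _)
  obtain ⟨δ, h1, h2, h3⟩ := exists_extend_derivation φ (fun f : F[X] => aeval x (derivative f))
    (fun a b => by simp) (fun a b => by simp [hφ]; ring)
  let _ : Algebra (FractionRing F[X]) L := φ.toAlgebra
  have : CharZero (FractionRing F[X]) := charZero_of_injective_algebraMap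
    (IsFractionRing.injective F[X] (FractionRing F[X]))
  have := formallySmooth_of_charZero (FractionRing F[X]) L
  obtain ⟨δ', h1', h2', h3'⟩ := exists_extend_derivation (RingHom.id L) δ h1 h2
  refine ⟨⟨δ', h1', h2'⟩, fun a => ?_, ?_⟩
  · have := h3' (algebraMap F[X] (FractionRing F[X]) (C a))
    rw [h3, RingHom.algebraMap_toAlgebra, hφ] at this
    change δ' _ = _
    simpa using this
  · have := h3' (algebraMap F[X] (FractionRing F[X]) X)
    rw [h3, RingHom.algebraMap_toAlgebra, hφ] at this
    change δ' _ = _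
    simpa using this

namespace Der
variable {k : Type*} [Field k]

lemma map_inv (δ : Der k) {a : k} (ha : a ≠ 0) : δ a⁻¹ = -(δ a / a ^ 2) := by
  have h := δ.leibniz a a⁻¹
  rw [mul_inv_cancel₀ ha, map_one] at h
  have h2 : a * a⁻¹ = 1 := mul_inv_cancel₀ ha
  rw [eq_neg_iff_add_eq_zero, ← mul_right_inj' ha, mul_zero, h]
  field_simp

lemma map_div (δ : Der k) (a : k) {b : k} (hb : b ≠ 0) :
    δ (a / b) = (δ a * b - a * δ b) / b ^ 2 := by
  rw [div_eq_mul_inv, leibniz, map_inv δ hb]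
  field_simp
  ring

end Der

section ratfun
variable {K : Type*} [Field K] [CharZero K]

/-- The cubic `q (q - 1) (q - t)`. -/
noncomputable def cubic (t : K) : K[X] := X * (X - 1) * (X - C t)

omit [CharZero K] in
lemma cubic_eq (t : K) : cubic t = X ^ 3 - C (1 + t) * X ^ 2 + C t * X := by
  simp only [cubic, C_add, C_1]; ring

omit [CharZero K] in
lemma derivative_cubic (t : K) :
    derivative (cubic t) = 3 * X ^ 2 - 2 * C (1 + t) * X + C t := by
  rw [cubic_eq]; simp [show (C 2 : K[X]) = 2 from rfl]; ring

omit [CharZero K] in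
lemma eval_zero_derivative_cubic (t : K) : (derivative (cubic t)).eval 0 = t := by
  simp [derivative_cubic]

lemma natDegree_eq_zero_of_dvd_derivative {φ : K[X]} (h : φ ∣ derivative φ) :
    φ.natDegree = 0 := by
  by_contra h0
  have h1 : derivative φ ≠ 0 := fun h2 => h0 (derivative_eq_zero.1 h2)
  exact absurd (natDegree_le_of_dvd h h1) (not_le.2 (natDegree_derivative_lt h0))

lemma dvd_of_dvd_two_mul {b x : K[X]} (h : b ∣ 2 * x) : b ∣ x := by
  have : x = C (1 / 2 : K) * (2 * x) := by
    rw [← mul_assoc, show (2 : K[X]) = C 2 from rfl, ← C_mul]; simp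
  rw [this]
  exact h.mul_left _

lemma eq_prod_of_dvd_cubic_mul_derivative {t : K} {φ : K[X]} (hφ : φ ≠ 0)
    (h : φ ∣ cubic t * derivative φ) :
    ∃ (c : K) (i j l : ℕ), c ≠ 0 ∧ φ = C c * X ^ i * (X - 1) ^ j * (X - C t) ^ l := by
  induction hn : φ.natDegree using Nat.strong_induction_on generalizing φ with
  | _ n ih =>
  have key (e : K) (E₀ : K[X]) (hE : cubic t = (X - C e) * E₀) (hd : X - C e ∣ φ) :
      ∃ ψ : K[X], φ = (X - C e) * ψ ∧
        ∃ (c : K) (i j l : ℕ), c ≠ 0 ∧ ψ = C c * X ^ i * (X - 1) ^ j * (X - C t) ^ l := by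
    obtain ⟨ψ, rfl⟩ := hd
    have hψ : ψ ≠ 0 := right_ne_zero_of_mul hφ
    refine ⟨ψ, rfl, ih ψ.natDegree ?_ hψ ?_ rfl⟩
    · rw [← hn, natDegree_mul (X_sub_C_ne_zero e) hψ, natDegree_X_sub_C]; omega
    · have h2 : (X - C e) * ψ ∣ (X - C e) * (E₀ * ψ + cubic t * derivative ψ) := by
        convert h using 1
        rw [derivative_mul, derivative_sub, derivative_X, derivative_C, hE]; ring
      have h3 := (mul_dvd_mul_iff_left (X_sub_C_ne_zero e)).1 h2
      exact (dvd_add_right (dvd_mul_left ψ E₀)).1 h3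
  by_cases h0 : X - C (0 : K) ∣ φ
  · obtain ⟨ψ, h1, c, i, j, l, hc, h2⟩ := key 0 ((X - 1) * (X - C t)) (by simp [cubic]; ring) h0
    exact ⟨c, i + 1, j, l, hc, by rw [h1, h2]; simp; ring⟩
  by_cases h1 : X - C (1 : K) ∣ φ
  · obtain ⟨ψ, h1, c, i, j, l, hc, h2⟩ := key 1 (X * (X - C t)) (by simp [cubic]; ring) h1
    exact ⟨c, i, j + 1, l, hc, by rw [h1, h2]; simp; ring⟩
  by_cases ht : X - C t ∣ φ
  · obtain ⟨ψ, h1, c, i, j, l, hc, h2⟩ := key t (X * (X - 1)) (by simp [cubic]; ring) ht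
    exact ⟨c, i, j, l + 1, hc, by rw [h1, h2]; ring⟩
  have hco : IsCoprime φ (cubic t) := by
    have hp (e : K) (he : ¬ X - C e ∣ φ) : IsCoprime φ (X - C e) :=
      ((irreducible_X_sub_C e).coprime_iff_not_dvd.2 he).symm
    have := ((hp 0 h0).mul_right (hp 1 h1)).mul_right (hp t ht)
    simpa [cubic] using this
  have := natDegree_eq_zero_of_dvd_derivative (hco.dvd_of_dvd_mul_left h)
  obtain ⟨c, rfl⟩ := natDegree_eq_zero.1 this
  exact ⟨c, 0, 0, 0, by simpa using hφ, by simp⟩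

local notation "k" => FractionRing K[X]
local notation "ι" => algebraMap K[X] (FractionRing K[X])

omit [CharZero K] in
lemma algebraMap_injective : Function.Injective ι := IsFractionRing.injective _ _

omit [CharZero K] in
lemma exists_coprime_fraction (g : k) :
    ∃ a b : K[X], b ≠ 0 ∧ IsCoprime a b ∧ g = ι a / ι b := by
  refine ⟨IsFractionRing.num K[X] g, IsFractionRing.den K[X] g,
    nonZeroDivisors.ne_zero (IsFractionRing.den K[X] g).2,
    (IsFractionRing.num_den_reduced K[X] g).isCoprime, ?_⟩
  rw [← IsFractionRing.mk'_eq_div, IsFractionRing.mk'_num_den]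

omit [CharZero K] in
lemma der_fraction (D : Der k) (hD : ∀ f, D (ι f) = ι (derivative f)) (a : K[X]) {b : K[X]}
    (hb : b ≠ 0) : D (ι a / ι b) * ι (b ^ 2) = ι (derivative a * b - a * derivative b) := by
  have hb' : ι b ≠ 0 := (map_ne_zero_iff _ algebraMap_injective).2 hb
  rw [D.map_div _ hb', hD, hD]
  simp only [map_sub, map_mul, map_pow]
  field_simp

lemma eq_C_of_der_eq_zero (D : Der k) (hD : ∀ f, D (ι f) = ι (derivative f)) {g : k}
    (hg : D g = 0) : ∃ c : K, g = ι (C c) := by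
  obtain ⟨a, b, hb, hab, rfl⟩ := exists_coprime_fraction g
  have h := der_fraction D hD a hb
  rw [hg, zero_mul, eq_comm, map_eq_zero_iff _ algebraMap_injective, sub_eq_zero] at h
  have hb0 : b.natDegree = 0 := natDegree_eq_zero_of_dvd_derivative
    (hab.symm.dvd_of_dvd_mul_left (Dvd.intro_left _ h))
  obtain ⟨b, rfl⟩ := natDegree_eq_zero.1 hb0
  have hb1 : b ≠ 0 := by simpa using hb
  simp only [derivative_C, mul_zero, mul_eq_zero, hb, or_false] at h
  obtain ⟨a, rfl⟩ := natDegree_eq_zero.1 (derivative_eq_zero.1 h)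
  refine ⟨a / b, ?_⟩
  rw [div_eq_iff ((map_ne_zero_iff _ algebraMap_injective).2 hb), ← map_mul, ← C_mul,
    div_mul_cancel₀ _ hb1]

lemma eq_prod_of_log_derivative {t : K} (D : Der k) (hD : ∀ f, D (ι f) = ι (derivative f))
    {φ : k} (hφ : φ ≠ 0) {ℓ : K[X]} (h : 2 * ι (cubic t) * D φ = ι ℓ * φ) :
    ∃ (c : K) (i j l : ℤ), c ≠ 0 ∧
      φ = ι (C c) * ι X ^ i * ι (X - 1) ^ j * ι (X - C t) ^ l := by
  obtain ⟨a, b, hb, hab, rfl⟩ := exists_coprime_fraction φ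
  have hb' : ι b ≠ 0 := (map_ne_zero_iff _ algebraMap_injective).2 hb
  have ha : a ≠ 0 := by rintro rfl; simp at hφ
  have h2 : 2 * cubic t * (derivative a * b - a * derivative b) = ℓ * a * b := by
    apply algebraMap_injective
    rw [map_mul, ← der_fraction D hD a hb]
    simp only [map_mul, map_pow, map_ofNat]
    rw [← mul_assoc, h]
    field_simp
  have hda : a ∣ cubic t * derivative a := by
    refine hab.dvd_of_dvd_mul_right (dvd_of_dvd_two_mul ?_)
    exact ⟨ℓ * b + 2 * cubic t * derivative b, by linear_combination h2⟩
  have hdb : b ∣ cubic t * derivative b := by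
    refine hab.symm.dvd_of_dvd_mul_right (dvd_of_dvd_two_mul ?_)
    exact ⟨-ℓ * a + 2 * cubic t * derivative a, by linear_combination -h2⟩
  obtain ⟨c₁, i₁, j₁, l₁, hc₁, rfl⟩ := eq_prod_of_dvd_cubic_mul_derivative ha hda
  obtain ⟨c₂, i₂, j₂, l₂, hc₂, rfl⟩ := eq_prod_of_dvd_cubic_mul_derivative hb hdb
  have hX : ι X ≠ 0 := (map_ne_zero_iff _ algebraMap_injective).2 X_ne_zero
  have hX1 : ι (X - 1) ≠ 0 := (map_ne_zero_iff _ algebraMap_injective).2 (X_sub_C_ne_zero 1)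
  have hXt : ι (X - C t) ≠ 0 := (map_ne_zero_iff _ algebraMap_injective).2 (X_sub_C_ne_zero t)
  have hc2' : ι (C c₂) ≠ 0 := (map_ne_zero_iff _ algebraMap_injective).2 (by simpa using hc₂)
  refine ⟨c₁ / c₂, i₁ - i₂, j₁ - j₂, l₁ - l₂, div_ne_zero hc₁ hc₂, ?_⟩
  rw [zpow_sub₀ hX, zpow_sub₀ hX1, zpow_sub₀ hXt]
  have : ι (C (c₁ / c₂)) = ι (C c₁) / ι (C c₂) := by
    rw [eq_div_iff hc2', ← map_mul, ← C_mul, div_mul_cancel₀ _ hc₂]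
  rw [this]
  simp only [zpow_natCast, map_mul, map_pow]
  field_simp

lemma not_dvd_den {t e : K} {E₀ : K[X]} (hE : cubic t = (X - C e) * E₀) (he : E₀.eval e ≠ 0)
    {a b ℓ : K[X]} (hb : b ≠ 0) (hab : IsCoprime a b)
    (h : 2 * cubic t * (derivative a * b - a * derivative b) + derivative (cubic t) * (a * b)
      = ℓ * b ^ 2) : ¬ X - C e ∣ b := by
  intro hd
  obtain ⟨b₀, hb₀, hnd⟩ := exists_eq_pow_rootMultiplicity_mul_and_not_dvd b hb e
  set n := rootMultiplicity e b with hn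
  have hn0 : 0 < n := by
    rw [hn, rootMultiplicity_pos hb]; exact dvd_iff_isRoot.1 hd
  obtain ⟨m, hm⟩ : ∃ m, n = m + 1 := ⟨n - 1, by omega⟩
  have ha : a.eval e ≠ 0 := by
    intro h0
    obtain ⟨u, v, huv⟩ := hab
    have := congrArg (eval e) huv
    have hb1 : b.eval e = 0 := dvd_iff_isRoot.1 hd
    simp [h0, hb1] at this
  have hb1 : b₀.eval e ≠ 0 := fun h0 => hnd (dvd_iff_isRoot.2 h0)
  rw [hm] at hb₀
  have hdb : derivative b =
      (X - C e) ^ m * (((m + 1 : ℕ) : K[X]) * b₀ + (X - C e) * derivative b₀) := by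
    rw [hb₀, derivative_mul, derivative_pow]
    simp; ring
  have hdE : derivative (cubic t) = E₀ + (X - C e) * derivative E₀ := by
    rw [hE, derivative_mul]; simp
  have h2 : (X - C e) ^ (m + 1) * (2 * cubic t * derivative a * b₀
      - 2 * E₀ * a * (((m + 1 : ℕ) : K[X]) * b₀ + (X - C e) * derivative b₀)
      + (E₀ + (X - C e) * derivative E₀) * a * b₀)
      = (X - C e) ^ (m + 1) * (ℓ * (X - C e) ^ (m + 1) * b₀ ^ 2) := by
    rw [hdb, hdE] at h
    rw [hE] at h ⊢
    rw [hb₀] at h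
    linear_combination h
  have h3 := mul_left_cancel₀ (pow_ne_zero _ (X_sub_C_ne_zero e)) h2
  have h4 := congrArg (eval e) h3
  rw [hE] at h4
  simp only [eval_add, eval_sub, eval_mul, eval_pow, eval_X, eval_C, sub_self, zero_mul, mul_zero,
    add_zero, zero_sub, eval_natCast, eval_ofNat, zero_pow (Nat.succ_ne_zero m)] at h4
  have h5 : (1 - 2 * ((m + 1 : ℕ) : K)) * (E₀.eval e * a.eval e * b₀.eval e) = 0 := by
    linear_combination h4
  have h6 : (1 - 2 * ((m + 1 : ℕ) : K)) ≠ 0 := by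
    intro h7
    have : ((2 * (m + 1) : ℕ) : K) = ((1 : ℕ) : K) := by push_cast at h7 ⊢; linear_combination -h7
    have := Nat.cast_injective this
    omega
  exact (mul_ne_zero h6 (mul_ne_zero (mul_ne_zero he ha) hb1)) h5

/-- The operator `2 E ∂ + E'` on rational functions takes linear values only at zero. -/
lemma eq_zero_of_cubic_operator {t : K} (ht0 : t ≠ 0) (ht1 : t ≠ 1) (D : Der k)
    (hD : ∀ f, D (ι f) = ι (derivative f)) {g : k} {α β : K}
    (h : 2 * ι (cubic t) * D g + ι (derivative (cubic t)) * g = ι (C α * X + C β)) : g = 0 := by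
  obtain ⟨a, b, hb, hab, rfl⟩ := exists_coprime_fraction g
  have hb' : ι b ≠ 0 := (map_ne_zero_iff _ algebraMap_injective).2 hb
  have h2 : 2 * cubic t * (derivative a * b - a * derivative b) + derivative (cubic t) * (a * b)
      = (C α * X + C β) * b ^ 2 := by
    apply algebraMap_injective
    rw [map_add, map_mul _ (2 * cubic t), ← der_fraction D hD a hb, map_mul _ _ (b ^ 2), ← h]
    simp only [map_mul, map_pow, map_ofNat]
    field_simp
  have hdb : b ∣ cubic t * derivative b := by
    refine hab.symm.dvd_of_dvd_mul_right (dvd_of_dvd_two_mul ?_)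
    exact ⟨2 * cubic t * derivative a + derivative (cubic t) * a - (C α * X + C β) * b,
      by linear_combination -h2⟩
  obtain ⟨c, i, j, l, hc, hbe⟩ := eq_prod_of_dvd_cubic_mul_derivative hb hdb
  have n0 := not_dvd_den (e := 0) (E₀ := (X - 1) * (X - C t)) (by simp [cubic]; ring)
    (by simpa using ht0) hb hab h2
  have n1 := not_dvd_den (e := 1) (E₀ := X * (X - C t)) (by simp [cubic]; ring)
    (by simpa [sub_eq_zero] using ht1.symm) hb hab h2
  have nt := not_dvd_den (e := t) (E₀ := X * (X - 1)) (by simp [cubic]; ring)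
    (by simpa [sub_eq_zero] using ⟨ht0, ht1⟩) hb hab h2
  have hi : i = 0 := by
    by_contra hi
    apply n0
    rw [hbe]
    exact dvd_mul_of_dvd_left (dvd_mul_of_dvd_left (dvd_mul_of_dvd_right
      (by rw [C_0, sub_zero]; exact dvd_pow_self _ hi) _) _) _
  have hj : j = 0 := by
    by_contra hj
    apply n1
    rw [hbe]
    exact dvd_mul_of_dvd_left (dvd_mul_of_dvd_right (by rw [C_1]; exact dvd_pow_self _ hj) _) _
  have hl : l = 0 := by
    by_contra hl
    apply nt
    rw [hbe]
    exact dvd_mul_of_dvd_right (dvd_pow_self _ hl) _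
  subst hi hj hl
  simp only [pow_zero, mul_one] at hbe
  subst hbe
  by_contra hne
  have ha : a ≠ 0 := by rintro rfl; simp at hne
  simp only [derivative_C, mul_zero, sub_zero] at h2
  have h3 : 2 * cubic t * derivative a + derivative (cubic t) * a = (C α * X + C β) * C c := by
    apply mul_right_cancel₀ hb
    linear_combination h2
  have h4 := congrArg (fun f => zcoeff f (a.natDegree + 2)) h3
  have h5 : 2 * cubic t * derivative a + derivative (cubic t) * a =
      C 2 * (X ^ 3 * derivative a) - C (2 * (1 + t)) * (X ^ 2 * derivative a)
      + C (2 * t) * (X * derivative a) + C 3 * (X ^ 2 * a) - C (2 * (1 + t)) * (X * a)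
      + C t * a := by
    rw [derivative_cubic, cubic_eq, C_mul, C_mul]
    simp only [show (C 2 : K[X]) = 2 from rfl, show (C 3 : K[X]) = 3 from rfl]
    ring
  have h6 : (C α * X + C β) * C c = C (c * α) * (X * C 1) + C (c * β) := by simp; ring
  rw [h5, h6] at h4
  have z1 : zcoeff a (a.natDegree + 1) = 0 := by
    rw [show ((a.natDegree : ℤ) + 1) = ((a.natDegree + 1 : ℕ) : ℤ) by push_cast; ring,
      zcoeff_natCast, coeff_eq_zero_of_natDegree_lt (by omega)]
  have z2 : zcoeff a (a.natDegree + 2) = 0 := by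
    rw [show ((a.natDegree : ℤ) + 2) = ((a.natDegree + 2 : ℕ) : ℤ) by push_cast; ring,
      zcoeff_natCast, coeff_eq_zero_of_natDegree_lt (by omega)]
  have z0 : zcoeff a a.natDegree = a.leadingCoeff := zcoeff_natCast _ _
  have zc (c : K) (n : ℕ) : zcoeff (C c) ((n : ℤ) + 1) = 0 := by
    rw [show ((n : ℤ) + 1) = ((n + 1 : ℕ) : ℤ) by push_cast; ring, zcoeff_natCast]; simp
  simp only [zcoeff_add, zcoeff_sub, zcoeff_C_mul, zcoeff_X_pow_mul, zcoeff_X_mul,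
    zcoeff_derivative] at h4
  rw [show ((a.natDegree : ℤ) + 2 - 1) = a.natDegree + 1 by ring, zc,
    show ((a.natDegree : ℤ) + 2) = ((a.natDegree + 1 : ℕ) : ℤ) + 1 by push_cast; ring, zc,
    show (((a.natDegree + 1 : ℕ) : ℤ) + 1) = a.natDegree + 2 by push_cast; ring,
    show ((a.natDegree : ℤ) + 2 - (3 : ℕ) + 1) = a.natDegree by push_cast; ring,
    show ((a.natDegree : ℤ) + 2 - (2 : ℕ) + 1) = a.natDegree + 1 by push_cast; ring,
    show ((a.natDegree : ℤ) + 1 + 1) = a.natDegree + 2 by ring,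
    show ((a.natDegree : ℤ) + 2 - (2 : ℕ)) = a.natDegree by push_cast; ring, z0, z1, z2] at h4
  have h7 : (2 * (a.natDegree : K) + 3) * a.leadingCoeff = 0 := by
    push_cast at h4
    linear_combination h4
  rcases mul_eq_zero.1 h7 with h8 | h8
  · have : ((2 * a.natDegree + 3 : ℕ) : K) = 0 := by push_cast; exact h8
    rw [Nat.cast_eq_zero] at this
    omega
  · exact ha (leadingCoeff_eq_zero.1 h8)

end ratfun

section top
variable {k : Type*} [Field k] [CharZero k]

/-- The leading coefficients of a semi-invariant of the vector field
`d + 2 E p ∂ + (v - E' p²) ∂/∂p + (v₂ - u²) ∂/∂u`. -/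
lemma top_of_semiInvariant (d e : Der k) (E v v₂ : k) (hE : E ≠ 0)
    (hop : ∀ (g : k) (n : ℤ), 2 * E * e g + e E * g = n → g = 0)
    (g : k[X][X]) (hg : g ≠ 0) (a b c : k)
    (h : vectorField d e (C (C (2 * E)) * C X) (C (C v) - C (C (e E)) * C X ^ 2)
      (C (C v₂) - X ^ 2) g = (C (C a) * C X + C (C b) + C (C c) * X) * g) :
    ∃ (N m : ℤ) (φ : k), φ ≠ 0 ∧ (N : ℤ) = weight g ∧ 0 ≤ m ∧ m ≤ N ∧
      (∀ i, zcoeff₂ g (N - i) i = if i = m then φ else 0) ∧ c = -m ∧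
      2 * E * e φ = (a + (N - m) * e E) * φ ∧
      ∃ w G : k, e w = 0 ∧ 2 * E * e G + e E * G + w + d φ / φ = b := by
  obtain ⟨N, hN⟩ : ∃ N : ℤ, N = (weight g : ℤ) := ⟨_, rfl⟩
  have hvan : ∀ j i : ℤ, N < j + i → zcoeff₂ g j i = 0 := by
    rw [hN]; exact (weight_le_iff g _).1 le_rfl
  have key (j i : ℤ) : d (zcoeff₂ g j i) + 2 * E * e (zcoeff₂ g (j - 1) i)
      + v * ((j + 1) * zcoeff₂ g (j + 1) i) - e E * ((j - 1) * zcoeff₂ g (j - 1) i)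
      + v₂ * ((i + 1) * zcoeff₂ g j (i + 1)) - (i - 1) * zcoeff₂ g j (i - 1)
      = a * zcoeff₂ g (j - 1) i + b * zcoeff₂ g j i + c * zcoeff₂ g j (i - 1) := by
    have h1 := congrArg (fun f => zcoeff₂ f j i) h
    simp only [vectorField_apply, sub_mul, add_mul, sq, mul_assoc, zcoeff₂_add, zcoeff₂_sub,
      zcoeff₂_C_C_mul, zcoeff₂_C_X_mul, zcoeff₂_X_mul, zcoeff₂_coeffDeriv_coeffDeriv,
      zcoeff₂_coeffDeriv_polyDeriv, zcoeff₂_derivative] at h1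
    rw [show j - 1 - 1 + 1 = j - 1 by ring, show i - 1 - 1 + 1 = i - 1 by ring] at h1
    push_cast at h1
    linear_combination h1
  have quot (x y A B : k) (hy : y ≠ 0) (hx : 2 * E * e x = A) (hy' : 2 * E * e y = B) :
      2 * E * e (x / y) = (A * y - x * B) / y ^ 2 := by
    rw [Der.map_div _ _ hy, ← hx, ← hy']; ring
  have top (i : ℤ) : 2 * E * e (zcoeff₂ g (N - i) i) = (a + (N - i) * e E) * zcoeff₂ g (N - i) i
      + (c + (i - 1)) * zcoeff₂ g (N - (i - 1)) (i - 1) := by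
    have h1 := key (N + 1 - i) i
    rw [hvan (N + 1 - i) i (by omega), hvan (N + 1 - i + 1) i (by omega),
      hvan (N + 1 - i) (i + 1) (by omega), show N + 1 - i - 1 = N - i by ring,
      show N + 1 - i = N - (i - 1) by ring] at h1
    rw [map_zero] at h1
    push_cast at h1
    linear_combination h1
  have low (i : ℤ) : 2 * E * e (zcoeff₂ g (N - 1 - i) i) + d (zcoeff₂ g (N - i) i) =
      (a + (N - 1 - i) * e E) * zcoeff₂ g (N - 1 - i) i
      + (c + (i - 1)) * zcoeff₂ g (N - 1 - (i - 1)) (i - 1) + b * zcoeff₂ g (N - i) i := by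
    have h1 := key (N - i) i
    rw [hvan (N - i + 1) i (by omega), hvan (N - i) (i + 1) (by omega),
      show N - i - 1 = N - 1 - i by ring] at h1
    rw [show N - 1 - (i - 1) = N - i by ring]
    push_cast at h1
    linear_combination h1
  obtain ⟨i₀, hi₀⟩ := exists_zcoeff₂_weight_ne_zero hg
  rw [← hN] at hi₀
  have hneg (i : ℤ) (hi : zcoeff₂ g (N - i) i ≠ 0) : 0 ≤ i := by
    by_contra! h0
    exact hi (zcoeff₂_of_neg_right _ _ h0)
  have hpos (i : ℤ) (hi : zcoeff₂ g (N - i) i ≠ 0) : i ≤ N := by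
    by_contra! h0
    exact hi (zcoeff₂_of_neg_left _ _ (by omega))
  obtain ⟨m, hm, hmax⟩ := Int.exists_greatest_of_bdd
    (P := fun i => zcoeff₂ g (N - i) i ≠ 0) ⟨N, hpos⟩ ⟨i₀, hi₀⟩
  obtain ⟨l, hl, hmin⟩ := Int.exists_least_of_bdd
    (P := fun i => zcoeff₂ g (N - i) i ≠ 0) ⟨0, hneg⟩ ⟨i₀, hi₀⟩
  have hbelow (i : ℤ) (hi : i < l) : zcoeff₂ g (N - i) i = 0 := by
    by_contra h0; exact absurd (hmin i h0) (by omega)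
  have habove (i : ℤ) (hi : m < i) : zcoeff₂ g (N - i) i = 0 := by
    by_contra h0; exact absurd (hmax i h0) (by omega)
  have hc : c = -m := by
    have h1 := top (m + 1)
    rw [habove (m + 1) (by omega), map_zero, show m + 1 - 1 = m by ring] at h1
    have h3 : (c + m) * zcoeff₂ g (N - m) m = 0 := by push_cast at h1; linear_combination -h1
    exact eq_neg_of_add_eq_zero_left ((mul_eq_zero.1 h3).resolve_right hm)
  have hlm : l = m := by
    have h1 := top l
    have h3 := top (l + 1)
    rw [hbelow (l - 1) (by omega)] at h1
    rw [show l + 1 - 1 = l by ring] at h3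
    have h4 := quot _ _ _ _ hl h3 h1
    have h5 : 2 * E * e (zcoeff₂ g (N - (l + 1)) (l + 1) / zcoeff₂ g (N - l) l)
        + e E * (zcoeff₂ g (N - (l + 1)) (l + 1) / zcoeff₂ g (N - l) l) = ((l - m : ℤ) : k) := by
      rw [h4, hc]
      field_simp
      push_cast
      ring
    have h6 := hop _ _ h5
    rw [div_eq_zero_iff, or_iff_left hl] at h6
    by_contra hne
    have hlm : l ≤ m := hmin m hm
    rw [h6, map_zero] at h3
    have h7 : (((l - m : ℤ) : k)) * zcoeff₂ g (N - l) l = 0 := by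
      rw [hc] at h3; push_cast at h3 ⊢; linear_combination -h3
    have h8 : ((l - m : ℤ) : k) = 0 := (mul_eq_zero.1 h7).resolve_right hl
    exact hne (by have := Int.cast_eq_zero.1 h8; omega)
  subst hlm
  have hl0 : ∀ i, zcoeff₂ g (N - i) i = if i = l then zcoeff₂ g (N - l) l else 0 := by
    intro i
    split_ifs with hi
    · rw [hi]
    · rcases lt_or_gt_of_ne hi with hi | hi
      · exact hbelow i hi
      · exact habove i hi
  have hφ := top l
  rw [hbelow (l - 1) (by omega), mul_zero, add_zero] at hφ
  have hlow (i : ℤ) (hi : i < l - 1) : zcoeff₂ g (N - 1 - i) i = 0 := by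
    by_contra hne
    obtain ⟨r, ⟨hr, hrl⟩, hrmin⟩ := Int.exists_least_of_bdd
      (P := fun i => zcoeff₂ g (N - 1 - i) i ≠ 0 ∧ i < l - 1) ⟨0, fun z hz => by
        by_contra! h0
        exact hz.1 (zcoeff₂_of_neg_right _ _ h0)⟩ ⟨i, hne, hi⟩
    have h0 : zcoeff₂ g (N - 1 - (r - 1)) (r - 1) = 0 := by
      by_contra h0
      exact absurd (hrmin _ ⟨h0, by omega⟩) (by omega)
    have h1 := low r
    have h3 := low (r + 1)
    rw [h0, hbelow r (by omega), map_zero, mul_zero, mul_zero, add_zero, add_zero, add_zero] at h1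
    rw [show r + 1 - 1 = r by ring, hbelow (r + 1) (by omega), map_zero, mul_zero, add_zero,
      add_zero] at h3
    have h4 := quot _ _ _ _ hr h3 h1
    have h5 : 2 * E * e (zcoeff₂ g (N - 1 - (r + 1)) (r + 1) / zcoeff₂ g (N - 1 - r) r)
        + e E * (zcoeff₂ g (N - 1 - (r + 1)) (r + 1) / zcoeff₂ g (N - 1 - r) r)
        = ((r - l : ℤ) : k) := by
      rw [h4, hc]
      field_simp
      push_cast
      ring
    have h6 := hop _ _ h5
    rw [div_eq_zero_iff, or_iff_left hr] at h6
    rw [h6, map_zero] at h3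
    have h7 : (((r - l : ℤ) : k)) * zcoeff₂ g (N - 1 - r) r = 0 := by
      rw [hc] at h3; push_cast at h3 ⊢; linear_combination -h3
    have := Int.cast_eq_zero.1 ((mul_eq_zero.1 h7).resolve_right hr)
    omega
  have hw := low (l - 1)
  rw [hlow (l - 1 - 1) (by omega), hbelow (l - 1) (by omega), map_zero, mul_zero, mul_zero,
    add_zero, add_zero, add_zero] at hw
  have hG := low l
  rw [hc] at hG
  refine ⟨N, l, zcoeff₂ g (N - l) l, hl, hN, hneg l hl, hpos l hl, hl0, hc, hφ,
    zcoeff₂ g (N - 1 - (l - 1)) (l - 1) / zcoeff₂ g (N - l) l,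
    zcoeff₂ g (N - 1 - l) l / zcoeff₂ g (N - l) l, ?_, ?_⟩
  · have h1 := quot _ _ _ _ hl hw hφ
    have h3 : 2 * E * e (zcoeff₂ g (N - 1 - (l - 1)) (l - 1) / zcoeff₂ g (N - l) l) = 0 := by
      rw [h1]; push_cast; field_simp; ring
    exact (mul_eq_zero.1 h3).resolve_left (mul_ne_zero two_ne_zero hE)
  · have h1 := quot _ _ _ _ hl (eq_sub_of_add_eq hG) hφ
    rw [h1]
    field_simp
    ring
end top

section Riccati
variable {A : Type*} [CommRing A]

/-- The Hamiltonian vector field `q' = 2 E p - B`, `p' = -E' p² + B' p - κ` together with the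
Riccati equation satisfied by the slope `u` of an invariant foliation. Here `e` is the derivation
with respect to `q`. -/
noncomputable def riccatiField (d e : Der A) (E B κ : A) : Der A[X][X] :=
  vectorField d e (C (C (2 * E)) * C X - C (C B))
    (C (C (e B)) * C X - C (C (e E)) * C X ^ 2 - C (C κ))
    (C (C (e (e B))) * C X - C (C (e (e E))) * C X ^ 2
      - 2 * (2 * C (C (e E)) * C X - C (C (e B))) * X - 2 * C (C E) * X ^ 2)

lemma zcoeff₂_C_C (a : A) (j k : ℤ) : zcoeff₂ (C (C a)) j k = if j = 0 ∧ k = 0 then a else 0 := by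
  rcases lt_or_ge k 0 with hk | hk
  · rw [zcoeff₂_of_neg_right _ _ hk, if_neg (by omega)]
  rcases lt_or_ge j 0 with hj | hj
  · rw [zcoeff₂_of_neg_left _ _ hj, if_neg (by omega)]
  lift j to ℕ using hj
  lift k to ℕ using hk
  rw [zcoeff₂_natCast, coeff_C]
  split_ifs with h1 h2 h2
  · simp_all
  · rw [coeff_C, if_neg (by simpa [h1] using h2)]
  · simp_all
  · simp

lemma weight_riccatiField_le (d e : Der A) (E B κ : A) (f : A[X][X]) :
    weight (riccatiField d e E B κ f) ≤ weight f + 1 := by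
  rw [weight_le_iff]
  intro j i hji
  push_cast at hji
  have hvan : ∀ j i : ℤ, (weight f : ℤ) < j + i → zcoeff₂ f j i = 0 :=
    (weight_le_iff f _).1 le_rfl
  have two (g : A[X][X]) : (2 : A[X][X]) * g = C (C 2) * g := by
    rw [show (C (C 2) : A[X][X]) = 2 from rfl]
  simp only [riccatiField, vectorField_apply, sub_mul, add_mul, sq, mul_assoc, two, zcoeff₂_add,
    zcoeff₂_sub, mul_sub, zcoeff₂_C_C_mul, zcoeff₂_C_X_mul, zcoeff₂_X_mul,
    zcoeff₂_coeffDeriv_coeffDeriv, zcoeff₂_coeffDeriv_polyDeriv, zcoeff₂_derivative]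
  repeat rw [hvan _ _ (by omega)]
  simp

end Riccati

lemma affine_eval₂_injective {A T : Type*} [CommRing A] [CommRing T] [IsDomain T] (φ : A →+* T)
    (hφ : Function.Injective φ) (w z : T) (hw : w ≠ 0) :
    Function.Injective (eval₂RingHom (C.comp φ) (C w * X + C z)) := by
  rw [injective_iff_map_eq_zero]
  intro p hp
  have h1 : (p.map φ).comp (C w * X + C z) = 0 := by
    rw [comp, eval₂_map]; exact hp
  rcases comp_eq_zero_iff.1 h1 with h2 | ⟨-, h2⟩
  · exact (Polynomial.map_eq_zero_iff hφ).1 h2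
  · have := congrArg (fun f => coeff f 1) h2
    simp [coeff_C] at this
    exact absurd this hw

section chart
variable {A k : Type*} [CommRing A] [Field k] (φ : A →+* k)

/-- The substitution `p ↦ p + b`, `u ↦ (u - E' p) / (2 E) + c`. -/
noncomputable def chart (E₂ E' b c : k) : A[X][X] →+* k[X][X] :=
  eval₂RingHom (C.comp (eval₂RingHom (C.comp φ) (C 1 * X + C b)))
    (C (C E₂⁻¹) * X + C (C c - C (E₂⁻¹ * E') * X))

variable (E₂ E' b c : k)

@[simp] lemma chart_C_C (a : A) : chart φ E₂ E' b c (C (C a)) = C (C (φ a)) := by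
  simp [chart]
@[simp] lemma chart_C_X : chart φ E₂ E' b c (C X) = C X + C (C b) := by
  simp [chart]
@[simp] lemma chart_X : chart φ E₂ E' b c X =
    C (C E₂⁻¹) * X + (C (C c) - C (C (E₂⁻¹ * E')) * C X) := by
  simp [chart]

variable {φ E₂} in
lemma chart_injective (hφ : Function.Injective φ) (hE : E₂ ≠ 0) :
    Function.Injective (chart φ E₂ E' b c) := by
  refine affine_eval₂_injective _ (affine_eval₂_injective φ hφ _ _ one_ne_zero) _ _ ?_
  simpa using hE

/-- In suitable coordinates the Riccati vector field is in normal form. -/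
lemma riccatiField_chart [CharZero k] (hφ : Function.Injective φ) (d e : Der A)
    (hcomm : ∀ a, d (e a) = e (d a)) (d' e' : Der k) (hd : ∀ a, d' (φ a) = φ (d a))
    (he : ∀ a, e' (φ a) = φ (e a)) {E B κ : A} (hE : E ≠ 0)
    (s : k) (hs : 2 * φ E * s = -φ (d E)) (b : k) (hb : 2 * φ E * b = φ B) :
    ∃ v v₂ : k, ∀ f, vectorField d' e' (C (C (2 * φ E)) * C X)
      (C (C v) - C (C (e' (φ E))) * C X ^ 2) (C (C v₂) - X ^ 2)
        (chart φ (2 * φ E) (φ (e E)) b (e' b - s / (2 * φ E)) f)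
      = chart φ (2 * φ E) (φ (e E)) b (e' b - s / (2 * φ E)) (riccatiField d e E B κ f) := by
  have hE' : φ E ≠ 0 := (map_ne_zero_iff _ hφ).2 hE
  have hE2 : 2 * φ E ≠ 0 := mul_ne_zero two_ne_zero hE'
  set c := e' b - s / (2 * φ E) with hc
  have hc1 : 2 * φ E * c = 2 * φ E * e' b - s := by rw [hc]; field_simp
  have hdk2 : d' (2 : k) = 0 := d'.map_ofNat 2
  have hek2 : e' (2 : k) = 0 := e'.map_ofNat 2
  have hB1 : φ (e B) = 2 * φ E * e' b + 2 * b * φ (e E) := by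
    have := congrArg e' hb
    rw [Der.leibniz, Der.leibniz, hek2, he, he] at this
    rw [← this]; ring
  have hB2 : φ (e (e B)) = 2 * φ E * e' (e' b) + 4 * φ (e E) * e' b + 2 * b * φ (e (e E)) := by
    have := congrArg e' hB1
    simp only [map_add, Der.leibniz, hek2, he] at this
    rw [this]; ring
  have hdE' : φ (d (e E)) = - 2 * φ (e E) * s - 2 * φ E * e' s := by
    have := congrArg e' hs
    rw [map_neg, he, Der.leibniz, Der.leibniz, hek2, he, ← hcomm] at this
    linear_combination this
  refine ⟨-φ (e E) * b ^ 2 + φ (e B) * b - φ κ - d' b, 2 * φ E *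
    (φ (e (e B)) * b - φ (e (e E)) * b ^ 2 - 2 * (2 * φ (e E) * b - φ (e B)) * c
      - 2 * φ E * c ^ 2) + φ (e E) * (-φ (e E) * b ^ 2 + φ (e B) * b - φ κ - d' b)
      - 2 * φ E * d' c, fun f => ?_⟩
  refine intertwine₂ (chart φ (2 * φ E) (φ (e E)) b c) (riccatiField d e E B κ) _
    (fun a => ?_) ?_ ?_ f
  · simp only [chart_C_C, riccatiField, vectorField_C_C, map_add, map_sub, map_mul, chart_C_X, hd,
      he, ← hb, map_ofNat]
    ring
  · simp only [chart_C_C, riccatiField, vectorField_C_C, vectorField_C_X, map_add, map_sub,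
      map_mul, map_pow, chart_C_X, he, map_ofNat, hB1, map_neg]
    ring
  · have hs1 : s = 2 * φ E * e' b - 2 * φ E * c := by rw [hc1]; ring
    have hs2 : e' s = 2 * φ E * e' (e' b) + 2 * φ (e E) * e' b - 2 * φ E * e' c
        - 2 * φ (e E) * c := by
      rw [hs1]
      simp only [map_sub, Der.leibniz, hek2, he]
      ring
    have hdE : φ (d E) = - (2 * φ E * s) := by rw [hs, neg_neg]
    rw [hs2, hs1] at hdE'
    rw [hs1] at hdE
    clear_value c
    set T := chart φ (2 * φ E) (φ (e E)) b c X with hT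
    have hT1 : C (C (2 * φ E)) * T = X - C (C (φ (e E))) * C X + C (C (2 * φ E * c)) := by
      have hi : (C (C (2 * φ E)) * C (C (2 * φ E)⁻¹) : k[X][X]) = 1 := by
        rw [← C_mul, ← C_mul, mul_inv_cancel₀ hE2, C_1, C_1]
      rw [hT, chart_X]
      simp only [map_mul] at hi ⊢
      linear_combination (X - C (C (φ (e E))) * C X) * hi
    set Dk := vectorField d' e' _ _ _ with hDk
    have h1 := congrArg Dk hT1
    refine mul_left_cancel₀ (b := Dk T) (a := C (C (2 * φ E))) (by simpa using hE') ?_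
    simp only [Der.leibniz, map_add, map_sub] at h1
    rw [hDk] at h1
    simp only [vectorField_C_C, vectorField_C_X, vectorField_X] at h1
    rw [← hDk] at h1
    simp only [riccatiField, vectorField_X, map_sub, map_mul, map_pow, map_ofNat,
      chart_C_C, chart_C_X, ← hT]
    simp only [map_sub, map_add, map_mul, map_pow, map_ofNat, Der.leibniz, hek2, hdk2, hd, he, hdE,
      hdE', map_neg, map_zero, hB1, hB2] at h1 hT1 ⊢
    linear_combination h1 + (2 * (2 * C (C (φ (e E))) * (C X + C (C b))
      - (2 * C (C (φ E)) * C (C (e' b)) + 2 * C (C b) * C (C (φ (e E)))))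
      + 2 * (2 * C (C (φ E)) * C (C (e' b)) - 2 * C (C (φ E)) * C (C c))
      - 2 * C (C (φ (e E))) * C X + 2 * C (C (φ E)) * T
      + (X - C (C (φ (e E))) * C X + 2 * C (C (φ E)) * C (C c))) * hT1
end chart

lemma Der.map_zpow {F : Type*} [Field F] (δ : Der F) {x : F} (hx : x ≠ 0) (n : ℤ) :
    δ (x ^ n) = n * x ^ n * (δ x / x) := by
  have nat (n : ℕ) : δ (x ^ n) = n * x ^ n * (δ x / x) := by
    rw [Der.leibniz_pow]
    rcases n with _ | n
    · simp
    · rw [Nat.add_sub_cancel, pow_succ]; field_simp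
  rcases n with n | n
  · simpa using nat n
  · rw [zpow_negSucc, Der.map_inv _ (pow_ne_zero _ hx), nat]
    push_cast
    field_simp

section
variable {K : Type*} [Field K]

/-- The linear term of the Hamiltonian of the sixth Painlevé equation. -/
noncomputable def linTerm (t κ₀ κ₁ θ : K) : K[X] :=
  C κ₀ * (X - 1) * (X - C t) + C κ₁ * X * (X - C t) + C (θ - 1) * X * (X - 1)

/-- The vector field of the sixth Painlevé equation extended by the Riccati equation. -/
noncomputable def sixthField (d : Der K) (t κ₀ κ₁ θ κ : K) : Der K[X][X][X] :=
  riccatiField (coeffDeriv d) (polyDeriv K) (cubic t) (linTerm t κ₀ κ₁ θ) (C κ)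

lemma coeffDeriv_cubic {d : Der K} {t : K} (ht : d t = t * (t - 1)) :
    coeffDeriv d (cubic t) = - C (t * (t - 1)) * X * (X - 1) := by
  simp only [cubic, Der.leibniz, map_sub, coeffDeriv_X, coeffDeriv_C, Der.map_one, ht]
  ring

lemma coeffDeriv_polyDeriv_comm {A : Type*} [CommRing A] (d : Der A) (f : A[X]) :
    coeffDeriv d (polyDeriv A f) = polyDeriv A (coeffDeriv d f) := by
  ext n
  rw [coeff_coeffDeriv, polyDeriv_apply, polyDeriv_apply, coeff_derivative, coeff_derivative,
    coeff_coeffDeriv, Der.leibniz, map_add, Der.map_natCast, Der.map_one]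
  ring

lemma cubic_ne_zero (t : K) : cubic t ≠ 0 :=
  mul_ne_zero (mul_ne_zero X_ne_zero (X_sub_C_ne_zero 1)) (X_sub_C_ne_zero t)

variable [CharZero K]

local notation "k" => FractionRing K[X]
local notation "ι" => algebraMap K[X] (FractionRing K[X])

omit [CharZero K] in
/-- The logarithmic derivative of a product of powers of `q`, `q - 1` and `q - t`. -/
lemma der_prod (D : Der k) {t c : K} (hc : c ≠ 0) {i j l : ℤ} {φ : k}
    (hφ : φ = ι (C c) * ι X ^ i * ι (X - 1) ^ j * ι (X - C t) ^ l) :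
    D φ = φ * (D (ι (C c)) / ι (C c) + i * (D (ι X) / ι X) + j * (D (ι (X - 1)) / ι (X - 1))
      + l * (D (ι (X - C t)) / ι (X - C t))) := by
  have ne {f : K[X]} (hf : f ≠ 0) : ι f ≠ 0 := (map_ne_zero_iff _ algebraMap_injective).2 hf
  have h0 := ne (C_ne_zero.2 hc)
  have h1 := ne (X_ne_zero (R := K))
  have h2 := ne (X_sub_C_ne_zero (1 : K))
  have h3 := ne (X_sub_C_ne_zero t)
  rw [C_1] at h2
  rw [hφ, Der.leibniz, Der.leibniz, Der.leibniz, Der.map_zpow _ h1, Der.map_zpow _ h2,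
    Der.map_zpow _ h3]
  field_simp
  ring

/-- The residue relation coming from the subleading coefficient of a semi-invariant. -/
lemma residue_relation {d : Der K} {t κ₀ κ₁ θ : K} (ht : d t = t * (t - 1)) (ht0 : t ≠ 0)
    (ht1 : t ≠ 1) (d' e' : Der k) (hd : ∀ a, d' (ι a) = ι (coeffDeriv d a))
    (he : ∀ a, e' (ι a) = ι (derivative a)) {N m a₀ a₁ aₜ : ℤ} {l₀ l₁ c : K} (hc : c ≠ 0)
    {φ G w : k} (hφ : φ = ι (C c) * ι X ^ a₀ * ι (X - 1) ^ a₁ * ι (X - C t) ^ aₜ)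
    (hw : e' w = 0) {ℓ : K[X]}
    (hℓ : ℓ = 2 * ((a₀ : K[X]) * ((X - 1) * (X - C t)) + (a₁ : K[X]) * (X * (X - C t))
      + (aₜ : K[X]) * (X * (X - 1))) - (N : K[X]) * derivative (cubic t)) {b s : k}
    (hb : 2 * ι (cubic t) * b = ι (linTerm t κ₀ κ₁ θ))
    (hs : 2 * ι (cubic t) * s = - ι (coeffDeriv d (cubic t)))
    (hG : 2 * ι (cubic t) * e' G + ι (derivative (cubic t)) * G + w + d' φ / φ =
      ι (C l₁ * X + C l₀) + ι ℓ * b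
        - m * (ι (derivative (linTerm t κ₀ κ₁ θ)) - 2 * b * ι (derivative (cubic t))) + m * s) :
    2 * l₁ + (2 * (a₀ + a₁ + aₜ) - 3 * N + 2 * m) * (κ₀ + κ₁ + θ - 1)
      + (2 * a₀ + 2 * m - N) * κ₀ + (2 * a₁ + 2 * m - N) * κ₁ + (2 * aₜ + 2 * m - N) * θ
      + (N - m) = 0 := by
  obtain ⟨w₀, rfl⟩ := eq_C_of_der_eq_zero e' he hw
  have ne {f : K[X]} (hf : f ≠ 0) : ι f ≠ 0 := (map_ne_zero_iff _ algebraMap_injective).2 hf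
  have h0 := ne (C_ne_zero.2 hc)
  have h1 := ne (X_ne_zero (R := K))
  have h2 := ne (X_sub_C_ne_zero (1 : K))
  have h3 := ne (X_sub_C_ne_zero t)
  have hφ0 : φ ≠ 0 := by
    rw [hφ]
    rw [C_1] at h2
    positivity
  set n₀ : K := a₀ - N / 2 + m with hn₀
  set n₁ : K := a₁ - N / 2 + m with hn₁
  set nₜ : K := aₜ - N / 2 + m with hnₜ
  set r₀ : K := n₀ * κ₀ with hr₀
  set r₁ : K := n₁ * κ₁ with hr₁
  set rₜ : K := nₜ * θ + (N - m) / 2 with hrₜ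
  set S : K := κ₀ + κ₁ + θ - 1 with hS
  set B₁ : K := - κ₀ * (1 + t) - κ₁ * t - (θ - 1) with hB₁
  have key : 2 * ι (cubic t) * e' (G + ι (C r₀) / ι X + ι (C r₁) / ι (X - 1)
      + ι (C rₜ) / ι (X - C t)) + ι (derivative (cubic t)) * (G + ι (C r₀) / ι X
      + ι (C r₁) / ι (X - 1) + ι (C rₜ) / ι (X - C t)) =
      ι (C (l₁ + S * (n₀ + n₁ + nₜ - 2 * m) + r₀ + r₁ + rₜ) * X +
        C (l₀ - w₀ - d c / c + n₀ * B₁ + n₁ * (B₁ + S) + nₜ * (B₁ + S * t) - m * B₁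
          - r₁ - rₜ * t)) := by
    rw [C_1] at h2
    have heC (a : K) : e' (ι (C a)) = 0 := by rw [he, derivative_C, map_zero]
    have heX : e' (ι X) = 1 := by rw [he, derivative_X, map_one]
    have hdC (a : K) : d' (ι (C a)) = ι (C (d a)) := by rw [hd, coeffDeriv_C]
    have hdX : d' (ι X) = 0 := by rw [hd, coeffDeriv_X, map_zero]
    have hE : ι (cubic t) = ι X * (ι X - 1) * (ι X - ι (C t)) := by simp [cubic]
    have hdiv (x y : K) : ι (C (x / y)) = ι (C x) / ι (C y) :=
      map_div₀ ((algebraMap K[X] k).comp C) x y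
    have hE0 := ne (cubic_ne_zero t)
    have hb' : b = ι (linTerm t κ₀ κ₁ θ) / (2 * ι (cubic t)) := by
      rw [← hb]; field_simp
    have hs' : s = ι (C (t * (t - 1)) * X * (X - 1)) / (2 * ι (cubic t)) := by
      rw [coeffDeriv_cubic ht, neg_mul, neg_mul, map_neg, neg_neg] at hs
      rw [← hs]; field_simp
    rw [der_prod d' hc hφ, mul_div_cancel_left₀ _ hφ0, hb', hs', hℓ] at hG
    clear hb' hs' hb hs hφ hφ0 hℓ hw
    rw [map_add e', map_add e', map_add e', e'.map_div _ h1, e'.map_div _ h2, e'.map_div _ h3, heC,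
      heC, heC]
    simp only [hE, derivative_cubic, linTerm, map_add, map_sub, map_mul, map_one, map_ofNat,
      derivative_mul, derivative_X, derivative_C, derivative_one, map_neg, map_zero, hdC, hdX, ht,
      Der.map_one, map_intCast, map_pow, heC, heX, hdiv, hS, hB₁, hr₀, hr₁, hrₜ, hn₀, hn₁,
      hnₜ] at hG h1 h2 h3 ⊢
    generalize ι (C t) = T at *
    generalize ι (C κ₀) = k₀ at *
    generalize ι (C κ₁) = k₁ at *
    generalize ι (C θ) = k₂ at *
    generalize ι X = x at *
    generalize ι (C (d c)) / ι (C c) = γ at *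
    linear_combination (norm := skip) hG
    field_simp
    ring
  have hG1 := eq_zero_of_cubic_operator ht0 ht1 e' he key
  rw [hG1, map_zero, mul_zero, mul_zero, add_zero, eq_comm, map_eq_zero_iff _ algebraMap_injective]
    at key
  have : ∀ x y : K, C x * X + C y = 0 → x = 0 := fun x y hxy => by
    simpa [coeff_C] using congrArg (fun f => coeff f 1) hxy
  replace this := this _ _ key
  rw [hr₀, hr₁, hrₜ, hn₀, hn₁, hnₜ] at this
  linear_combination 2 * this
end

section
variable {k : Type*} [Field k]

/-- The substitution `p ↦ p - b`, `u ↦ w p + z`. -/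
noncomputable def slice (b w z : k) : k[X][X] →+* k[X] :=
  eval₂RingHom (compRingHom (X - C b)) (C w * X + C z)

lemma natDegree_slice_le (b w z : k) {g : k[X][X]} {n : ℕ} (hg : weight g ≤ n) :
    (slice b w z g).natDegree ≤ n := by
  change (g.eval₂ (compRingHom (X - C b)) (C w * X + C z)).natDegree ≤ n
  rw [eval₂_eq_sum, sum_def]
  refine natDegree_sum_le_of_forall_le _ _ fun i hi => ?_
  have h1 : (g.coeff i).natDegree + i ≤ n := by
    by_contra! h1
    have h2 := (weight_le_iff g n).1 hg (g.coeff i).natDegree i (by exact_mod_cast h1)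
    rw [zcoeff₂_natCast] at h2
    exact mem_support_iff.1 hi (leadingCoeff_eq_zero.1 h2)
  refine natDegree_mul_le.trans (le_trans (add_le_add ?_ ?_) h1)
  · exact natDegree_comp_le.trans (by simp)
  · refine natDegree_pow_le.trans ?_
    have : (C w * X + C z).natDegree ≤ 1 := natDegree_linear_le
    nlinarith

lemma eq_C_C_of_weight_eq_zero {g : k[X][X]} (h : weight g = 0) : g = C (C (zcoeff₂ g 0 0)) := by
  have hvan := (weight_le_iff g 0).1 h.le
  have h1 := weight_le_one_form (f := g) (by omega)
  rw [hvan 1 0 (by simp), hvan 0 1 (by simp)] at h1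
  simpa using h1

lemma coeff_slice (b w z φ : k) {g : k[X][X]}
    (h : ∀ i, zcoeff₂ g (weight g - i) i = if i = weight g then φ else 0) :
    (slice b w z g).coeff (weight g) = φ * w ^ weight g := by
  have hX (n : ℕ) (j i : ℤ) : zcoeff₂ (C (C φ) * X ^ n) j i = if j = 0 ∧ i = n then φ else 0 := by
    have : zcoeff₂ (X ^ n * C (C φ)) j i = zcoeff₂ (C (C φ)) j (i - n) := by
      rw [zcoeff₂, zcoeff_X_pow_mul]; rfl
    rw [mul_comm, this, zcoeff₂_C_C]
    simp only [sub_eq_zero]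
  have hvan : ∀ j i : ℤ, (weight g : ℤ) < j + i → zcoeff₂ g j i = 0 :=
    (weight_le_iff g _).1 le_rfl
  have hev : slice b w z (C (C φ) * X ^ weight g) = C φ * (C w * X + C z) ^ weight g := by
    simp [slice]
  have htop : (C φ * (C w * X + C z) ^ weight g).coeff (weight g) = φ * w ^ weight g := by
    rw [coeff_C_mul]
    congr 1
    have := coeff_pow_of_natDegree_le (p := C w * X + C z) (n := 1) natDegree_linear_le
      (m := weight g)
    simpa using this
  have hg : g = (g - C (C φ) * X ^ weight g) + C (C φ) * X ^ weight g := by ring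
  rcases Nat.eq_zero_or_pos (weight g) with h0 | h0
  · have h1 := h 0
    have h2 := eq_C_C_of_weight_eq_zero h0
    rw [h0, Nat.cast_zero, sub_zero, if_pos rfl] at h1
    rw [h1] at h2
    rw [← htop, ← hev, h0, pow_zero, mul_one, ← h2]
  · have hw : weight (g - C (C φ) * X ^ weight g) ≤ weight g - 1 := by
      rw [weight_le_iff]
      intro j i hji
      rw [zcoeff₂_sub, hX]
      rcases lt_or_eq_of_le (show (weight g : ℤ) ≤ j + i by omega) with hlt | heq
      · rw [hvan _ _ hlt, if_neg (by omega), sub_zero]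
      · have := h i
        rw [show (weight g : ℤ) - i = j by omega] at this
        rw [this]
        split_ifs <;> first | omega | simp
    have hd := natDegree_slice_le b w z hw
    have : slice b w z g = slice b w z (g - C (C φ) * X ^ weight g)
        + C φ * (C w * X + C z) ^ weight g := by
      rw [← hev, ← map_add, ← hg]
    rw [this, coeff_add, htop, coeff_eq_zero_of_natDegree_lt (by omega), zero_add]

lemma slice_chart {A : Type*} [CommRing A] (φ : A →+* k) {E₂ : k} (hE : E₂ ≠ 0) (E' b c : k)
    (f : A[X][X]) : slice b E' (-(E₂ * c) - E' * b) (chart φ E₂ E' b c f) = (f.coeff 0).map φ := by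
  have : (slice b E' (-(E₂ * c) - E' * b)).comp (chart φ E₂ E' b c)
      = (mapRingHom φ).comp (evalRingHom 0) := by
    refine ringHom_ext' (ringHom_ext' (RingHom.ext fun a => ?_) ?_) ?_
    · simp [slice]
    · simp [slice]
    · have : (C E₂⁻¹ * C E₂ : k[X]) = 1 := by rw [← C_mul, inv_mul_cancel₀ hE, C_1]
      simp [slice]
      linear_combination (-C c) * this
  have := congrArg (fun ψ => ψ f) this
  simpa [coeff_zero_eq_eval_zero] using this
end

section
variable {K : Type*} [Field K] [CharZero K]

local notation "k" => FractionRing K[X]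
local notation "ι" => algebraMap K[X] (FractionRing K[X])

omit [CharZero K] in
lemma eq_C_of_top {t c : K} (ht0 : t ≠ 0) {f : K[X][X][X]} {b z : k} {E₂ : k} (hE : E₂ ≠ 0)
    (hc : c ≠ 0) {a₀ a₁ aₜ m : ℤ} {φ : k}
    (hφ : φ = ι (C c) * ι X ^ a₀ * ι (X - 1) ^ a₁ * ι (X - C t) ^ aₜ)
    (h : ∀ i, zcoeff₂ (chart ι E₂ (ι (derivative (cubic t))) b z f)
      (weight (chart ι E₂ (ι (derivative (cubic t))) b z f) - i) i
      = if i = weight (chart ι E₂ (ι (derivative (cubic t))) b z f) then φ else 0)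
    (hm : m = weight (chart ι E₂ (ι (derivative (cubic t))) b z f)) (h₀ : 2 * a₀ + m = 0)
    (h₁ : 2 * a₁ + m = 0) (hₜ : 2 * aₜ + m = 0) : ∃ c : K, f = C (C (C c)) := by
  have ne {f : K[X]} (hf : f ≠ 0) : ι f ≠ 0 := (map_ne_zero_iff _ algebraMap_injective).2 hf
  have h0 := ne (C_ne_zero.2 hc)
  have h1 := ne (X_ne_zero (R := K))
  have h2 := ne (X_sub_C_ne_zero (1 : K))
  have h3 := ne (X_sub_C_ne_zero t)
  rw [C_1] at h2
  have hs := coeff_slice b (ι (derivative (cubic t))) (-(E₂ * z) - ι (derivative (cubic t)) * b) φ h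
  rw [slice_chart _ hE, coeff_map] at hs
  generalize hg : chart ι E₂ (ι (derivative (cubic t))) b z f = g at *
  generalize hn : weight g = n at *
  subst hm
  rcases Nat.eq_zero_or_pos n with rfl | hpos
  · have hgφ : g = C (C φ) := by
      have h00 := h 0
      rw [Nat.cast_zero, sub_zero, if_pos rfl] at h00
      rw [eq_C_C_of_weight_eq_zero hn, h00]
    refine ⟨c, chart_injective (φ := ι) (E' := ι (derivative (cubic t))) (b := b) (c := z)
      algebraMap_injective hE ?_⟩
    rw [hg, hgφ, chart_C_C, hφ]
    obtain ⟨rfl, rfl, rfl⟩ : a₀ = 0 ∧ a₁ = 0 ∧ aₜ = 0 := by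
      push_cast at *; omega
    simp
  · exfalso
    have hsq : φ ^ 2 * ι (cubic t) ^ n = ι (C c) ^ 2 := by
      have e1 : ι (cubic t) ^ n = (ι X * ι (X - 1) * ι (X - C t)) ^ (n : ℤ) := by
        rw [zpow_natCast, cubic, map_mul, map_mul]
      rw [hφ, e1, mul_zpow, mul_zpow, mul_pow, mul_pow, mul_pow, ← zpow_natCast (_ ^ a₀),
        ← zpow_natCast (_ ^ a₁), ← zpow_natCast (_ ^ aₜ), ← zpow_mul, ← zpow_mul, ← zpow_mul,
        show a₀ * (2 : ℕ) = -n by push_cast; omega, show a₁ * (2 : ℕ) = -n by push_cast; omega,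
        show aₜ * (2 : ℕ) = -n by push_cast; omega, zpow_neg, zpow_neg, zpow_neg]
      field_simp
    have hpoly : ((f.coeff 0).coeff n) ^ 2 * cubic t ^ n =
        C c ^ 2 * (derivative (cubic t) ^ n) ^ 2 := by
      apply algebraMap_injective
      simp only [map_mul, map_pow]
      rw [hs, ← hsq]
      ring
    have := congrArg (eval 0) hpoly
    simp only [eval_mul, eval_pow, eval_zero_derivative_cubic, eval_C] at this
    rw [show eval 0 (cubic t) = 0 by simp [cubic], zero_pow hpos.ne', mul_zero, eq_comm] at this
    have h5 : c ^ 2 * (t ^ n) ^ 2 ≠ 0 := by positivity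
    exact h5 this

lemma finite_chart {d : Der K} {t κ₀ κ₁ θ κ : K} (ht : d t = t * (t - 1)) (ht0 : t ≠ 0)
    (ht1 : t ≠ 1) {f : K[X][X][X]} (hf : f ≠ 0) {la lb lc : K[X]}
    (h : sixthField d t κ₀ κ₁ θ κ f = (C (C la) * C X + C (C lb) + C (C lc) * X) * f) :
    ∃ N m a₀ a₁ aₜ : ℤ, lc = - (2 * (m : K[X]) * cubic t) ∧
      la = 2 * ((a₀ : K[X]) * ((X - 1) * (X - C t)) + (a₁ : K[X]) * (X * (X - C t))
        + (aₜ : K[X]) * (X * (X - 1))) - (N : K[X]) * derivative (cubic t) ∧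
      (∀ l₀ l₁, lb = C l₁ * X + C l₀ →
        2 * l₁ + (2 * (a₀ + a₁ + aₜ) - 3 * N + 2 * m) * (κ₀ + κ₁ + θ - 1)
          + (2 * a₀ + 2 * m - N) * κ₀ + (2 * a₁ + 2 * m - N) * κ₁ + (2 * aₜ + 2 * m - N) * θ
          + (N - m) = 0) ∧
      (N = m → 2 * a₀ + m = 0 → 2 * a₁ + m = 0 → 2 * aₜ + m = 0 → ∃ c, f = C (C (C c))) := by
  obtain ⟨d', hd⟩ := exists_extend_fractionRing (coeffDeriv d)
  obtain ⟨e', he⟩ := exists_extend_fractionRing (polyDeriv K)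
  have hE0 : ι (cubic t) ≠ 0 := (map_ne_zero_iff _ algebraMap_injective).2 (cubic_ne_zero t)
  have hE2 : 2 * ι (cubic t) ≠ 0 := mul_ne_zero two_ne_zero hE0
  obtain ⟨s, hs⟩ : ∃ s, 2 * ι (cubic t) * s = - ι (coeffDeriv d (cubic t)) :=
    ⟨_, mul_div_cancel₀ _ hE2⟩
  obtain ⟨b, hb⟩ : ∃ b, 2 * ι (cubic t) * b = ι (linTerm t κ₀ κ₁ θ) := ⟨_, mul_div_cancel₀ _ hE2⟩
  obtain ⟨v, v₂, hΨ⟩ := riccatiField_chart (φ := ι) (κ := C κ) algebraMap_injective (coeffDeriv d)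
    (polyDeriv K) (fun a => coeffDeriv_polyDeriv_comm d a) d' e' hd he (cubic_ne_zero t) s hs b hb
  have hD := hΨ f
  change _ = chart _ _ _ _ _ (sixthField d t κ₀ κ₁ θ κ f) at hD
  set c := e' b - s / (2 * ι (cubic t)) with hc
  have hc1 : 2 * ι (cubic t) * c = 2 * ι (cubic t) * e' b - s := by rw [hc]; field_simp
  set E' := ι (derivative (cubic t)) with hE'
  change vectorField _ _ _ _ _ (chart ι (2 * ι (cubic t)) E' b c f)
    = chart ι (2 * ι (cubic t)) E' b c (sixthField d t κ₀ κ₁ θ κ f) at hD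
  rw [h, map_mul (chart ι (2 * ι (cubic t)) E' b c)] at hD
  have hg0 : chart ι (2 * ι (cubic t)) E' b c f ≠ 0 :=
    (map_ne_zero_iff _ (chart_injective _ _ _ algebraMap_injective hE2)).2 hf
  obtain ⟨N, m, φ, hφ0, hN, hm0, hmN, htop, hcm, hφ, w, G, hw, hG⟩ := top_of_semiInvariant d' e'
    (ι (cubic t)) v v₂ hE0 (fun g n hg => by
      refine eq_zero_of_cubic_operator ht0 ht1 e' he (α := 0) (β := n) ?_
      rw [he, polyDeriv_apply] at hg
      rw [hg]
      simp) _ hg0 (ι la - ι lc * ((2 * ι (cubic t))⁻¹ * E')) (ι lb + ι la * b + ι lc * c)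
      (ι lc * (2 * ι (cubic t))⁻¹) (by
        rw [hD]
        simp only [map_add, map_mul, map_sub, chart_C_C, chart_C_X, chart_X]
        ring)
  have hlc : ι lc = - (2 * m * ι (cubic t)) := by
    rw [mul_inv_eq_iff_eq_mul₀ hE2] at hcm
    rw [hcm]; ring
  rw [hlc, he] at hφ
  have hφe : 2 * ι (cubic t) * e' φ = ι (la + (N : K[X]) * derivative (cubic t)) * φ := by
    rw [hφ, hE']
    simp only [map_add, map_mul, map_intCast, polyDeriv_apply]
    field_simp
    ring
  obtain ⟨γ, a₀, a₁, aₜ, hγ, hprod⟩ := eq_prod_of_log_derivative e' he hφ0 hφe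
  have hla : la = 2 * ((a₀ : K[X]) * ((X - 1) * (X - C t)) + (a₁ : K[X]) * (X * (X - C t))
        + (aₜ : K[X]) * (X * (X - 1))) - (N : K[X]) * derivative (cubic t) := by
    have ne {f : K[X]} (hf : f ≠ 0) : ι f ≠ 0 := (map_ne_zero_iff _ algebraMap_injective).2 hf
    have h1 := ne (X_ne_zero (R := K))
    have h2 := ne (X_sub_C_ne_zero (1 : K))
    have h3 := ne (X_sub_C_ne_zero t)
    rw [C_1] at h2
    rw [der_prod e' hγ hprod, he, he, he, he] at hφe
    apply algebraMap_injective
    have key : ι (la + (N : K[X]) * derivative (cubic t)) = _ :=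
      mul_right_cancel₀ hφ0 (hφe.symm.trans (by rw [mul_comm φ, ← mul_assoc]))
    rw [map_sub, eq_sub_iff_add_eq, ← map_add, key]
    simp only [cubic, map_add, map_mul, map_sub, map_one, map_ofNat, map_intCast, polyDeriv_apply,
      derivative_C, derivative_X, derivative_one, map_zero] at h2 h3 ⊢
    field_simp
    ring
  refine ⟨N, m, a₀, a₁, aₜ, ?_, hla, ?_, ?_⟩
  · apply algebraMap_injective
    rw [hlc]
    simp only [map_neg, map_mul, map_intCast, map_ofNat]
  · rintro l₀ l₁ rfl
    refine residue_relation (G := G) (l₀ := l₀) ht ht0 ht1 d' e' hd he hγ hprod hw hla hb hs ?_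
    rw [he] at hG
    rw [← hE']
    have hB := congrArg e' hb
    rw [Der.leibniz, Der.leibniz, e'.map_ofNat, he, he] at hB
    rw [polyDeriv_apply] at hG
    rw [polyDeriv_apply, polyDeriv_apply, ← hE'] at hB
    rw [hG, hlc]
    linear_combination (-m : k) * hc1 - m * hB
  · rintro rfl h₀ h₁ hₜ
    exact eq_C_of_top ht0 hE2 hγ hprod (by rw [← hN]; exact htop) hN h₀ h₁ hₜ

end

section
variable {A : Type*} [CommRing A]

/-- The component along `x = 1 / q` of the sixth Painlevé vector field near `q = ∞`. -/
def infX (t κ₀ κ₁ θ ρ x h : A) : A :=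
  -(2 * ((1 - x) * (1 - t * x)) * (ρ + x * h)) + (κ₀ + κ₁ + θ - 1)
    - (κ₀ * (1 + t) + κ₁ * t + θ - 1) * x + κ₀ * t * x ^ 2

/-- The component along `h = (p - ρ / q) q ^ 2` of the sixth Painlevé vector field near
`q = ∞`. -/
def infH (t κ₀ κ₁ θ ρ x h : A) : A :=
  h ^ 2 + t * (ρ + x * h) * (ρ + x * h - κ₀)
    - h * (2 * (1 + t) * (ρ + x * h) - (κ₀ * (1 + t) + κ₁ * t + θ - 1))
    - x * h * (κ₀ * t - 2 * t * (ρ + x * h))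

/-- The component along the slope `η = dh / dx` of the sixth Painlevé vector field near
`q = ∞`. -/
def infU (t κ₀ κ₁ θ ρ x h η : A) : A :=
  t * h * (2 * (ρ + x * h) - κ₀) - 2 * (1 + t) * h ^ 2 - h * (κ₀ * t - 2 * t * (ρ + x * h))
    + 2 * t * x * h ^ 2
    + (2 * h + t * x * (2 * (ρ + x * h) - κ₀)
      - (2 * (1 + t) * (ρ + x * h) - (κ₀ * (1 + t) + κ₁ * t + θ - 1))
      - 2 * (1 + t) * x * h - x * (κ₀ * t - 2 * t * (ρ + x * h)) + 2 * t * x ^ 2 * h) * η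
    - η * (2 * ((1 + t) - 2 * t * x) * (ρ + x * h) - 2 * ((1 - x) * (1 - t * x)) * h
      - (κ₀ * (1 + t) + κ₁ * t + θ - 1) + 2 * κ₀ * t * x)
    + 2 * ((1 - x) * (1 - t * x)) * x * η ^ 2

lemma infX_spec (t κ₀ κ₁ θ ρ x h y : A) (hxy : x * y = 1) :
    2 * (y * (y - 1) * (y - t)) * (x ^ 2 * h + x * ρ) -
        (κ₀ * ((y - 1) * (y - t)) + κ₁ * (y * (y - t)) + (θ - 1) * (y * (y - 1))) =
      -y ^ 2 * infX t κ₀ κ₁ θ ρ x h := by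
  rw [infX]; grind

lemma infH_spec (t κ₀ κ₁ θ ρ x h y : A) (hxy : x * y = 1) :
    (κ₀ * ((y - 1) + (y - t)) + κ₁ * (y + (y - t)) + (θ - 1) * (y + (y - 1))) *
          (x ^ 2 * h + x * ρ) -
        ((y - 1) * (y - t) + y * (y - t) + y * (y - 1)) * (x ^ 2 * h + x * ρ) ^ 2 -
        ρ * (κ₀ + κ₁ + θ - 1 - ρ) =
      (2 * x * h + ρ) * infX t κ₀ κ₁ θ ρ x h + x ^ 2 * infH t κ₀ κ₁ θ ρ x h := by
  rw [infX, infH]; grind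

lemma infU_spec (t κ₀ κ₁ θ ρ x h y η u : A) (hxy : x * y = 1)
    (hu : u = - x ^ 2 * (ρ + 2 * x * h) - x ^ 4 * η) :
    2 * (κ₀ + κ₁ + θ - 1) * (x ^ 2 * h + x * ρ) - 2 * (3 * y - 1 - t) * (x ^ 2 * h + x * ρ) ^ 2 -
        2 * (2 * ((y - 1) * (y - t) + y * (y - t) + y * (y - 1)) * (x ^ 2 * h + x * ρ) -
          (κ₀ * ((y - 1) + (y - t)) + κ₁ * (y + (y - t)) + (θ - 1) * (y + (y - 1)))) * u -
        2 * (y * (y - 1) * (y - t)) * u ^ 2 =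
      -(2 * x * (ρ + 2 * x * h) + x ^ 2 * (2 * h) + 4 * x ^ 3 * η) * infX t κ₀ κ₁ θ ρ x h -
        x ^ 2 * (2 * x) * infH t κ₀ κ₁ θ ρ x h - x ^ 4 * infU t κ₀ κ₁ θ ρ x h η := by
  subst hu
  rw [infX, infH, infU]; grind

lemma map_infX {T : Type*} [CommRing T] {F : Type*} [FunLike F A T] [RingHomClass F A T]
    (φ : F) (t κ₀ κ₁ θ ρ x h : A) :
    φ (infX t κ₀ κ₁ θ ρ x h) = infX (φ t) (φ κ₀) (φ κ₁) (φ θ) (φ ρ) (φ x) (φ h) := by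
  simp [infX, map_ofNat]

lemma map_infH {T : Type*} [CommRing T] {F : Type*} [FunLike F A T] [RingHomClass F A T]
    (φ : F) (t κ₀ κ₁ θ ρ x h : A) :
    φ (infH t κ₀ κ₁ θ ρ x h) = infH (φ t) (φ κ₀) (φ κ₁) (φ θ) (φ ρ) (φ x) (φ h) := by
  simp [infH, map_ofNat]

lemma map_infU {T : Type*} [CommRing T] {F : Type*} [FunLike F A T] [RingHomClass F A T]
    (φ : F) (t κ₀ κ₁ θ ρ x h η : A) :
    φ (infU t κ₀ κ₁ θ ρ x h η) =
      infU (φ t) (φ κ₀) (φ κ₁) (φ θ) (φ ρ) (φ x) (φ h) (φ η) := by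
  simp [infU, map_ofNat]
end

section
variable {K : Type*} [Field K]

variable {k : Type*} [Field k] [Algebra K[X] k]

local notation "ι" => algebraMap K[X] k

variable (K k) in
/-- The substitution `q ↦ 1 / x`. -/
noncomputable def invHom : K[X] →+* k := eval₂RingHom ((algebraMap K[X] k).comp C) (ι X)⁻¹

@[simp] lemma invHom_C (a : K) : invHom K k (C a) = ι (C a) := by simp [invHom]
@[simp] lemma invHom_X : invHom K k X = (ι X)⁻¹ := by simp [invHom]

variable [FaithfulSMul K[X] k]

lemma algebraMap_X_ne_zero : algebraMap K[X] k X ≠ 0 :=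
  (map_ne_zero_iff _ (FaithfulSMul.algebraMap_injective K[X] k)).2 X_ne_zero

lemma invHom_mul_pow {f : K[X]} {N : ℕ} (hf : f.natDegree ≤ N) :
    ι X ^ N * invHom K k f = ι (reflect N f) := by
  have hX := algebraMap_X_ne_zero (K := K) (k := k)
  refine induction_with_natDegree_le (fun f => ι X ^ N * invHom K k f = ι (reflect N f)) N
    (by simp) (fun n a _ hn => ?_) (fun f g _ _ hf hg => ?_) f hf
  · rw [reflect_C_mul_X_pow, revAt_le hn, map_mul, map_mul, map_pow, map_pow, invHom_C, invHom_X]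
    obtain ⟨j, rfl⟩ := Nat.exists_eq_add_of_le hn
    rw [Nat.add_sub_cancel_left, pow_add, inv_pow]
    field_simp
  · rw [map_add, mul_add, hf, hg, reflect_add, map_add]

lemma invHom_injective : Function.Injective (invHom K k) := by
  rw [injective_iff_map_eq_zero]
  intro f hf
  have := invHom_mul_pow (k := k) (le_refl f.natDegree)
  rw [hf, mul_zero, eq_comm, map_eq_zero_iff _ (FaithfulSMul.algebraMap_injective K[X] k),
    reflect_eq_zero_iff] at this
  exact this

variable (k) in
/-- The change of chart `q = 1 / x`, `p = x ^ 2 h + ρ x`, `u = - x ^ 2 (ρ + 2 x h) - x ^ 4 η`. -/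
noncomputable def infChart (ρ : K) : K[X][X][X] →+* k[X][X] :=
  eval₂RingHom (C.comp (eval₂RingHom (C.comp (invHom K k)) (C (ι X ^ 2) * X + C (ι X * ι (C ρ)))))
    (C (C (-ι X ^ 4)) * X + C (-(C (ι X) ^ 2 * (C (ι (C ρ)) + 2 * C (ι X) * X))))

omit [FaithfulSMul K[X] k] in
@[simp] lemma infChart_C_C (ρ : K) (a : K[X]) : infChart k ρ (C (C a)) = C (C (invHom K k a)) := by
  simp [infChart]
omit [FaithfulSMul K[X] k] in
@[simp] lemma infChart_C_X (ρ : K) :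
    infChart k ρ (C X) = C (C (ι X)) ^ 2 * C X + C (C (ι X)) * C (C (ι (C ρ))) := by
  simp [infChart]
omit [FaithfulSMul K[X] k] in
@[simp] lemma infChart_X (ρ : K) :
    infChart k ρ X = - C (C (ι X)) ^ 2 * (C (C (ι (C ρ))) + 2 * C (C (ι X)) * C X)
      - C (C (ι X)) ^ 4 * X := by
  simp [infChart]
  rw [show (C 2 : k[X][X]) = 2 from rfl]
  ring

lemma infChart_injective (ρ : K) : Function.Injective (infChart k ρ) := by
  have hX := algebraMap_X_ne_zero (K := K) (k := k)
  exact affine_eval₂_injective _ (affine_eval₂_injective _ invHom_injective _ _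
    (pow_ne_zero 2 hX)) _ _ (C_ne_zero.2 (neg_ne_zero.2 (pow_ne_zero 4 hX)))

variable (k) in
/-- Polynomials in three variables as polynomials over `K(x)`. -/
noncomputable def infIncl : K[X][X][X] →+* k[X][X] := mapRingHom (mapRingHom (algebraMap K[X] k))

omit [FaithfulSMul K[X] k] in
@[simp] lemma infIncl_C_C (a : K[X]) : infIncl k (C (C a)) = C (C (ι a)) := by simp [infIncl]
omit [FaithfulSMul K[X] k] in
@[simp] lemma infIncl_C_X : infIncl k (C X : K[X][X][X]) = C X := by simp [infIncl]
omit [FaithfulSMul K[X] k] in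
@[simp] lemma infIncl_X : infIncl k (X : K[X][X][X]) = X := by simp [infIncl]

lemma infIncl_injective : Function.Injective (infIncl k : K[X][X][X] →+* k[X][X]) :=
  map_injective _ (map_injective _ (FaithfulSMul.algebraMap_injective K[X] k))

lemma exists_infIncl (ρ : K) (f : K[X][X][X]) :
    ∃ (n : ℕ) (G : K[X][X][X]), C (C (ι X)) ^ n * infChart k ρ f = infIncl k G := by
  have hadd {z w : k[X][X]} (hz : ∃ (n : ℕ) (G : K[X][X][X]), C (C (ι X)) ^ n * z = infIncl k G)
      (hw : ∃ (n : ℕ) (G : K[X][X][X]), C (C (ι X)) ^ n * w = infIncl k G) :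
      ∃ (n : ℕ) (G : K[X][X][X]), C (C (ι X)) ^ n * (z + w) = infIncl k G := by
    obtain ⟨n, G, h⟩ := hz
    obtain ⟨m, H, h'⟩ := hw
    refine ⟨n + m, C (C X) ^ m * G + C (C X) ^ n * H, ?_⟩
    rw [map_add, map_mul, map_mul, map_pow, map_pow, ← h, ← h', infIncl_C_C]
    ring
  have hmul {z w : k[X][X]} (hz : ∃ (n : ℕ) (G : K[X][X][X]), C (C (ι X)) ^ n * z = infIncl k G)
      (hw : ∃ (n : ℕ) (G : K[X][X][X]), C (C (ι X)) ^ n * w = infIncl k G) :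
      ∃ (n : ℕ) (G : K[X][X][X]), C (C (ι X)) ^ n * (z * w) = infIncl k G := by
    obtain ⟨n, G, h⟩ := hz
    obtain ⟨m, H, h'⟩ := hw
    exact ⟨n + m, G * H, by rw [map_mul, ← h, ← h']; ring⟩
  have hmem (G : K[X][X][X]) :
      ∃ (n : ℕ) (H : K[X][X][X]), C (C (ι X)) ^ n * infIncl k G = infIncl k H := ⟨0, G, by simp⟩
  have hpow {z : k[X][X]} (hz : ∃ (n : ℕ) (G : K[X][X][X]), C (C (ι X)) ^ n * z = infIncl k G)
      (n : ℕ) : ∃ (m : ℕ) (G : K[X][X][X]), C (C (ι X)) ^ m * z ^ n = infIncl k G := by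
    induction n with
    | zero => simpa using hmem 1
    | succ n ih => rw [pow_succ]; exact hmul ih hz
  have hX : ∃ (n : ℕ) (G : K[X][X][X]), C (C (ι X)) ^ n * infChart k ρ X = infIncl k G := by
    have : infChart k ρ X = infIncl k (C (C (-1)) * (C (C X) ^ 2 *
        (C (C (C ρ)) + (C (C X) + C (C X)) * C X) + C (C X) ^ 4 * X)) := by
      rw [infChart_X]
      simp only [map_mul, map_pow, map_add, infIncl_C_C, infIncl_C_X, infIncl_X, map_neg, map_one]
      ring
    rw [this]
    exact hmem _
  have hCX : ∃ (n : ℕ) (G : K[X][X][X]), C (C (ι X)) ^ n * infChart k ρ (C X) = infIncl k G := by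
    have : infChart k ρ (C X) = infIncl k (C (C X) ^ 2 * C X + C (C X) * C (C (C ρ))) := by simp
    rw [this]
    exact hmem _
  have hCC (a : K[X]) :
      ∃ (n : ℕ) (G : K[X][X][X]), C (C (ι X)) ^ n * infChart k ρ (C (C a)) = infIncl k G := by
    refine ⟨a.natDegree, C (C (reflect a.natDegree a)), ?_⟩
    rw [infChart_C_C, infIncl_C_C, ← invHom_mul_pow le_rfl]
    simp
  have hC (a : K[X][X]) :
      ∃ (n : ℕ) (G : K[X][X][X]), C (C (ι X)) ^ n * infChart k ρ (C a) = infIncl k G := by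
    induction a using Polynomial.induction_on' with
    | add p q hp hq => rw [C_add, map_add]; exact hadd hp hq
    | monomial n a =>
      rw [← C_mul_X_pow_eq_monomial, C_mul, C_pow, map_mul, map_pow]
      exact hmul (hCC a) (hpow hCX n)
  induction f using Polynomial.induction_on' with
  | add p q hp hq => rw [map_add]; exact hadd hp hq
  | monomial n a =>
    rw [← C_mul_X_pow_eq_monomial, map_mul, map_pow]
    exact hmul (hC a) (hpow hX n)

/-- The sixth Painlevé vector field near `q = ∞`. -/
noncomputable def infField (d : Der K) (t κ₀ κ₁ θ ρ : K) : Der K[X][X][X] :=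
  vectorField (coeffDeriv d) (polyDeriv K)
    (infX (C (C (C t))) (C (C (C κ₀))) (C (C (C κ₁))) (C (C (C θ))) (C (C (C ρ))) (C (C X)) (C X))
    (infH (C (C (C t))) (C (C (C κ₀))) (C (C (C κ₁))) (C (C (C θ))) (C (C (C ρ))) (C (C X)) (C X))
    (infU (C (C (C t))) (C (C (C κ₀))) (C (C (C κ₁))) (C (C (C θ))) (C (C (C ρ))) (C (C X)) (C X) X)

lemma exists_infField {d : Der K} {t κ₀ κ₁ θ ρ κ : K} (hρ : d ρ = 0)
    (hκ : κ = ρ * (κ₀ + κ₁ + θ - 1 - ρ)) (d' e' : Der k)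
    (hd : ∀ a, d' (ι a) = ι (coeffDeriv d a)) (he : ∀ a, e' (ι a) = ι (polyDeriv K a)) :
    ∃ Y : Der k[X][X],
      (∀ G, Y (infIncl k G) = infIncl k (infField d t κ₀ κ₁ θ ρ G)) ∧
      (∀ f, Y (infChart k ρ f) = infChart k ρ (sixthField d t κ₀ κ₁ θ κ f)) := by
  have hX := algebraMap_X_ne_zero (K := K) (k := k)
  have hE : polyDeriv K (cubic t) = (X - 1) * (X - C t) + X * (X - C t) + X * (X - 1) := by
    rw [polyDeriv_apply, derivative_cubic, C_add, C_1]
    ring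
  have hE' : polyDeriv K (polyDeriv K (cubic t)) = 2 * (3 * X - 1 - C t) := by
    rw [hE]
    simp
    ring
  have hB : polyDeriv K (linTerm t κ₀ κ₁ θ) = C κ₀ * ((X - 1) + (X - C t)) +
      C κ₁ * (X + (X - C t)) + (C θ - 1) * (X + (X - 1)) := by
    simp [linTerm]
    ring
  have hB' : polyDeriv K (polyDeriv K (linTerm t κ₀ κ₁ θ)) = 2 * (C κ₀ + C κ₁ + C θ - 1) := by
    rw [hB]
    simp
    ring
  have hXX : (C (C (ι X)) : k[X][X]) * C (C (ι X)⁻¹) = 1 := by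
    rw [← C_mul, ← C_mul, mul_inv_cancel₀ hX, C_1, C_1]
  refine ⟨vectorField d' e'
    (infX (C (C (ι (C t)))) (C (C (ι (C κ₀)))) (C (C (ι (C κ₁)))) (C (C (ι (C θ))))
      (C (C (ι (C ρ)))) (C (C (ι X))) (C X))
    (infH (C (C (ι (C t)))) (C (C (ι (C κ₀)))) (C (C (ι (C κ₁)))) (C (C (ι (C θ))))
      (C (C (ι (C ρ)))) (C (C (ι X))) (C X))
    (infU (C (C (ι (C t)))) (C (C (ι (C κ₀)))) (C (C (ι (C κ₁)))) (C (C (ι (C θ))))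
      (C (C (ι (C ρ)))) (C (C (ι X))) (C X) X), intertwine₂ _ _ _ (fun a => ?_) ?_ ?_,
      intertwine₂ _ _ _ (fun a => ?_) ?_ ?_⟩
  · rw [infField, vectorField_C_C, map_add, map_mul, map_infX]
    simp [hd, he]
  · rw [infField, vectorField_C_X, map_infH]
    simp
  · rw [infField, vectorField_X, map_infU]
    simp
  · have hda : d' (invHom K k a) = invHom K k (coeffDeriv d a) := by
      refine intertwine (invHom K k) (coeffDeriv d) d' (fun a => ?_) ?_ a
      · rw [invHom_C, hd, coeffDeriv_C, invHom_C]
      · rw [invHom_X, coeffDeriv_X, map_zero, d'.map_inv hX, hd, coeffDeriv_X, map_zero]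
        simp
    have hea : -(ι X) ^ 2 * e' (invHom K k a) = invHom K k (derivative a) := by
      refine intertwine (invHom K k) (polyDeriv K)
        ⟨fun z => -(ι X) ^ 2 * e' z, fun _ _ => by rw [map_add, mul_add],
          fun _ _ => by rw [e'.leibniz]; ring⟩ (fun a => ?_) ?_ a
      · change -(ι X) ^ 2 * e' _ = _
        rw [invHom_C, he]
        simp
      · change -(ι X) ^ 2 * e' _ = _
        rw [invHom_X, e'.map_inv hX, he]
        simp [hX]
    have hea' : e' (invHom K k a) = -((ι X)⁻¹) ^ 2 * invHom K k (derivative a) := by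
      rw [← hea]; field_simp
    rw [infChart_C_C, sixthField, riccatiField, vectorField_C_C, vectorField_C_C, hda, hea']
    have := infX_spec (C (C (ι (C t)))) (C (C (ι (C κ₀)))) (C (C (ι (C κ₁)))) (C (C (ι (C θ))))
      (C (C (ι (C ρ)))) (C (C (ι X))) (C X) _ hXX
    simp only [infChart_C_C, infChart_C_X, polyDeriv_apply, map_add, map_sub, map_mul, map_pow,
      map_neg, map_one, map_ofNat, cubic, linTerm, invHom_C, invHom_X]
    linear_combination -(C (C (invHom K k (derivative a)))) * this
  · have := infH_spec (C (C (ι (C t)))) (C (C (ι (C κ₀)))) (C (C (ι (C κ₁)))) (C (C (ι (C θ))))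
      (C (C (ι (C ρ)))) (C (C (ι X))) (C X) _ hXX
    rw [infChart_C_X, map_add, Der.leibniz, Der.leibniz, Der.leibniz_pow, sixthField, riccatiField,
      vectorField_C_X, vectorField_C_X, vectorField_C_C, vectorField_C_C, hd, hd, he, he]
    simp only [infChart_C_C, infChart_C_X, polyDeriv_apply, map_add, map_sub, map_mul, map_pow,
      map_one, cubic, hB, invHom_C, invHom_X, hκ]
    simp [hρ]
    linear_combination -this
  · have := infU_spec (C (C (ι (C t)))) (C (C (ι (C κ₀)))) (C (C (ι (C κ₁)))) (C (C (ι (C θ))))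
      (C (C (ι (C ρ)))) (C (C (ι X))) (C X) _ X (infChart k ρ X) hXX (by rw [infChart_X])
    rw [sixthField, riccatiField, vectorField_X]
    simp only [hB, infChart_C_C, infChart_C_X, map_add, map_sub, map_mul, map_pow,
      map_one, map_ofNat, cubic, invHom_C, invHom_X]
    rw [infChart_X] at this ⊢
    simp only [map_sub, map_mul, map_neg, Der.leibniz, Der.leibniz_pow, map_add,
      vectorField_C_C, vectorField_C_X, vectorField_X, hd, he]
    rw [show (2 : k[X][X]) = ((2 : ℕ) : k[X][X]) from rfl, Der.map_natCast]
    simp [hρ]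
    linear_combination -this

end

section
variable {A : Type*} [CommRing A]

/-- `x` times the cofactor of an invariant hypersurface, in the chart near `q = ∞`. -/
def infL (t ρ N m a₀ a₁ aₜ x h η : A) : A :=
  (2 * (a₀ * ((1 - x) * (1 - t * x)) + a₁ * (1 - t * x) + aₜ * (1 - x))
      - N * (3 - 2 * (1 + t) * x + t * x ^ 2)) * (ρ + x * h)
    + 2 * m * ((1 - x) * (1 - t * x)) * (ρ + 2 * x * h + x ^ 2 * η)

lemma map_infL {T : Type*} [CommRing T] {F : Type*} [FunLike F A T] [RingHomClass F A T]
    (φ : F) (t ρ N m a₀ a₁ aₜ x h η : A) :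
    φ (infL t ρ N m a₀ a₁ aₜ x h η) =
      infL (φ t) (φ ρ) (φ N) (φ m) (φ a₀) (φ a₁) (φ aₜ) (φ x) (φ h) (φ η) := by
  simp [infL, map_ofNat]

lemma infL_spec (t ρ N m a₀ a₁ aₜ x h η y : A) (hxy : x * y = 1) :
    x * ((2 * (a₀ * ((y - 1) * (y - t)) + a₁ * (y * (y - t)) + aₜ * (y * (y - 1)))
        - N * (3 * y ^ 2 - 2 * (1 + t) * y + t)) * (x ^ 2 * h + x * ρ)
      + -(2 * (m * (y * (y - 1) * (y - t)))) * (-x ^ 2 * (ρ + 2 * x * h) - x ^ 4 * η)) =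
    infL t ρ N m a₀ a₁ aₜ x h η := by
  rw [infL]
  grind
end

section
variable {K : Type*} [Field K] [CharZero K]

omit [CharZero K] in
lemma mul_der_pow {A : Type*} [CommRing A] (δ : Der A) (x : A) (n : ℕ) :
    x * δ (x ^ n) = n * x ^ n * δ x := by
  cases n with
  | zero => simp
  | succ n => rw [Der.leibniz_pow]; simp; ring

omit [CharZero K] in
lemma infIncl_intCast {k : Type*} [Field k] [Algebra K[X] k] (n : ℤ) :
    infIncl k (n : K[X][X][X]) = n := map_intCast (infIncl k) n

omit [CharZero K] in
lemma exists_semiInvariant_infField {k : Type*} [Field k] [Algebra K[X] k] [FaithfulSMul K[X] k]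
    {d : Der K} {t κ₀ κ₁ θ ρ κ : K} (hρ : d ρ = 0) (hκ : κ = ρ * (κ₀ + κ₁ + θ - 1 - ρ))
    (d' e' : Der k) (hd : ∀ a, d' (algebraMap K[X] k a) = algebraMap K[X] k (coeffDeriv d a))
    (he : ∀ a, e' (algebraMap K[X] k a) = algebraMap K[X] k (polyDeriv K a))
    {f : K[X][X][X]} (hf : f ≠ 0) {la lb lc : K[X]}
    {N m a₀ a₁ aₜ : ℤ} (hlc : lc = -(2 * (m : K[X]) * cubic t))
    (hla : la = 2 * ((a₀ : K[X]) * ((X - 1) * (X - C t)) + (a₁ : K[X]) * (X * (X - C t)) +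
      (aₜ : K[X]) * (X * (X - 1))) - (N : K[X]) * derivative (cubic t))
    (h : sixthField d t κ₀ κ₁ θ κ f = (C (C la) * C X + C (C lb) + C (C lc) * X) * f)
    {n : ℕ} (hn : lb.natDegree ≤ n + 1) :
    ∃ (M : ℤ) (G : K[X][X][X]), ¬ C (C X) ∣ G ∧
      C (C X) ^ (n + 1) * infField d t κ₀ κ₁ θ ρ G =
        (C (C X) ^ n * ((M : K[X][X][X]) * infX (C (C (C t))) (C (C (C κ₀))) (C (C (C κ₁)))
            (C (C (C θ))) (C (C (C ρ))) (C (C X)) (C X) +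
          infL (C (C (C t))) (C (C (C ρ))) N m a₀ a₁ aₜ (C (C X)) (C X) X) +
          C (C (reflect (n + 1) lb))) * G := by
  obtain ⟨Y, hY, hY'⟩ := exists_infField (t := t) (κ₀ := κ₀) (κ₁ := κ₁) (θ := θ) hρ hκ d' e' hd he
  have hX := algebraMap_X_ne_zero (K := K) (k := k)
  have hXX : (C (C (algebraMap K[X] k X)) : k[X][X]) * C (C (algebraMap K[X] k X)⁻¹) = 1 := by
    rw [← C_mul, ← C_mul, mul_inv_cancel₀ hX, C_1, C_1]
  have hx : (C (C (algebraMap K[X] k X)) : k[X][X]) ≠ 0 := C_ne_zero.2 (C_ne_zero.2 hX)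
  obtain ⟨i, F, hF⟩ := exists_infIncl (k := k) ρ f
  have hF0 : F ≠ 0 := by
    rintro rfl
    rw [map_zero, mul_eq_zero, map_eq_zero_iff _ (infChart_injective ρ)] at hF
    exact hF.elim (pow_ne_zero _ hx) hf
  obtain ⟨j, G, hG, rfl⟩ := WfDvdMonoid.max_power_factor' hF0
    (x := (C (C X) : K[X][X][X])) (by simpa [isUnit_C] using not_isUnit_X)
  refine ⟨(i : ℤ) - j, G, hG, infIncl_injective (k := k) ?_⟩
  set Q := infX (C (C (C t))) (C (C (C κ₀))) (C (C (C κ₁))) (C (C (C θ))) (C (C (C ρ))) (C (C X))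
    (C X) with hQ
  set l := infL (C (C (C t))) (C (C (C ρ))) (N : K[X][X][X]) m a₀ a₁ aₜ (C (C X)) (C X) X with hl
  have hxX : Y (C (C (algebraMap K[X] k X))) = infIncl k Q := by
    rw [← infIncl_C_C, hY, infField, vectorField_C_C]
    simp [hQ]
  have hL : C (C (algebraMap K[X] k X)) *
      infChart k ρ (C (C la) * C X + C (C lb) + C (C lc) * X) =
      infIncl k l +
        C (C (algebraMap K[X] k X)) * C (C (invHom K k lb)) := by
    rw [hl, map_infL]
    simp only [infIncl_C_C, infIncl_C_X, infIncl_X, infIncl_intCast]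
    rw [← infL_spec _ _ _ _ _ _ _ _ _ _ _ hXX]
    rw [hla, hlc, derivative_cubic]
    simp only [cubic, infChart_C_C, infChart_C_X, infChart_X, map_add,
      map_sub, map_mul, map_pow, map_neg, map_one, map_ofNat, map_intCast, invHom_C, invHom_X]
    ring
  rw [map_mul, map_pow, infIncl_C_C] at hF
  have hYF := congrArg (fun z => C (C (algebraMap K[X] k X)) * Y z) hF
  simp only [Der.leibniz, hY, hY', h, map_mul (infChart k ρ)] at hYF
  have hi := mul_der_pow Y (C (C (algebraMap K[X] k X))) i
  have hj := mul_der_pow Y (C (C (algebraMap K[X] k X))) j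
  rw [hxX] at hi hj
  have hb : C (C (algebraMap K[X] k X)) ^ (n + 1) * C (C (invHom K k lb)) =
      C (C (algebraMap K[X] k (reflect (n + 1) lb))) := by
    rw [← invHom_mul_pow hn]
    simp
  simp only [map_mul (infIncl k), map_add (infIncl k), map_pow (infIncl k), infIncl_intCast,
    infIncl_C_C, ← hb]
  refine mul_left_cancel₀ (pow_ne_zero j hx) ?_
  push_cast
  set x := C (C (algebraMap K[X] k X))
  linear_combination -x ^ n * hYF - x ^ n * infIncl k G * hj + x ^ n * infChart k ρ f * hi +
    x ^ n * x ^ i * infChart k ρ f * hL +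
    x ^ n * (i * infIncl k Q + infIncl k l + x * C (C (invHom K k lb))) * hF

omit [CharZero K] in
lemma infinity_chart {d : Der K} {t κ₀ κ₁ θ ρ κ : K} (hρ : d ρ = 0)
    (hκ : κ = ρ * (κ₀ + κ₁ + θ - 1 - ρ)) {f : K[X][X][X]} (hf : f ≠ 0) {la lb lc : K[X]}
    {N m a₀ a₁ aₜ : ℤ} (hlc : lc = -(2 * (m : K[X]) * cubic t))
    (hla : la = 2 * ((a₀ : K[X]) * ((X - 1) * (X - C t)) + (a₁ : K[X]) * (X * (X - C t)) +
      (aₜ : K[X]) * (X * (X - 1))) - (N : K[X]) * derivative (cubic t))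
    (h : sixthField d t κ₀ κ₁ θ κ f = (C (C la) * C X + C (C lb) + C (C lc) * X) * f) :
    ∃ (M : ℤ) (l₀ l₁ : K), lb = C l₁ * X + C l₀ ∧
      l₁ + (2 * (a₀ + a₁ + aₜ) - 3 * N + 2 * m) * ρ = M * (2 * ρ - (κ₀ + κ₁ + θ - 1)) := by
  obtain ⟨d', hd⟩ := exists_extend_fractionRing (coeffDeriv d)
  obtain ⟨e', he⟩ := exists_extend_fractionRing (polyDeriv K)
  obtain ⟨n, hn, hn'⟩ : ∃ n, lb.natDegree ≤ n + 1 ∧ (n ≠ 0 → lb.natDegree = n + 1) := by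
    rcases Nat.lt_or_ge lb.natDegree 2 with h | h
    · exact ⟨0, by omega, by simp⟩
    · exact ⟨lb.natDegree - 1, by omega, by omega⟩
  obtain ⟨M, G, hG, hMG⟩ := exists_semiInvariant_infField hρ hκ d' e' hd he hf hlc hla h hn
  set π : K[X][X][X] →+* K[X][X] := mapRingHom (mapRingHom (evalRingHom 0))
  have hπC (a : K[X]) : π (C (C a)) = C (C (a.eval 0)) := by simp [π]
  have hπCX : π (C X) = C X := by simp [π]
  have hπX : π X = X := by simp [π]
  have hπZ (n : ℤ) : π (n : K[X][X][X]) = n := map_intCast π n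
  have hπG : π G ≠ 0 := by
    intro h0
    refine hG (C_dvd_iff_dvd_coeff _ _ |>.2 fun i => C_dvd_iff_dvd_coeff _ _ |>.2 fun j => ?_)
    rw [X_dvd_iff, coeff_zero_eq_eval_zero]
    simpa [π, coeff_map] using congrArg (fun g => (g.coeff i).coeff j) h0
  have key := congrArg π hMG
  rw [map_mul π, map_mul π, map_pow π, hπC, eval_X, C_0, C_0, zero_pow (by simp), zero_mul, eq_comm,
    mul_eq_zero, or_iff_left hπG, map_add π, map_mul π, map_pow π, map_add π, map_mul π, map_infX,
    map_infL] at key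
  simp only [hπC, hπCX, hπX, hπZ, infX, infL, eval_X, eval_C, C_0] at key
  have hcoeff : (reflect (n + 1) lb).eval 0 = lb.coeff (n + 1) := by
    rw [← coeff_zero_eq_eval_zero, coeff_reflect, revAt_le (by simp), Nat.sub_zero]
  rw [hcoeff] at key
  by_cases hn0 : n = 0
  · subst hn0
    refine ⟨M, lb.coeff 0, lb.coeff 1, eq_X_add_C_of_natDegree_le_one hn, ?_⟩
    apply C_injective (R := K)
    apply C_injective (R := K[X])
    simp only [C_add, C_sub, C_mul, map_intCast, map_ofNat, C_1]
    rw [← sub_eq_zero, ← key]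
    ring
  · rw [zero_pow hn0, zero_mul, zero_add, C_eq_zero, C_eq_zero, ← hn' hn0, coeff_natDegree,
      leadingCoeff_eq_zero] at key
    rw [key] at hn'
    simp at hn'
    omega

/-- A hypersurface invariant under the generic sixth Painlevé vector field is trivial. -/
theorem eq_C_of_dvd_sixthField {d : Der K} {t κ₀ κ₁ θ ρ κ : K} (ht : d t = t * (t - 1))
    (ht0 : t ≠ 0) (ht1 : t ≠ 1) (hρ : d ρ = 0) (hκ : κ = ρ * (κ₀ + κ₁ + θ - 1 - ρ))
    (hgen : ∀ n₀ n₁ n₂ n₃ n₄ : ℤ, n₀ * κ₀ + n₁ * κ₁ + n₂ * θ +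
      n₃ * (2 * ρ - (κ₀ + κ₁ + θ - 1)) + n₄ = 0 → n₀ = 0 ∧ n₁ = 0 ∧ n₂ = 0 ∧ n₃ = 0 ∧ n₄ = 0)
    {f : K[X][X][X]} (hf : f ≠ 0) (h : f ∣ sixthField d t κ₀ κ₁ θ κ f) :
    ∃ c, f = C (C (C c)) := by
  obtain ⟨l, hl⟩ := h
  replace hl := hl.trans (mul_comm f l)
  have hw : weight l ≤ 1 := by
    by_cases h0 : l = 0
    · simp [h0, weight]
    have := weight_riccatiField_le (coeffDeriv d) (polyDeriv K) (cubic t) (linTerm t κ₀ κ₁ θ)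
      (C κ) f
    change weight (sixthField d t κ₀ κ₁ θ κ f) ≤ _ at this
    rw [hl, weight_mul h0 hf] at this
    omega
  rw [weight_le_one_form hw] at hl
  obtain ⟨N, m, a₀, a₁, aₜ, hlc, hla, hres, hc⟩ := finite_chart ht ht0 ht1 hf hl
  obtain ⟨M, l₀, l₁, hlb, hM⟩ := infinity_chart hρ hκ hf hlc hla hl
  have h1 := hres _ _ hlb
  obtain ⟨h₀, h₁, h₂, h₃, h₄⟩ := hgen (2 * a₀ + 2 * m - N) (2 * a₁ + 2 * m - N) (2 * aₜ + 2 * m - N)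
    (2 * M - (2 * (a₀ + a₁ + aₜ) - 3 * N + 2 * m)) (N - m) (by
      push_cast
      linear_combination h1 - 2 * hM)
  exact hc (by omega) (by omega) (by omega) (by omega)
end

section AlgebraicSpan
variable {W : Type*} [Field W] [CharZero W]

/-- The elements of `W` that are algebraic over the field generated by `S`. -/
noncomputable def algSpan (S : Set W) : Subfield W where
  toSubring := (Subalgebra.algebraicClosure (Algebra.adjoin ℚ S) W).toSubring
  inv_mem' x hx := by
    change x⁻¹ ∈ Subalgebra.algebraicClosure (Algebra.adjoin ℚ S) W
    have hx' : x ∈ Subalgebra.algebraicClosure (Algebra.adjoin ℚ S) W := hx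
    rw [Subalgebra.mem_algebraicClosure] at hx' ⊢
    exact hx'.inv

theorem mem_algSpan {S : Set W} {x : W} : x ∈ algSpan S ↔ IsAlgebraic (Algebra.adjoin ℚ S) x :=
  Iff.rfl

theorem mem_algSpan_iff_mem_closure {S : Set W} {x : W} :
    x ∈ algSpan S ↔ x ∈ (AlgebraicIndependent.matroid ℚ W).closure S := by
  rw [AlgebraicIndependent.matroid_closure_eq, mem_algSpan]
  rfl

theorem subset_algSpan (S : Set W) : S ⊆ algSpan S := fun x hx ↦
  mem_algSpan_iff_mem_closure.2 (Matroid.mem_closure_of_mem _ hx)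

theorem algSpan_le {S T : Set W} (h : S ⊆ algSpan T) : algSpan S ≤ algSpan T := fun x hx ↦ by
  rw [mem_algSpan_iff_mem_closure] at hx ⊢
  exact Matroid.closure_subset_closure_of_subset_closure
    (fun y hy ↦ mem_algSpan_iff_mem_closure.1 (h hy)) hx

theorem algSpan_mono {S T : Set W} (h : S ⊆ T) : algSpan S ≤ algSpan T :=
  algSpan_le (h.trans (subset_algSpan T))

theorem algSpan_exchange {S : Set W} {x y : W} (hx : x ∉ algSpan S)
    (hxy : x ∈ algSpan (insert y S)) : y ∈ algSpan (insert x S) := by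
  rw [mem_algSpan_iff_mem_closure] at *
  exact Matroid.mem_closure_insert hx hxy

omit [CharZero W] in
theorem isAlgebraic_iff_exists_coeff_mem {R : Type*} [CommRing R] [IsDomain R] [Algebra R W]
    (hR : Function.Injective (algebraMap R W)) {x : W} :
    IsAlgebraic R x ↔ ∃ P : W[X], P ≠ 0 ∧ (∀ n, P.coeff n ∈ (algebraMap R W).range) ∧
      P.eval x = 0 := by
  constructor
  · rintro ⟨p, hp, h⟩
    refine ⟨p.map (algebraMap R W), (Polynomial.map_ne_zero_iff hR).2 hp, fun n ↦ ?_, ?_⟩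
    · rw [coeff_map]; exact ⟨_, rfl⟩
    · rwa [eval_map_algebraMap]
  · rintro ⟨P, hP, hc, h⟩
    have : P ∈ lifts (algebraMap R W) := (lifts_iff_coeff_lifts _).2 hc
    obtain ⟨p, rfl⟩ := (mem_lifts _).1 this
    refine ⟨p, fun h0 ↦ hP (by rw [h0, Polynomial.map_zero]), ?_⟩
    rwa [eval_map_algebraMap] at h

theorem mem_algSpan_of_root {S : Set W} {P : W[X]} (hP : P ≠ 0)
    (hc : ∀ n, P.coeff n ∈ algSpan S) {x : W} (hx : P.eval x = 0) : x ∈ algSpan S := by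
  refine algSpan_le (S := (algSpan S : Set W)) subset_rfl ?_
  refine mem_algSpan.2 ((isAlgebraic_iff_exists_coeff_mem Subtype.val_injective).2
    ⟨P, hP, fun n ↦ ?_, hx⟩)
  exact ⟨⟨P.coeff n, Algebra.subset_adjoin (hc n)⟩, rfl⟩

theorem transcendental_of_notMem_algSpan {S : Set W} {x : W} (hx : x ∉ algSpan S) :
    Transcendental (algSpan S) x := by
  intro h
  obtain ⟨P, hP, hc, h0⟩ := (isAlgebraic_iff_exists_coeff_mem Subtype.val_injective).1 h
  refine hx (mem_algSpan_of_root hP (fun n ↦ ?_) h0)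
  obtain ⟨c, hc⟩ := hc n
  rw [← hc]
  exact c.2

/-- A zero of a polynomial with coefficients in a subalgebra is a simple zero of such
a polynomial. -/
theorem exists_simple_root {R : Subalgebra ℚ W} {x : W} (hx : IsAlgebraic R x) :
    ∃ P : W[X], (∀ n, P.coeff n ∈ R) ∧ P.eval x = 0 ∧ (derivative P).eval x ≠ 0 := by
  obtain ⟨P, hP, hc, h⟩ := (isAlgebraic_iff_exists_coeff_mem Subtype.val_injective).1 hx
  induction hn : P.natDegree using Nat.strong_induction_on generalizing P with
  | _ n ih =>
    by_cases h' : (derivative P).eval x = 0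
    · have hd : P.natDegree ≠ 0 := by
        intro h0
        rw [eq_C_of_natDegree_eq_zero h0, eval_C] at h
        exact hP (by rw [eq_C_of_natDegree_eq_zero h0, h, C_0])
      refine ih _ (hn ▸ natDegree_derivative_lt hd) (derivative P) ?_ (fun m ↦ ?_) h' rfl
      · exact fun h0 ↦ hd (derivative_eq_zero.1 h0)
      · rw [coeff_derivative]
        obtain ⟨c, hc⟩ := hc (m + 1)
        exact ⟨c * (m + 1), by rw [map_mul, hc]; simp⟩
    · refine ⟨P, fun m ↦ ?_, h, h'⟩
      obtain ⟨c, hc⟩ := hc m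
      rw [← hc]; exact c.2

omit [CharZero W] in
theorem Der.eval_apply (d : Der W) (P : W[X]) (x : W) :
    d (P.eval x) = (coeffDeriv d P).eval x + (derivative P).eval x * d x := by
  induction P using Polynomial.induction_on' with
  | add p q hp hq => simp only [eval_add, map_add, hp, hq]; ring
  | monomial n a =>
    have h : monomial n a = C a * X ^ n := (C_mul_X_pow_eq_monomial).symm
    simp only [h, eval_mul, eval_C, eval_pow, eval_X, Der.leibniz, Der.leibniz_pow, coeffDeriv_C,
      coeffDeriv_X, derivative_mul, derivative_C, derivative_X_pow, mul_zero, zero_mul, zero_add]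
    ring

theorem Der.algebraMap_rat (d : Der W) (r : ℚ) : d (algebraMap ℚ W r) = 0 := by
  rw [eq_ratCast, Rat.cast_def, Der.map_div (δ := d) _ (Nat.cast_ne_zero.2 r.den_nz),
    Der.map_natCast, Der.map_intCast]
  simp

theorem Der.mem_of_adjoin (d : Der W) {S T : Set W} (hST : S ⊆ algSpan T)
    (h : ∀ s ∈ S, d s ∈ algSpan T) {x : W} (hx : x ∈ Algebra.adjoin ℚ S) :
    x ∈ algSpan T ∧ d x ∈ algSpan T := by
  induction hx using Algebra.adjoin_induction with
  | mem x hx => exact ⟨hST hx, h x hx⟩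
  | algebraMap r =>
    rw [Der.algebraMap_rat, eq_ratCast]
    exact ⟨SubfieldClass.ratCast_mem _ r, zero_mem _⟩
  | add x y _ _ hx hy => rw [map_add]; exact ⟨add_mem hx.1 hy.1, add_mem hx.2 hy.2⟩
  | mul x y _ _ hx hy =>
    rw [Der.leibniz]
    exact ⟨mul_mem hx.1 hy.1, add_mem (mul_mem hx.1 hy.2) (mul_mem hy.1 hx.2)⟩

omit [CharZero W] in
theorem eval_mem_of_coeff_mem {F : Subfield W} {P : W[X]} (hP : ∀ n, P.coeff n ∈ F) {x : W}
    (hx : x ∈ F) : P.eval x ∈ F := by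
  rw [eval_eq_sum_range]
  exact sum_mem fun n _ ↦ mul_mem (hP n) (pow_mem hx n)

theorem Der.mem_algSpan_of_forall (d : Der W) {S T : Set W} (hST : S ⊆ algSpan T)
    (h : ∀ s ∈ S, d s ∈ algSpan T) {x : W} (hx : x ∈ algSpan S) : d x ∈ algSpan T := by
  obtain ⟨P, hc, h0, h1⟩ := exists_simple_root (mem_algSpan.1 hx)
  have hxT := algSpan_le hST hx
  have key := d.eval_apply P x
  rw [h0, map_zero] at key
  have : d x = -(coeffDeriv d P).eval x / (derivative P).eval x := by
    field_simp
    linear_combination -key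
  rw [this]
  refine div_mem (neg_mem (eval_mem_of_coeff_mem (fun n ↦ ?_) hxT))
    (eval_mem_of_coeff_mem (fun n ↦ ?_) hxT)
  · rw [coeff_coeffDeriv]
    exact (d.mem_of_adjoin hST h (hc n)).2
  · rw [coeff_derivative]
    exact mul_mem (d.mem_of_adjoin hST h (hc _)).1
      (by exact_mod_cast natCast_mem (algSpan T) (n + 1))

theorem Der.eq_zero_of_mem_algSpan (d : Der W) {S : Set W} (h : ∀ s ∈ S, d s = 0) {x : W}
    (hx : x ∈ algSpan S) : d x = 0 := by
  have hadj : ∀ z ∈ Algebra.adjoin ℚ S, d z = 0 := by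
    intro z hz
    induction hz using Algebra.adjoin_induction with
    | mem x hx => exact h x hx
    | algebraMap r => exact Der.algebraMap_rat d r
    | add x y _ _ hx hy => rw [map_add, hx, hy, add_zero]
    | mul x y _ _ hx hy => rw [Der.leibniz, hx, hy, mul_zero, mul_zero, add_zero]
  obtain ⟨P, hc, h0, h1⟩ := exists_simple_root (mem_algSpan.1 hx)
  have key := d.eval_apply P x
  have hP : coeffDeriv d P = 0 := by
    ext n
    rw [coeff_coeffDeriv, hadj _ (hc n), coeff_zero]
  rw [h0, map_zero, hP, eval_zero, zero_add] at key
  exact (mul_eq_zero.1 key.symm).resolve_left h1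

theorem map_mem_algSpan {V : Type*} [Field V] [CharZero V] (j : V →+* W) {S : Set V} {x : V} :
    j x ∈ algSpan (j '' S) ↔ x ∈ algSpan S := by
  have hadj : Algebra.adjoin ℚ (j '' S) = (Algebra.adjoin ℚ S).map j.toRatAlgHom :=
    (AlgHom.map_adjoin j.toRatAlgHom S).symm
  constructor
  · intro h
    obtain ⟨P, hP, hc, h0⟩ := (isAlgebraic_iff_exists_coeff_mem Subtype.val_injective).1
      (mem_algSpan.1 h)
    have hc' : ∀ n, ∃ z ∈ Algebra.adjoin ℚ S, j z = P.coeff n := by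
      intro n
      obtain ⟨c, hc⟩ := hc n
      obtain ⟨z, hz, hz'⟩ := hadj.le c.2
      exact ⟨z, hz, by rw [← hc]; exact hz'⟩
    choose z hz hz' using hc'
    have : P ∈ lifts j := (lifts_iff_coeff_lifts _).2 fun n ↦ ⟨z n, hz' n⟩
    obtain ⟨Q, rfl⟩ := (mem_lifts _).1 this
    refine mem_algSpan.2 ((isAlgebraic_iff_exists_coeff_mem Subtype.val_injective).2
      ⟨Q, fun h ↦ hP (by rw [h, Polynomial.map_zero]), fun n ↦ ?_, ?_⟩)
    · have : Q.coeff n = z n := j.injective (by rw [hz', coeff_map])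
      rw [this]
      exact ⟨⟨z n, hz n⟩, rfl⟩
    · rw [eval_map, eval₂_hom] at h0
      exact j.injective (by rw [h0, map_zero])
  · intro h
    obtain ⟨P, hP, hc, h0⟩ := (isAlgebraic_iff_exists_coeff_mem Subtype.val_injective).1
      (mem_algSpan.1 h)
    refine mem_algSpan.2 ((isAlgebraic_iff_exists_coeff_mem Subtype.val_injective).2
      ⟨P.map j, (Polynomial.map_ne_zero_iff j.injective).2 hP, fun n ↦ ?_, ?_⟩)
    · obtain ⟨c, hc⟩ := hc n
      rw [coeff_map, ← hc]
      refine ⟨⟨j c, ?_⟩, rfl⟩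
      exact hadj.ge ⟨c, c.2, rfl⟩
    · rw [eval_map, eval₂_hom, h0, map_zero]

theorem isAlgebraic_adjoin_iff_mem_algSpan (K : Subfield W) {T : Set W} {x : W} :
    IsAlgebraic (Algebra.adjoin K T) x ↔ x ∈ algSpan ((K : Set W) ∪ T) := by
  have h1 : ∀ z, z ∈ Algebra.adjoin K T ↔ z ∈ Algebra.adjoin ℚ ((K : Set W) ∪ T) := by
    intro z
    constructor
    · intro hz
      induction hz using Algebra.adjoin_induction with
      | mem x hx => exact Algebra.subset_adjoin (Or.inr hx)
      | algebraMap r => exact Algebra.subset_adjoin (Or.inl r.2)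
      | add x y _ _ hx hy => exact add_mem hx hy
      | mul x y _ _ hx hy => exact mul_mem hx hy
    · intro hz
      induction hz using Algebra.adjoin_induction with
      | mem x hx =>
        obtain hx | hx := hx
        · exact Subalgebra.algebraMap_mem (Algebra.adjoin K T) (⟨x, hx⟩ : K)
        · exact Algebra.subset_adjoin hx
      | algebraMap r =>
        have := Subalgebra.algebraMap_mem (Algebra.adjoin K T) (r : K)
        simpa using this
      | add x y _ _ hx hy => exact add_mem hx hy
      | mul x y _ _ hx hy => exact mul_mem hx hy
  rw [mem_algSpan, isAlgebraic_iff_exists_coeff_mem Subtype.val_injective,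
    isAlgebraic_iff_exists_coeff_mem Subtype.val_injective]
  refine exists_congr fun P ↦ and_congr_right fun _ ↦ and_congr_left fun _ ↦
    forall_congr' fun n ↦ ?_
  constructor
  · rintro ⟨c, hc⟩
    rw [← hc]
    exact ⟨⟨c, (h1 _).1 c.2⟩, rfl⟩
  · rintro ⟨c, hc⟩
    rw [← hc]
    exact ⟨⟨c, (h1 _).2 c.2⟩, rfl⟩

theorem exists_polynomial_of_mem_algSpan {A : Type*} [CommRing A] [IsDomain A] [Algebra ℚ A]
    (φ : A →+* W) {S : Set W} (hS : ∀ s ∈ S, s ∈ φ.range) {x : W}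
    (hx : x ∈ algSpan S) : ∃ g : A[X], g ≠ 0 ∧ eval₂ φ x g = 0 := by
  obtain ⟨P, hP, hc, h0⟩ := (isAlgebraic_iff_exists_coeff_mem Subtype.val_injective).1
      (mem_algSpan.1 hx)
  have hle : Algebra.adjoin ℚ S ≤ φ.toRatAlgHom.range := Algebra.adjoin_le hS
  have : P ∈ lifts φ := (lifts_iff_coeff_lifts _).2 fun n ↦ by
    obtain ⟨c, hc⟩ := hc n
    rw [← hc]
    exact hle c.2
  obtain ⟨g, rfl⟩ := (mem_lifts _).1 this
  exact ⟨g, fun h ↦ hP (by rw [h, Polynomial.map_zero]), by rwa [eval_map] at h0⟩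

theorem eval₂_injective_of_notMem {A : Type*} [CommRing A] [IsDomain A]
    {φ : A →+* W} (hφ : Function.Injective φ) {S : Set W} (hS : ∀ a, φ a ∈ algSpan S) {x : W}
    (hx : x ∉ algSpan S) : Function.Injective (eval₂RingHom φ x) := by
  rw [injective_iff_map_eq_zero]
  intro g hg
  by_contra hg0
  refine hx (mem_algSpan_of_root ((Polynomial.map_ne_zero_iff hφ).2 hg0) (fun n ↦ ?_) ?_)
  · rw [coeff_map]; exact hS _
  · rw [eval_map]; exact hg

theorem exists_kernel_generator {A : Type*} [CommRing A] [IsDomain A] [UniqueFactorizationMonoid A]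
    {φ : A →+* W} (hφ : Function.Injective φ) {x : W} (h : ∃ g : A[X], g ≠ 0 ∧ eval₂ φ x g = 0) :
    ∃ f : A[X], 0 < f.natDegree ∧ eval₂ φ x f = 0 ∧ ∀ g, eval₂ φ x g = 0 → f ∣ g := by
  obtain ⟨g₀, hg₀, hx⟩ := h
  set P := RingHom.ker (eval₂RingHom φ x)
  have hP : P.IsPrime := RingHom.ker_isPrime _
  obtain ⟨f, hfP, hf⟩ := hP.exists_mem_prime_of_ne_bot
    (fun hb ↦ hg₀ ((Submodule.mem_bot _).1 (hb.le (show g₀ ∈ P from hx))))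
  have hf0 : eval₂ φ x f = 0 := hfP
  have hdeg : 0 < f.natDegree := by
    rw [Nat.pos_iff_ne_zero]
    intro h0
    rw [eq_C_of_natDegree_eq_zero h0, eval₂_C] at hf0
    refine hf.ne_zero ?_
    rw [eq_C_of_natDegree_eq_zero h0, hφ (hf0.trans φ.map_zero.symm), C_0]
  have hprim : f.IsPrimitive := hf.irreducible.isPrimitive hdeg.ne'
  refine ⟨f, hdeg, hf0, fun g hg ↦ ?_⟩
  let _ : StrongNormalizationMonoid A := UniqueFactorizationMonoid.strongNormalizationMonoid
  let _ : NormalizedGCDMonoid A := UniqueFactorizationMonoid.toNormalizedGCDMonoid A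
  let ψ : FractionRing A →+* W := IsFractionRing.lift hφ
  have hψ : ∀ a, ψ (algebraMap A (FractionRing A) a) = φ a := IsFractionRing.lift_algebraMap hφ
  have hmap : ∀ g : A[X], eval₂ ψ x (g.map (algebraMap A (FractionRing A))) = eval₂ φ x g := by
    intro g
    rw [eval₂_map]
    congr 1
    ext a
    exact hψ a
  have hirr := (hprim.irreducible_iff_irreducible_map_fraction_map
    (K := FractionRing A)).1 hf.irreducible
  refine hprim.dvd_of_fraction_map_dvd_fraction_map (K := FractionRing A) ?_
  by_contra hnd
  obtain ⟨a, b, hab⟩ := (hirr.coprime_iff_not_dvd).2 hnd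
  have := congrArg (eval₂ ψ x) hab
  rw [eval₂_add, eval₂_mul, eval₂_mul, hmap, hmap, hf0, hg, mul_zero, mul_zero, add_zero,
    eval₂_one] at this
  exact zero_ne_one this

end AlgebraicSpan

section System
variable {W : Type*} [Field W]

/-- Parameters of the sixth Painlevé equation for which no resonance occurs, over a field whose
derivation is `t * (t - 1)` times the derivation with respect to `t`. -/
structure GenericParams (d : Der W) (t κ₀ κ₁ θ ρ κ : W) : Prop where
  map_t : d t = t * (t - 1)
  t_ne_zero : t ≠ 0
  t_ne_one : t ≠ 1
  map_ρ : d ρ = 0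
  κ_eq : κ = ρ * (κ₀ + κ₁ + θ - 1 - ρ)
  eq_zero_of_relation : ∀ n₀ n₁ n₂ n₃ n₄ : ℤ, n₀ * κ₀ + n₁ * κ₁ + n₂ * θ
    + n₃ * (2 * ρ - (κ₀ + κ₁ + θ - 1)) + n₄ = 0 → n₀ = 0 ∧ n₁ = 0 ∧ n₂ = 0 ∧ n₃ = 0 ∧ n₄ = 0

/-- The Hamiltonian system equivalent to the sixth Painlevé equation. -/
structure IsHamiltonian (d : Der W) (t κ₀ κ₁ θ κ q p : W) : Prop where
  map_q : d q = 2 * (cubic t).eval q * p - (linTerm t κ₀ κ₁ θ).eval q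
  map_p : d p = (derivative (linTerm t κ₀ κ₁ θ)).eval q * p
    - (derivative (cubic t)).eval q * p ^ 2 - κ

/-- The Riccati equation for the slope of a foliation invariant under the Hamiltonian system. -/
def IsRiccati (d : Der W) (t κ₀ κ₁ θ q p u : W) : Prop :=
  d u = (derivative (derivative (linTerm t κ₀ κ₁ θ))).eval q * p
    - (derivative (derivative (cubic t))).eval q * p ^ 2
    - 2 * (2 * (derivative (cubic t)).eval q * p - (derivative (linTerm t κ₀ κ₁ θ)).eval q) * u
    - 2 * (cubic t).eval q * u ^ 2

/-- The restriction of a derivation to a stable subfield. -/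
def Der.restrict (d : Der W) (F : Subfield W) (h : ∀ x ∈ F, d x ∈ F) : Der F where
  toFun x := ⟨d x, h x x.2⟩
  add' a b := Subtype.ext (map_add d (a : W) b)
  mul' a b := Subtype.ext (d.leibniz (a : W) b)

theorem Der.coe_restrict (d : Der W) (F : Subfield W) (h : ∀ x ∈ F, d x ∈ F) (x : F) :
    (d.restrict F h x : W) = d x := rfl

theorem map_cubic (F : Subfield W) (t : F) : (cubic t).map F.subtype = cubic (t : W) := by
  simp [cubic]

theorem map_linTerm (F : Subfield W) (t κ₀ κ₁ θ : F) :
    (linTerm t κ₀ κ₁ θ).map F.subtype = linTerm (t : W) κ₀ κ₁ θ := by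
  simp [linTerm]

theorem eval_cubic (t q : W) : (cubic t).eval q = q * (q - 1) * (q - t) := by
  simp [cubic]

theorem eval_linTerm (t κ₀ κ₁ θ q : W) : (linTerm t κ₀ κ₁ θ).eval q =
    κ₀ * (q - 1) * (q - t) + κ₁ * q * (q - t) + (θ - 1) * q * (q - 1) := by
  simp [linTerm]

variable [CharZero W]

/-- The subset `S` generates a field that is, up to algebraic extension, stable under `d` and
contains the parameters. -/
structure IsDifferentialBase (d : Der W) (t κ₀ κ₁ θ ρ : W) (S : Set W) : Prop where
  map_mem : ∀ x ∈ algSpan S, d x ∈ algSpan S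
  t_mem : t ∈ algSpan S
  κ₀_mem : κ₀ ∈ algSpan S
  κ₁_mem : κ₁ ∈ algSpan S
  θ_mem : θ ∈ algSpan S
  ρ_mem : ρ ∈ algSpan S

section
variable {d : Der W} {t κ₀ κ₁ θ ρ κ q p u : W} {S : Set W}

theorem IsDifferentialBase.of_subset (hS : IsDifferentialBase d t κ₀ κ₁ θ ρ S) {T : Set W}
    (hST : S ⊆ T) (hT : ∀ x ∈ T, x ∈ S ∨ d x ∈ algSpan T) :
    IsDifferentialBase d t κ₀ κ₁ θ ρ T := by
  have hle : algSpan S ≤ algSpan T := algSpan_mono hST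
  refine ⟨fun x hx ↦ d.mem_algSpan_of_forall (subset_algSpan _) (fun s hs ↦ ?_) hx, hle hS.t_mem,
    hle hS.κ₀_mem, hle hS.κ₁_mem, hle hS.θ_mem, hle hS.ρ_mem⟩
  exact (hT s hs).elim (fun h ↦ hle (hS.map_mem s (subset_algSpan S h))) id

theorem IsDifferentialBase.κ_mem (hS : IsDifferentialBase d t κ₀ κ₁ θ ρ S)
    (hgp : GenericParams d t κ₀ κ₁ θ ρ κ) : κ ∈ algSpan S := by
  rw [hgp.κ_eq]
  exact mul_mem hS.ρ_mem (sub_mem (sub_mem (add_mem (add_mem hS.κ₀_mem hS.κ₁_mem) hS.θ_mem)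
    (one_mem _)) hS.ρ_mem)

omit [CharZero W] in
theorem eval_cubic_mem {F : Subfield W} (ht : t ∈ F) (hq : q ∈ F) : (cubic t).eval q ∈ F := by
  rw [eval_cubic]
  exact mul_mem (mul_mem hq (sub_mem hq (one_mem _))) (sub_mem hq ht)

omit [CharZero W] in
theorem eval_linTerm_mem {F : Subfield W} (ht : t ∈ F) (h₀ : κ₀ ∈ F) (h₁ : κ₁ ∈ F) (hθ : θ ∈ F)
    (hq : q ∈ F) : (linTerm t κ₀ κ₁ θ).eval q ∈ F := by
  rw [eval_linTerm]
  have h1 := sub_mem hq (one_mem F)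
  have h2 := sub_mem hq ht
  exact add_mem (add_mem (mul_mem (mul_mem h₀ h1) h2) (mul_mem (mul_mem h₁ hq) h2))
    (mul_mem (mul_mem (sub_mem hθ (one_mem F)) hq) h1)

omit [CharZero W] in
theorem eval_derivative_cubic (t q : W) : (derivative (cubic t)).eval q =
    (q - 1) * (q - t) + q * (q - t) + q * (q - 1) := by
  simp [cubic]; ring

omit [CharZero W] in
theorem eval_derivative_linTerm (t κ₀ κ₁ θ q : W) : (derivative (linTerm t κ₀ κ₁ θ)).eval q =
    κ₀ * (2 * q - 1 - t) + κ₁ * (2 * q - t) + (θ - 1) * (2 * q - 1) := by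
  simp [linTerm]; ring

omit [CharZero W] in
theorem eval_derivative₂_cubic (t q : W) : (derivative (derivative (cubic t))).eval q =
    2 * ((q - 1) + (q - t) + q) := by
  simp [cubic]; ring

omit [CharZero W] in
theorem eval_derivative₂_linTerm (t κ₀ κ₁ θ q : W) :
    (derivative (derivative (linTerm t κ₀ κ₁ θ))).eval q = 2 * (κ₀ + κ₁ + (θ - 1)) := by
  simp [linTerm]; ring

theorem IsHamiltonian.mem_of_mem (hS : IsDifferentialBase d t κ₀ κ₁ θ ρ S)
    (h : IsHamiltonian d t κ₀ κ₁ θ κ q p) (hE : (cubic t).eval q ≠ 0) (hq : q ∈ algSpan S) :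
    p ∈ algSpan S := by
  have : p = (d q + (linTerm t κ₀ κ₁ θ).eval q) / (2 * (cubic t).eval q) := by
    rw [h.map_q]; field_simp; ring
  rw [this]
  exact div_mem (add_mem (hS.map_mem q hq)
    (eval_linTerm_mem hS.t_mem hS.κ₀_mem hS.κ₁_mem hS.θ_mem hq))
    (mul_mem (ofNat_mem _ 2) (eval_cubic_mem hS.t_mem hq))

theorem GenericParams.restrict (hgp : GenericParams d t κ₀ κ₁ θ ρ κ)
    (hS : IsDifferentialBase d t κ₀ κ₁ θ ρ S) :
    GenericParams (d.restrict (algSpan S) hS.map_mem) ⟨t, hS.t_mem⟩ ⟨κ₀, hS.κ₀_mem⟩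
      ⟨κ₁, hS.κ₁_mem⟩ ⟨θ, hS.θ_mem⟩ ⟨ρ, hS.ρ_mem⟩ ⟨κ, hS.κ_mem hgp⟩ where
  map_t := Subtype.ext hgp.map_t
  t_ne_zero h := hgp.t_ne_zero (congrArg Subtype.val h)
  t_ne_one h := hgp.t_ne_one (congrArg Subtype.val h)
  map_ρ := Subtype.ext hgp.map_ρ
  κ_eq := Subtype.ext hgp.κ_eq
  eq_zero_of_relation n₀ n₁ n₂ n₃ n₄ h := by
    refine hgp.eq_zero_of_relation n₀ n₁ n₂ n₃ n₄ ?_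
    have := congrArg (algSpan S).subtype h
    simp at this
    exact this

theorem GenericParams.eq_C_of_dvd {F : Type*} [Field F] [CharZero F] {d : Der F}
    {t κ₀ κ₁ θ ρ κ : F} (h : GenericParams d t κ₀ κ₁ θ ρ κ) {f : F[X][X][X]} (hf : f ≠ 0)
    (hd : f ∣ sixthField d t κ₀ κ₁ θ κ f) : ∃ c, f = C (C (C c)) :=
  eq_C_of_dvd_sixthField h.map_t h.t_ne_zero h.t_ne_one h.map_ρ h.κ_eq h.eq_zero_of_relation hf hd

/-- The derivation on polynomials in two variables given by the Hamiltonian system. -/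
noncomputable def hamiltonianField {F : Type*} [Field F] (d : Der F) (t κ₀ κ₁ θ κ : F) :
    Der F[X][X] :=
  vectorField d d 0 (C (2 * cubic t) * X - C (linTerm t κ₀ κ₁ θ))
    (C (derivative (linTerm t κ₀ κ₁ θ)) * X - C (derivative (cubic t)) * X ^ 2 - C (C κ))

theorem sixthField_C {F : Type*} [Field F] (d : Der F) (t κ₀ κ₁ θ κ : F) (f : F[X][X]) :
    sixthField d t κ₀ κ₁ θ κ (C f) = C (hamiltonianField d t κ₀ κ₁ θ κ f) := by
  simp only [sixthField, riccatiField, hamiltonianField, vectorField_apply, coeffDeriv_C,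
    derivative_C, polyDeriv_apply, mul_zero, add_zero, zero_mul, C_add, C_mul, C_sub, C_pow]

theorem eval₂_hamiltonianField (hS : IsDifferentialBase d t κ₀ κ₁ θ ρ S)
    (hgp : GenericParams d t κ₀ κ₁ θ ρ κ) (h : IsHamiltonian d t κ₀ κ₁ θ κ q p)
    (f : (algSpan S)[X][X]) :
    d (eval₂RingHom (eval₂RingHom (algSpan S).subtype q) p f) =
      eval₂RingHom (eval₂RingHom (algSpan S).subtype q) p (hamiltonianField
        (d.restrict (algSpan S) hS.map_mem) ⟨t, hS.t_mem⟩ ⟨κ₀, hS.κ₀_mem⟩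
      ⟨κ₁, hS.κ₁_mem⟩ ⟨θ, hS.θ_mem⟩ ⟨κ, hS.κ_mem hgp⟩ f) := by
  refine intertwine₂ _ _ d (fun a ↦ ?_) ?_ ?_ f
  · simp [hamiltonianField, Der.coe_restrict]
  · simp [hamiltonianField, h.map_q, ← eval_map, map_cubic, map_linTerm]
  · simp [hamiltonianField, h.map_p, ← eval_map, ← derivative_map, map_cubic, map_linTerm]

theorem eval₂_sixthField (hS : IsDifferentialBase d t κ₀ κ₁ θ ρ S)
    (hgp : GenericParams d t κ₀ κ₁ θ ρ κ) (h : IsHamiltonian d t κ₀ κ₁ θ κ q p)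
    (hu : IsRiccati d t κ₀ κ₁ θ q p u) (f : (algSpan S)[X][X][X]) :
    d (eval₂RingHom (eval₂RingHom (eval₂RingHom (algSpan S).subtype q) p) u f) =
      eval₂RingHom (eval₂RingHom (eval₂RingHom (algSpan S).subtype q) p) u (sixthField
        (d.restrict (algSpan S) hS.map_mem) ⟨t, hS.t_mem⟩ ⟨κ₀, hS.κ₀_mem⟩
      ⟨κ₁, hS.κ₁_mem⟩ ⟨θ, hS.θ_mem⟩ ⟨κ, hS.κ_mem hgp⟩ f) := by
  refine intertwine _ _ d (fun a ↦ ?_) ?_ f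
  · rw [sixthField_C]
    simpa using eval₂_hamiltonianField hS hgp h a
  · rw [IsRiccati] at hu
    simp [sixthField, riccatiField, hu, ← eval_map, ← derivative_map, map_cubic, map_linTerm]

omit [CharZero W] in
theorem subset_range_eval₂ {A : Type*} [CommRing A] {φ : A →+* W} {x : W} {S : Set W}
    (hS : ∀ s ∈ S, s ∈ φ.range) : ∀ s ∈ insert x S, s ∈ (eval₂RingHom φ x).range := by
  rintro s (rfl | hs)
  · exact ⟨X, by simp⟩
  · obtain ⟨a, rfl⟩ := hS s hs
    exact ⟨C a, by simp⟩

theorem eval₂_mem_algSpan {A : Type*} [CommRing A] {φ : A →+* W} {x : W} {S : Set W}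
    (hS : ∀ a, φ a ∈ algSpan S) (f : A[X]) : eval₂RingHom φ x f ∈ algSpan (insert x S) := by
  rw [coe_eval₂RingHom, eval₂_eq_sum_range]
  exact sum_mem fun n _ ↦ mul_mem (algSpan_mono (Set.subset_insert _ _) (hS _))
    (pow_mem (subset_algSpan _ (Set.mem_insert _ _)) n)

omit [CharZero W] in
theorem subtype_injective (F : Subfield W) : Function.Injective F.subtype := Subtype.val_injective

/-- A solution that is not algebraic over a differential field generates, with its derivative,
an extension of transcendence degree two. -/
theorem IsHamiltonian.notMem_algSpan (hS : IsDifferentialBase d t κ₀ κ₁ θ ρ S)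
    (hgp : GenericParams d t κ₀ κ₁ θ ρ κ) (h : IsHamiltonian d t κ₀ κ₁ θ κ q p)
    (hq : q ∉ algSpan S) : p ∉ algSpan (insert q S) := by
  intro hp
  have hinj : Function.Injective (eval₂RingHom (algSpan S).subtype q) :=
    eval₂_injective_of_notMem (subtype_injective _) (fun a ↦ a.2) hq
  obtain ⟨f, hdeg, hf0, hf⟩ := exists_kernel_generator hinj
    (exists_polynomial_of_mem_algSpan _ (subset_range_eval₂
      (fun s hs ↦ ⟨⟨s, subset_algSpan S hs⟩, rfl⟩)) hp)
  have key := eval₂_hamiltonianField hS hgp h f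
  rw [coe_eval₂RingHom, hf0, map_zero] at key
  obtain ⟨g, hg⟩ := hf _ key.symm
  have hfne : f ≠ 0 := by rintro rfl; simp at hdeg
  obtain ⟨c, hc⟩ := (hgp.restrict hS).eq_C_of_dvd (C_ne_zero.2 hfne)
    (by rw [sixthField_C]; exact ⟨C g, by rw [← C_mul, ← hg]⟩)
  rw [C_injective hc, natDegree_C] at hdeg
  exact lt_irrefl _ hdeg

/-- The Riccati equation along a transcendental solution has no algebraic solution. -/
theorem IsRiccati.notMem_algSpan (hS : IsDifferentialBase d t κ₀ κ₁ θ ρ S)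
    (hgp : GenericParams d t κ₀ κ₁ θ ρ κ) (h : IsHamiltonian d t κ₀ κ₁ θ κ q p)
    (hq : q ∉ algSpan S) (hu : IsRiccati d t κ₀ κ₁ θ q p u) :
    u ∉ algSpan (insert p (insert q S)) := by
  intro hmem
  have hp := h.notMem_algSpan hS hgp hq
  have hinj : Function.Injective (eval₂RingHom (algSpan S).subtype q) :=
    eval₂_injective_of_notMem (subtype_injective _) (fun a ↦ a.2) hq
  have hinj₂ := eval₂_injective_of_notMem hinj (eval₂_mem_algSpan (fun a ↦ a.2)) hp
  obtain ⟨f, hdeg, hf0, hf⟩ := exists_kernel_generator hinj₂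
    (exists_polynomial_of_mem_algSpan _ (subset_range_eval₂ (subset_range_eval₂
      (fun s hs ↦ ⟨⟨s, subset_algSpan S hs⟩, rfl⟩))) hmem)
  have key := eval₂_sixthField hS hgp h hu f
  rw [coe_eval₂RingHom, hf0, map_zero] at key
  have hfne : f ≠ 0 := by rintro rfl; simp at hdeg
  obtain ⟨c, hc⟩ := (hgp.restrict hS).eq_C_of_dvd hfne (hf _ key.symm)
  rw [hc, natDegree_C] at hdeg
  exact lt_irrefl _ hdeg

end
end System

section
variable {W : Type*} [Field W]

/-- The linear combination `a • δ₁ + b • δ₂` of derivations. -/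
def Der.comb (a b : W) (δ₁ δ₂ : Der W) : Der W where
  toFun x := a * δ₁ x + b * δ₂ x
  add' x y := by rw [map_add, map_add]; ring
  mul' x y := by rw [Der.leibniz, Der.leibniz]; ring

theorem Der.comb_apply (a b : W) (δ₁ δ₂ : Der W) (x : W) :
    Der.comb a b δ₁ δ₂ x = a * δ₁ x + b * δ₂ x := rfl

/-- The commutator of derivations. -/
def Der.bracket (δ₁ δ₂ : Der W) : Der W where
  toFun x := δ₁ (δ₂ x) - δ₂ (δ₁ x)
  add' x y := by simp only [map_add]; ring
  mul' x y := by simp only [Der.leibniz, map_add]; ring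

theorem Der.bracket_apply (δ₁ δ₂ : Der W) (x : W) :
    Der.bracket δ₁ δ₂ x = δ₁ (δ₂ x) - δ₂ (δ₁ x) := rfl

variable {δ : Der W} {t κ₀ κ₁ θ κ q p u : W}

theorem Der.map_eval_cubic (ht : δ t = 0) :
    δ ((cubic t).eval q) = (derivative (cubic t)).eval q * δ q := by
  rw [eval_cubic, eval_derivative_cubic]
  simp only [Der.leibniz, map_sub, Der.map_one, ht]
  ring

theorem Der.map_eval_derivative_cubic (ht : δ t = 0) :
    δ ((derivative (cubic t)).eval q) = (derivative (derivative (cubic t))).eval q * δ q := by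
  rw [eval_derivative_cubic, eval_derivative₂_cubic]
  simp only [Der.leibniz, map_sub, map_add, Der.map_one, ht]
  ring

theorem Der.map_eval_linTerm (ht : δ t = 0) (h₀ : δ κ₀ = 0) (h₁ : δ κ₁ = 0) (hθ : δ θ = 0) :
    δ ((linTerm t κ₀ κ₁ θ).eval q) = (derivative (linTerm t κ₀ κ₁ θ)).eval q * δ q := by
  rw [eval_linTerm, eval_derivative_linTerm]
  simp only [Der.leibniz, map_sub, map_add, Der.map_one, ht, h₀, h₁, hθ]
  ring

theorem Der.map_eval_derivative_linTerm (ht : δ t = 0) (h₀ : δ κ₀ = 0) (h₁ : δ κ₁ = 0)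
    (hθ : δ θ = 0) : δ ((derivative (linTerm t κ₀ κ₁ θ)).eval q) =
      (derivative (derivative (linTerm t κ₀ κ₁ θ))).eval q * δ q := by
  have h2 : δ 2 = 0 := δ.map_ofNat 2
  rw [eval_derivative_linTerm, eval_derivative₂_linTerm]
  simp only [Der.leibniz, map_sub, map_add, Der.map_one, h2, ht, h₀, h₁, hθ]
  ring

/-- The linearization of the Hamiltonian system along a derivation killing the parameters. -/
theorem IsHamiltonian.map_derivation {d : Der W} (h : IsHamiltonian d t κ₀ κ₁ θ κ q p)
    (ht : δ t = 0) (h₀ : δ κ₀ = 0) (h₁ : δ κ₁ = 0) (hθ : δ θ = 0) (hκ : δ κ = 0) :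
    δ (d q) =
      (2 * (derivative (cubic t)).eval q * p - (derivative (linTerm t κ₀ κ₁ θ)).eval q) * δ q
      + 2 * (cubic t).eval q * δ p ∧
    δ (d p) = ((derivative (derivative (linTerm t κ₀ κ₁ θ))).eval q * p
      - (derivative (derivative (cubic t))).eval q * p ^ 2) * δ q
      + ((derivative (linTerm t κ₀ κ₁ θ)).eval q - 2 * (derivative (cubic t)).eval q * p) *
        δ p := by
  constructor
  · have h2 : δ 2 = 0 := δ.map_ofNat 2
    rw [h.map_q]
    simp only [Der.leibniz, map_sub, Der.map_eval_cubic ht, Der.map_eval_linTerm ht h₀ h₁ hθ, h2]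
    ring
  · rw [h.map_p]
    simp only [Der.leibniz, Der.leibniz_pow, map_sub, Der.map_eval_derivative_cubic ht,
      Der.map_eval_derivative_linTerm ht h₀ h₁ hθ, hκ]
    push_cast
    ring

/-- If two derivations commute up to a multiple of the second one, then the slope of the second
one along a solution of the Hamiltonian system solves the Riccati equation. -/
theorem IsHamiltonian.isRiccati {d : Der W} (h : IsHamiltonian d t κ₀ κ₁ θ κ q p)
    (ht : δ t = 0) (h₀ : δ κ₀ = 0) (h₁ : δ κ₁ = 0) (hθ : δ θ = 0) (hκ : δ κ = 0) {μ : W}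
    (hq : d (δ q) = δ (d q) - μ * δ q) (hp : d (δ p) = δ (d p) - μ * δ p) (hne : δ q ≠ 0) :
    IsRiccati d t κ₀ κ₁ θ q p (δ p / δ q) := by
  obtain ⟨e1, e2⟩ := h.map_derivation ht h₀ h₁ hθ hκ
  rw [IsRiccati, Der.map_div _ _ hne, hq, hp, e1, e2]
  field_simp
  ring

theorem IsHamiltonian.map_mem {d : Der W} (h : IsHamiltonian d t κ₀ κ₁ θ κ q p) {F : Subfield W}
    (ht : t ∈ F) (h₀ : κ₀ ∈ F) (h₁ : κ₁ ∈ F) (hθ : θ ∈ F) (hκ : κ ∈ F) (hq : q ∈ F) (hp : p ∈ F) :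
    d q ∈ F ∧ d p ∈ F := by
  rw [h.map_q, h.map_p, eval_cubic, eval_linTerm, eval_derivative_cubic, eval_derivative_linTerm]
  constructor
  all_goals repeat' first
    | assumption
    | apply one_mem
    | apply ofNat_mem
    | apply add_mem
    | apply sub_mem
    | apply mul_mem
    | apply pow_mem

theorem IsRiccati.map_mem {d : Der W} (h : IsRiccati d t κ₀ κ₁ θ q p u) {F : Subfield W}
    (ht : t ∈ F) (h₀ : κ₀ ∈ F) (h₁ : κ₁ ∈ F) (hθ : θ ∈ F) (hq : q ∈ F) (hp : p ∈ F) (hu : u ∈ F) :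
    d u ∈ F := by
  rw [h, eval_cubic, eval_derivative_cubic, eval_derivative_linTerm, eval_derivative₂_cubic,
    eval_derivative₂_linTerm]
  repeat' first
    | assumption
    | apply one_mem
    | apply ofNat_mem
    | apply add_mem
    | apply sub_mem
    | apply mul_mem
    | apply pow_mem

variable [CharZero W]

theorem IsDifferentialBase.insert_insert {d : Der W} {ρ : W} {S : Set W}
    (hS : IsDifferentialBase d t κ₀ κ₁ θ ρ S) (hgp : GenericParams d t κ₀ κ₁ θ ρ κ)
    (h : IsHamiltonian d t κ₀ κ₁ θ κ q p) :
    IsDifferentialBase d t κ₀ κ₁ θ ρ (insert p (insert q S)) := by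
  have hsub : S ⊆ insert p (insert q S) := fun s hs ↦ Or.inr (Or.inr hs)
  have hle := algSpan_mono hsub
  have hm := h.map_mem (hle hS.t_mem) (hle hS.κ₀_mem) (hle hS.κ₁_mem) (hle hS.θ_mem)
    (hle (hS.κ_mem hgp)) (subset_algSpan _ (Or.inr (Or.inl rfl)))
    (subset_algSpan _ (Or.inl rfl))
  refine hS.of_subset hsub ?_
  rintro s (rfl | rfl | hs)
  · exact Or.inr hm.2
  · exact Or.inr hm.1
  · exact Or.inl hs

theorem IsDifferentialBase.insert {d : Der W} {ρ : W} {S : Set W}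
    (hS : IsDifferentialBase d t κ₀ κ₁ θ ρ S) (hu : IsRiccati d t κ₀ κ₁ θ q p u)
    (hq : q ∈ algSpan S) (hp : p ∈ algSpan S) :
    IsDifferentialBase d t κ₀ κ₁ θ ρ (insert u S) := by
  have hsub : S ⊆ Insert.insert u S := Set.subset_insert u S
  have hle := algSpan_mono hsub
  refine hS.of_subset hsub ?_
  rintro s (rfl | hs)
  · exact Or.inr (hu.map_mem (hle hS.t_mem) (hle hS.κ₀_mem) (hle hS.κ₁_mem) (hle hS.θ_mem)
      (hle hq) (hle hp) (subset_algSpan _ (Or.inl rfl)))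
  · exact Or.inl hs

/-- Two solutions that are interalgebraic over a field generated by a third one cannot be
independent of each other. -/
theorem IsRiccati.false_of_interalgebraic {d : Der W} {ρ q₂ p₂ : W} {S₀ S₃ : Set W}
    (hS₀ : IsDifferentialBase d t κ₀ κ₁ θ ρ S₀) (hS₃ : IsDifferentialBase d t κ₀ κ₁ θ ρ S₃)
    (hgp : GenericParams d t κ₀ κ₁ θ ρ κ) (h₁ : IsHamiltonian d t κ₀ κ₁ θ κ q p)
    (h₂ : IsHamiltonian d t κ₀ κ₁ θ κ q₂ p₂) (hu : IsRiccati d t κ₀ κ₁ θ q p u)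
    (hq : q ∉ algSpan S₃) (hq₂ : q₂ ∉ algSpan S₃)
    (hq₂' : q₂ ∈ algSpan (insert p (insert q S₃))) (hp₂' : p₂ ∈ algSpan (insert p (insert q S₃)))
    (hS₃' : S₃ ⊆ algSpan (insert p₂ (insert q₂ (insert p (insert q S₀)))))
    (hq₂u : q₂ ∉ algSpan (insert u (insert p (insert q S₀)))) : False := by
  have hp : p ∉ algSpan (insert q S₃) := h₁.notMem_algSpan hS₃ hgp hq
  have hu' : u ∉ algSpan (insert p (insert q S₃)) := hu.notMem_algSpan hS₃ hgp h₁ hq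
  obtain ⟨δ₁, hδ₁, hδ₁q⟩ := exists_der_of_transcendental
    (transcendental_of_notMem_algSpan (fun h ↦ hp (algSpan_exchange hq h)))
  obtain ⟨δ₂, hδ₂, hδ₂p⟩ := exists_der_of_transcendental (transcendental_of_notMem_algSpan hp)
  have hδ₁p : δ₁ p = 0 := hδ₁ ⟨p, subset_algSpan _ (Set.mem_insert _ _)⟩
  have hδ₂q : δ₂ q = 0 := hδ₂ ⟨q, subset_algSpan _ (Set.mem_insert _ _)⟩
  have hδ₁S : ∀ s ∈ algSpan S₃, δ₁ s = 0 := fun s hs ↦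
    hδ₁ ⟨s, algSpan_mono (Set.subset_insert _ _) hs⟩
  have hδ₂S : ∀ s ∈ algSpan S₃, δ₂ s = 0 := fun s hs ↦
    hδ₂ ⟨s, algSpan_mono (Set.subset_insert _ _) hs⟩
  set δ := Der.comb 1 u δ₁ δ₂ with hδ
  have hδS : ∀ s ∈ algSpan S₃, δ s = 0 := fun s hs ↦ by
    rw [hδ, Der.comb_apply, hδ₁S s hs, hδ₂S s hs]; ring
  have hδq : δ q = 1 := by rw [hδ, Der.comb_apply, hδ₁q, hδ₂q]; ring
  have hδp : δ p = u := by rw [hδ, Der.comb_apply, hδ₁p, hδ₂p]; ring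
  have ht := hδS _ hS₃.t_mem
  have hκ₀ := hδS _ hS₃.κ₀_mem
  have hκ₁ := hδS _ hS₃.κ₁_mem
  have hθ := hδS _ hS₃.θ_mem
  have hκ := hδS _ (hS₃.κ_mem hgp)
  obtain ⟨e1, e2⟩ := h₁.map_derivation ht hκ₀ hκ₁ hθ hκ
  rw [hδq, hδp] at e1 e2
  rw [IsRiccati] at hu
  set μ := 2 * (derivative (cubic t)).eval q * p - (derivative (linTerm t κ₀ κ₁ θ)).eval q
    + 2 * (cubic t).eval q * u with hμ
  have hΔ : ∀ x ∈ algSpan (insert p (insert q S₃)),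
      Der.comb 1 μ (Der.bracket d δ) δ x = 0 := by
    refine fun x hx ↦ Der.eq_zero_of_mem_algSpan _ ?_ hx
    rintro s (rfl | rfl | hs)
    · rw [Der.comb_apply, Der.bracket_apply, e2, hδp, hu, hμ]; ring
    · rw [Der.comb_apply, Der.bracket_apply, e1, hδq, Der.map_one, hμ]; ring
    · have hs' := subset_algSpan S₃ hs
      rw [Der.comb_apply, Der.bracket_apply, hδS s hs', hδS _ (hS₃.map_mem s hs'), map_zero]; ring
  have hq₂d := hΔ q₂ hq₂'
  have hp₂d := hΔ p₂ hp₂'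
  rw [Der.comb_apply, Der.bracket_apply] at hq₂d hp₂d
  have hne : δ q₂ ≠ 0 := by
    intro h0
    have hmem₁ : δ₁ q₂ ∈ algSpan (insert p (insert q S₃)) := by
      refine δ₁.mem_algSpan_of_forall (subset_algSpan _) ?_ hq₂'
      rintro s (rfl | rfl | hs)
      · rw [hδ₁p]; exact zero_mem _
      · rw [hδ₁q]; exact one_mem _
      · rw [hδ₁S s (subset_algSpan _ hs)]; exact zero_mem _
    have hmem₂ : δ₂ q₂ ∈ algSpan (insert p (insert q S₃)) := by
      refine δ₂.mem_algSpan_of_forall (subset_algSpan _) ?_ hq₂'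
      rintro s (rfl | rfl | hs)
      · rw [hδ₂p]; exact one_mem _
      · rw [hδ₂q]; exact zero_mem _
      · rw [hδ₂S s (subset_algSpan _ hs)]; exact zero_mem _
    rw [hδ, Der.comb_apply] at h0
    have h2 : δ₂ q₂ = 0 := by
      by_contra h2
      refine hu' ?_
      have : u = -δ₁ q₂ / δ₂ q₂ := by field_simp; linear_combination h0
      rw [this]
      exact div_mem (neg_mem hmem₁) hmem₂
    have h1 : δ₁ q₂ = 0 := by linear_combination h0 - u * h2
    obtain ⟨δ₃, hδ₃, hδ₃q⟩ := exists_der_of_transcendental (transcendental_of_notMem_algSpan hq₂)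
    have := Der.eq_zero_of_mem_algSpan
      (Der.comb 1 (-1) δ₃ (Der.comb (δ₃ q) (δ₃ p) δ₁ δ₂)) ?_ hq₂'
    · rw [Der.comb_apply, Der.comb_apply, h1, h2, hδ₃q] at this
      simp at this
    · rintro s (rfl | rfl | hs)
      · rw [Der.comb_apply, Der.comb_apply, hδ₁p, hδ₂p]; ring
      · rw [Der.comb_apply, Der.comb_apply, hδ₁q, hδ₂q]; ring
      · have hs' := subset_algSpan S₃ hs
        have hs₃ : δ₃ s = 0 := hδ₃ ⟨s, hs'⟩
        rw [Der.comb_apply, Der.comb_apply, hδ₁S s hs', hδ₂S s hs', hs₃]; ring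
  have hric := h₂.isRiccati (μ := μ) ht hκ₀ hκ₁ hθ hκ (by linear_combination hq₂d)
    (by linear_combination hp₂d) hne
  have hS : IsDifferentialBase d t κ₀ κ₁ θ ρ (insert u (insert p (insert q S₀))) :=
    (hS₀.insert_insert hgp h₁).insert hu (subset_algSpan _ (Or.inr (Or.inl rfl)))
      (subset_algSpan _ (Or.inl rfl))
  have hT : insert p (insert q S₃) ⊆
      algSpan (insert p₂ (insert q₂ (insert u (insert p (insert q S₀))))) := by
    rintro s (rfl | rfl | hs)
    · exact subset_algSpan _ (by simp)
    · exact subset_algSpan _ (by simp)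
    · refine algSpan_mono ?_ (hS₃' hs)
      exact Set.insert_subset_insert (Set.insert_subset_insert (Set.subset_insert _ _))
  have hδT : ∀ x ∈ algSpan (insert p (insert q S₃)),
      δ x ∈ algSpan (insert p₂ (insert q₂ (insert u (insert p (insert q S₀))))) := by
    refine fun x hx ↦ δ.mem_algSpan_of_forall hT ?_ hx
    rintro s (rfl | rfl | hs)
    · rw [hδp]; exact subset_algSpan _ (by simp)
    · rw [hδq]; exact one_mem _
    · rw [hδS s (subset_algSpan _ hs)]; exact zero_mem _
  exact hric.notMem_algSpan hS hgp h₂ hq₂u (div_mem (hδT _ hp₂') (hδT _ hq₂'))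
end

section
variable {L : Type*} [Field L] [CharZero L]

omit [CharZero L] in
/-- Extend a derivation to the field of rational functions in one more variable, with prescribed
value on the variable. -/
theorem exists_extend_adjoin (d : Der L) (R : L[X]) : ∃ δ : Der (FractionRing L[X]),
    (∀ a, δ (algebraMap L[X] _ (C a)) = algebraMap L[X] _ (C (d a))) ∧
      δ (algebraMap L[X] _ X) = algebraMap L[X] _ R := by
  let δ₀ : Der L[X] :=
    { toFun := fun f ↦ coeffDeriv d f + R * derivative f
      add' := fun f g ↦ by rw [map_add, derivative_add]; ring
      mul' := fun f g ↦ by rw [Der.leibniz, derivative_mul]; ring }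
  obtain ⟨δ, hδ⟩ := exists_extend_fractionRing δ₀
  refine ⟨δ, fun a ↦ ?_, ?_⟩
  · rw [hδ]
    change algebraMap _ _ (coeffDeriv d (C a) + R * derivative (C a)) = _
    rw [coeffDeriv_C, derivative_C, mul_zero, add_zero]
  · rw [hδ]
    change algebraMap _ _ (coeffDeriv d X + R * derivative X) = _
    rw [coeffDeriv_X, derivative_X, mul_one, zero_add]

variable {W : Type*} [Field W] [CharZero W] {j : L →+* W} {d : Der L} {δ : Der W}
  {t κ₀ κ₁ θ ρ κ q p q₂ p₂ : L} {S S₀ S₃ : Set L}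

omit [CharZero L] [CharZero W] in
theorem GenericParams.map (hj : ∀ x, δ (j x) = j (d x)) (h : GenericParams d t κ₀ κ₁ θ ρ κ) :
    GenericParams δ (j t) (j κ₀) (j κ₁) (j θ) (j ρ) (j κ) where
  map_t := by rw [hj, h.map_t]; simp
  t_ne_zero := (map_ne_zero j).2 h.t_ne_zero
  t_ne_one h1 := h.t_ne_one (j.injective (h1.trans j.map_one.symm))
  map_ρ := by rw [hj, h.map_ρ, map_zero]
  κ_eq := by rw [h.κ_eq]; simp
  eq_zero_of_relation n₀ n₁ n₂ n₃ n₄ h0 := by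
    have e2 : j 2 = 2 := map_ofNat j 2
    exact h.eq_zero_of_relation n₀ n₁ n₂ n₃ n₄ (j.injective (by simpa [e2] using h0))

omit [CharZero L] [CharZero W] in
theorem IsHamiltonian.map (hj : ∀ x, δ (j x) = j (d x)) (h : IsHamiltonian d t κ₀ κ₁ θ κ q p) :
    IsHamiltonian δ (j t) (j κ₀) (j κ₁) (j θ) (j κ) (j q) (j p) where
  map_q := by
    rw [hj, h.map_q]
    simp only [eval_cubic, eval_linTerm, map_sub, map_add, map_mul, map_ofNat, map_one]
  map_p := by
    rw [hj, h.map_p]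
    simp only [eval_derivative_cubic, eval_derivative_linTerm, map_sub, map_add, map_mul,
      map_ofNat, map_one, map_pow]

theorem IsDifferentialBase.map (hj : ∀ x, δ (j x) = j (d x))
    (h : IsDifferentialBase d t κ₀ κ₁ θ ρ S) :
    IsDifferentialBase δ (j t) (j κ₀) (j κ₁) (j θ) (j ρ) (j '' S) where
  map_mem x hx := by
    refine δ.mem_algSpan_of_forall (subset_algSpan _) ?_ hx
    rintro _ ⟨s, hs, rfl⟩
    rw [hj, map_mem_algSpan]
    exact h.map_mem s (subset_algSpan S hs)
  t_mem := (map_mem_algSpan j).2 h.t_mem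
  κ₀_mem := (map_mem_algSpan j).2 h.κ₀_mem
  κ₁_mem := (map_mem_algSpan j).2 h.κ₁_mem
  θ_mem := (map_mem_algSpan j).2 h.θ_mem
  ρ_mem := (map_mem_algSpan j).2 h.ρ_mem

/-- Three solutions, pairwise independent over a differential field, are independent over it. -/
theorem IsHamiltonian.false_of_interalgebraic
    (hS₀ : IsDifferentialBase d t κ₀ κ₁ θ ρ S₀) (hS₃ : IsDifferentialBase d t κ₀ κ₁ θ ρ S₃)
    (hgp : GenericParams d t κ₀ κ₁ θ ρ κ) (h₁ : IsHamiltonian d t κ₀ κ₁ θ κ q p)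
    (h₂ : IsHamiltonian d t κ₀ κ₁ θ κ q₂ p₂)
    (hq : q ∉ algSpan S₃) (hq₂ : q₂ ∉ algSpan S₃)
    (hq₂' : q₂ ∈ algSpan (insert p (insert q S₃))) (hp₂' : p₂ ∈ algSpan (insert p (insert q S₃)))
    (hS₃' : S₃ ⊆ algSpan (insert p₂ (insert q₂ (insert p (insert q S₀)))))
    (hq₂₁ : q₂ ∉ algSpan (insert p (insert q S₀))) : False := by
  obtain ⟨δ, hδ, hδu⟩ := exists_extend_adjoin d
    (C ((derivative (derivative (linTerm t κ₀ κ₁ θ))).eval q * p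
      - (derivative (derivative (cubic t))).eval q * p ^ 2)
      - C (2 * (2 * (derivative (cubic t)).eval q * p -
          (derivative (linTerm t κ₀ κ₁ θ)).eval q)) * X
      - C (2 * (cubic t).eval q) * X ^ 2)
  let j : L →+* FractionRing L[X] := (algebraMap L[X] (FractionRing L[X])).comp C
  have hj : ∀ x, δ (j x) = j (d x) := hδ
  have hjC : ∀ x, algebraMap L[X] (FractionRing L[X]) (C x) = j x := fun _ ↦ rfl
  have : CharZero (FractionRing L[X]) := charZero_of_injective_ringHom j.injective
  set u : FractionRing L[X] := algebraMap L[X] (FractionRing L[X]) X with hu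
  have hric : IsRiccati δ (j t) (j κ₀) (j κ₁) (j θ) (j q) (j p) u := by
    rw [IsRiccati, hδu]
    simp only [map_sub, map_mul, map_pow, hjC, eval_cubic, eval_derivative_cubic,
      eval_derivative_linTerm, eval_derivative₂_cubic, eval_derivative₂_linTerm, map_add,
      map_ofNat, map_one, ← hu]
  have hutr : u ∉ algSpan (Set.range j) := by
    intro h
    obtain ⟨g, hg, hg0⟩ := exists_polynomial_of_mem_algSpan j (fun s hs ↦ hs) h
    refine hg ((IsFractionRing.injective L[X] (FractionRing L[X])) ?_)
    rw [map_zero, ← hg0, hu, ← hom_eval₂, eval₂_C_X]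
  have himg : ∀ a b : L, ∀ T : Set L, insert (j a) (insert (j b) (j '' T)) =
      j '' (insert a (insert b T)) := fun a b T ↦ by rw [Set.image_insert_eq, Set.image_insert_eq]
  refine hric.false_of_interalgebraic (hS₀.map hj) (hS₃.map hj) (hgp.map hj) (h₁.map hj)
    (h₂.map hj) ?_ ?_ ?_ ?_ ?_ ?_
  · rwa [map_mem_algSpan]
  · rwa [map_mem_algSpan]
  · rwa [himg, map_mem_algSpan]
  · rwa [himg, map_mem_algSpan]
  · rw [himg, himg]
    rintro _ ⟨s, hs, rfl⟩
    exact (map_mem_algSpan j).2 (hS₃' hs)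
  · rw [himg]
    intro hmem
    refine hutr (algSpan_mono ?_ (algSpan_exchange (by rwa [map_mem_algSpan]) hmem))
    rw [← Set.image_insert_eq]
    exact Set.image_subset_range _ _

variable {ι : Type*} [DecidableEq ι]

omit [Field L] [CharZero L] in
theorem insert_insert_image (S : Set L) (q p : ι → L) (a : ι) (J : Finset ι) :
    S ∪ (q '' ↑(insert a J) ∪ p '' ↑(insert a J)) =
      insert (p a) (insert (q a) (S ∪ (q '' ↑J ∪ p '' ↑J))) := by
  rw [Finset.coe_insert, Set.image_insert_eq, Set.image_insert_eq]
  ext x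
  simp only [Set.mem_union, Set.mem_insert_iff]
  tauto

theorem IsDifferentialBase.union_image (hS : IsDifferentialBase d t κ₀ κ₁ θ ρ S)
    (hgp : GenericParams d t κ₀ κ₁ θ ρ κ) {q p : ι → L}
    (h : ∀ i, IsHamiltonian d t κ₀ κ₁ θ κ (q i) (p i)) (J : Finset ι) :
    IsDifferentialBase d t κ₀ κ₁ θ ρ (S ∪ (q '' J ∪ p '' J)) := by
  induction J using Finset.induction_on with
  | empty => simpa using hS
  | insert a J _ ih =>
    rw [insert_insert_image]
    exact ih.insert_insert hgp (h a)

/-- Exchange for solutions of the Hamiltonian system. -/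
theorem IsHamiltonian.exchange (hS : IsDifferentialBase d t κ₀ κ₁ θ ρ S)
    (hgp : GenericParams d t κ₀ κ₁ θ ρ κ) (h₁ : IsHamiltonian d t κ₀ κ₁ θ κ q p)
    (h₂ : IsHamiltonian d t κ₀ κ₁ θ κ q₂ p₂) (hq : q ∉ algSpan S)
    (hq' : q ∈ algSpan (insert p₂ (insert q₂ S))) : q₂ ∈ algSpan (insert p (insert q S)) := by
  by_contra hcon
  have hp := h₂.notMem_algSpan (hS.insert_insert hgp h₁) hgp hcon
  by_cases hc : q ∈ algSpan (insert q₂ S)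
  · exact hcon (algSpan_mono (Set.subset_insert _ _) (algSpan_exchange hq hc))
  · refine hp (algSpan_mono ?_ (algSpan_exchange hc hq'))
    rw [Set.insert_comm]
    exact Set.insert_subset_insert (Set.insert_subset (Or.inr (Or.inl rfl))
      (fun s hs ↦ Or.inr (Or.inr hs)))

/-- An algebraic dependence among solutions yields one between two of them. -/
theorem IsHamiltonian.exists_pair (hS : IsDifferentialBase d t κ₀ κ₁ θ ρ S)
    (hgp : GenericParams d t κ₀ κ₁ θ ρ κ) {q p : ι → L}
    (h : ∀ i, IsHamiltonian d t κ₀ κ₁ θ κ (q i) (p i)) (hE : ∀ i, (cubic t).eval (q i) ≠ 0)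
    (J : Finset ι) {i : ι} (hi : i ∉ J) (hmem : q i ∈ algSpan (S ∪ (q '' J ∪ p '' J))) :
    (∃ i, q i ∈ algSpan S) ∨ ∃ i j, i ≠ j ∧ q i ∈ algSpan (insert (p j) (insert (q j) S)) := by
  induction hn : J.card using Nat.strong_induction_on generalizing J i with
  | _ n ih =>
    by_contra hcon
    have hmin : ∀ (J' : Finset ι) (k : ι), J'.card < J.card → k ∉ J' →
        q k ∉ algSpan (S ∪ (q '' J' ∪ p '' J')) := fun J' k hlt hk hmem' ↦
      hcon (ih _ (hn ▸ hlt) J' hk hmem' rfl)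
    obtain rfl | ⟨a, ha⟩ := J.eq_empty_or_nonempty
    · exact hcon (Or.inl ⟨i, by simpa using hmem⟩)
    obtain ⟨J, haJ, rfl⟩ : ∃ J', a ∉ J' ∧ insert a J' = J :=
      ⟨J.erase a, Finset.notMem_erase a J, Finset.insert_erase ha⟩
    obtain rfl | ⟨b, hb⟩ := J.eq_empty_or_nonempty
    · rw [insert_insert_image] at hmem
      exact hcon (Or.inr ⟨i, a, by simpa using hi, by simpa using hmem⟩)
    obtain ⟨J, hbJ, rfl⟩ : ∃ J', b ∉ J' ∧ insert b J' = J :=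
      ⟨J.erase b, Finset.notMem_erase b J, Finset.insert_erase hb⟩
    simp only [Finset.mem_insert, not_or] at hi haJ
    have hab : a ∉ insert b J := by simp [haJ]
    have hcard : (insert a (insert b J)).card = J.card + 2 := by
      rw [Finset.card_insert_of_notMem hab, Finset.card_insert_of_notMem hbJ]
    have hmin' : ∀ k l, k ∉ insert l J → q k ∉ algSpan
        (insert (p l) (insert (q l) (S ∪ (q '' ↑J ∪ p '' ↑J)))) := by
      intro k l hk
      rw [← insert_insert_image]
      refine hmin _ k ?_ hk
      rw [hcard]
      exact (Finset.card_insert_le _ _).trans_lt (by omega)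
    have hS₀ := hS.union_image hgp h J
    have hSa := hS₀.insert_insert hgp (h a)
    rw [Finset.insert_comm, insert_insert_image, insert_insert_image] at hmem
    have hSi := hS₀.insert_insert hgp (h i)
    have hb' := (h i).exchange hSa hgp (h b) (hmin' i a (by simp [hi])) hmem
    have hcomm : insert (p i) (insert (q i) (insert (p a) (insert (q a)
        (S ∪ (q '' ↑J ∪ p '' ↑J))))) = insert (p a) (insert (q a) (insert (p i) (insert (q i)
        (S ∪ (q '' ↑J ∪ p '' ↑J))))) := by
      ext x
      simp only [Set.mem_insert_iff]
      tauto
    rw [hcomm] at hb'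
    refine (h a).false_of_interalgebraic hS₀ hSi hgp (h b) (hmin' a i ?_) (hmin' b i ?_) hb'
      ((h b).mem_of_mem (hSi.insert_insert hgp (h a)) (hE b) hb') ?_ (hmin' b a ?_)
    · simp [haJ, Ne.symm hi.1]
    · simp [hbJ, Ne.symm hi.2.1]
    · rintro s (rfl | rfl | hs)
      · exact (h i).mem_of_mem (hSa.insert_insert hgp (h b)) (hE i) hmem
      · exact hmem
      · exact subset_algSpan _ (Or.inr (Or.inr (Or.inr (Or.inr hs))))
    · simp [hbJ, Ne.symm haJ.1]
end

section
variable {L : Type*} [Field L] [CharZero L]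

/-- The conjugate momentum of a solution of the sixth Painlevé equation. -/
noncomputable def momentum (t κ₀ κ₁ θ y z : L) : L :=
  (t * (t - 1) * z + (linTerm t κ₀ κ₁ θ).eval y) / (2 * (cubic t).eval y)

omit [CharZero L] in
theorem eval_cubic_ne_zero {t y : L} (h0 : y ≠ 0) (h1 : y ≠ 1) (ht : y ≠ t) :
    (cubic t).eval y ≠ 0 := by
  rw [eval_cubic]
  exact mul_ne_zero (mul_ne_zero h0 (sub_ne_zero.2 h1)) (sub_ne_zero.2 ht)

theorem isHamiltonian_momentum {D : Der L} {t κ₀ κ₁ θ ρ y : L} (ht : D t = 1) (hκ₀ : D κ₀ = 0)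
    (hκ₁ : D κ₁ = 0) (hθ : D θ = 0) (ht0 : t ≠ 0) (ht1 : t ≠ 1) (h0 : y ≠ 0) (h1 : y ≠ 1)
    (hyt : y ≠ t)
    (hsol : D (D y) = (1 / 2) * (1 / y + 1 / (y - 1) + 1 / (y - t)) * (D y) ^ 2
        - (1 / t + 1 / (t - 1) + 1 / (y - t)) * D y
        + (y * (y - 1) * (y - t) / (t ^ 2 * (t - 1) ^ 2))
          * ((2 * ρ - (κ₀ + κ₁ + θ - 1)) ^ 2 / 2 + (-κ₀ ^ 2 / 2) * t / y ^ 2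
            + (κ₁ ^ 2 / 2) * (t - 1) / (y - 1) ^ 2
            + ((1 - θ ^ 2) / 2) * t * (t - 1) / (y - t) ^ 2)) :
    IsHamiltonian (Der.comb (t * (t - 1)) 0 D D) t κ₀ κ₁ θ (ρ * (κ₀ + κ₁ + θ - 1 - ρ)) y
      (momentum t κ₀ κ₁ θ y (D y)) := by
  have hE := eval_cubic_ne_zero h0 h1 hyt
  have h1' := sub_ne_zero.2 h1
  have ht1' := sub_ne_zero.2 ht1
  have hyt' := sub_ne_zero.2 hyt
  constructor
  · rw [Der.comb_apply, momentum]
    field_simp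
    ring
  · rw [Der.comb_apply, momentum, Der.map_div _ _ (mul_ne_zero two_ne_zero hE)]
    rw [eval_cubic] at hE
    have h2 : D 2 = 0 := D.map_ofNat 2
    simp only [eval_cubic, eval_linTerm, eval_derivative_cubic, eval_derivative_linTerm,
      Der.leibniz, map_add, map_sub, Der.map_one, ht, hκ₀, hκ₁, hθ, hsol, h2]
    field_simp
    ring
end

section
variable {W : Type*} [Field W] [CharZero W]

theorem mem_algSpan_of_sq_mem {S : Set W} {x : W} (h : x ^ 2 ∈ algSpan S) : x ∈ algSpan S := by
  refine mem_algSpan_of_root (P := X ^ 2 - C (x ^ 2)) (X_pow_sub_C_ne_zero two_pos _)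
    (fun n ↦ ?_) (by simp)
  rw [coeff_sub, coeff_X_pow, coeff_C]
  refine sub_mem ?_ ?_ <;> split_ifs
  exacts [one_mem _, zero_mem _, h, zero_mem _]

theorem eq_zero_of_intCast_relation {σ : Type*} [Fintype σ] {x k : σ → W}
    (hx : AlgebraicIndependent ℚ x) (hxk : ∀ i, x i ∈ algSpan {k i})
    (hkx : ∀ i, k i ∈ algSpan {x i})
    {n : σ → ℤ} {m : ℤ} (h : ∑ i, n i * k i + m = 0) : (∀ i, n i = 0) ∧ m = 0 := by
  classical
  have key : ∀ i, n i = 0 := by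
    intro i
    by_contra hi
    have hi' : (n i : W) ≠ 0 := Int.cast_ne_zero.2 hi
    have hk : ∀ j ≠ i, k j ∈ algSpan (x '' {i}ᶜ) := fun j hj ↦
      algSpan_mono (Set.singleton_subset_iff.2 (Set.mem_image_of_mem x hj)) (hkx j)
    have hki : k i ∈ algSpan (x '' {i}ᶜ) := by
      rw [← Finset.add_sum_erase _ _ (Finset.mem_univ i)] at h
      have : k i = -(∑ j ∈ Finset.univ.erase i, n j * k j + m) / n i := by
        rw [eq_div_iff hi']
        linear_combination h
      rw [this]
      refine div_mem (neg_mem (add_mem (sum_mem fun j hj ↦ ?_) (intCast_mem _ _)))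
        (intCast_mem _ _)
      exact mul_mem (intCast_mem _ _) (hk j (Finset.ne_of_mem_erase hj))
    exact hx.transcendental_adjoin (s := {i}ᶜ) (by simp)
      (mem_algSpan.1 (algSpan_le (Set.singleton_subset_iff.2 hki) (hxk i)))
  refine ⟨key, ?_⟩
  simpa [key] using h

/-- Parameters of the Hamiltonian system attached to those of the sixth Painlevé equation. -/
theorem exists_generic_parameters {α β γ δ : ℂ} (h : AlgebraicIndependent ℚ ![α, β, γ, δ]) :
    ∃ κ₀ κ₁ θ ρ : ℂ, α = (2 * ρ - (κ₀ + κ₁ + θ - 1)) ^ 2 / 2 ∧ β = -κ₀ ^ 2 / 2 ∧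
      γ = κ₁ ^ 2 / 2 ∧ δ = (1 - θ ^ 2) / 2 ∧ ∀ n₀ n₁ n₂ n₃ n₄ : ℤ, n₀ * κ₀ + n₁ * κ₁ + n₂ * θ
        + n₃ * (2 * ρ - (κ₀ + κ₁ + θ - 1)) + n₄ = 0 →
          n₀ = 0 ∧ n₁ = 0 ∧ n₂ = 0 ∧ n₃ = 0 ∧ n₄ = 0 := by
  obtain ⟨κ₃, h₃⟩ := IsAlgClosed.exists_pow_nat_eq (2 * α) two_pos
  obtain ⟨κ₀, h₀⟩ := IsAlgClosed.exists_pow_nat_eq (-2 * β) two_pos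
  obtain ⟨κ₁, h₁⟩ := IsAlgClosed.exists_pow_nat_eq (2 * γ) two_pos
  obtain ⟨θ, hθ⟩ := IsAlgClosed.exists_pow_nat_eq (1 - 2 * δ) two_pos
  have e : 2 * ((κ₀ + κ₁ + θ - 1 + κ₃) / 2) - (κ₀ + κ₁ + θ - 1) = κ₃ := by ring
  refine ⟨κ₀, κ₁, θ, (κ₀ + κ₁ + θ - 1 + κ₃) / 2, ?_, ?_, ?_, ?_, ?_⟩
  · rw [e, h₃]; ring
  · rw [h₀]; ring
  · rw [h₁]; ring
  · rw [hθ]; ring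
  intro n₀ n₁ n₂ n₃ n₄ hn
  rw [e] at hn
  have mem (z : ℂ) : z ∈ algSpan {z} := subset_algSpan _ rfl
  have two {S : Set ℂ} : (2 : ℂ) ∈ algSpan S := ofNat_mem _ 2
  have := eq_zero_of_intCast_relation (k := ![κ₃, κ₀, κ₁, θ]) (n := ![n₃, n₀, n₁, n₂]) (m := n₄) h
    ?_ ?_ ?_
  · obtain ⟨hn, hm⟩ := this
    exact ⟨hn 1, hn 2, hn 3, hn 0, hm⟩
  · intro i
    fin_cases i
    · have : α = κ₃ ^ 2 / 2 := by rw [h₃]; ring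
      simpa [this] using div_mem (pow_mem (mem κ₃) 2) two
    · have : β = -κ₀ ^ 2 / 2 := by rw [h₀]; ring
      simpa [this] using div_mem (neg_mem (pow_mem (mem κ₀) 2)) two
    · have : γ = κ₁ ^ 2 / 2 := by rw [h₁]; ring
      simpa [this] using div_mem (pow_mem (mem κ₁) 2) two
    · have : δ = (1 - θ ^ 2) / 2 := by rw [hθ]; ring
      simpa [this] using div_mem (sub_mem (one_mem _) (pow_mem (mem θ) 2)) two
  · intro i
    apply mem_algSpan_of_sq_mem
    fin_cases i
    · simpa [h₃] using mul_mem two (mem α)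
    · simpa [h₀] using mul_mem two (mem β)
    · simpa [h₁] using mul_mem two (mem γ)
    · simpa [hθ] using sub_mem (one_mem _) (mul_mem two (mem δ))
  · simp only [Fin.sum_univ_four, Matrix.cons_val]
    linear_combination hn

end

section
variable {L : Type*} [Field L] [CharZero L] {t κ₀ κ₁ θ y z : L} {F : Subfield L}

omit [CharZero L] in
theorem momentum_mem (ht : t ∈ F) (h₀ : κ₀ ∈ F) (h₁ : κ₁ ∈ F) (hθ : θ ∈ F) (hy : y ∈ F)
    (hz : z ∈ F) : momentum t κ₀ κ₁ θ y z ∈ F :=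
  div_mem (add_mem (mul_mem (mul_mem ht (sub_mem ht (one_mem F))) hz)
    (eval_linTerm_mem ht h₀ h₁ hθ hy)) (mul_mem (ofNat_mem F 2) (eval_cubic_mem ht hy))

theorem mem_of_momentum_mem (ht0 : t ≠ 0) (ht1 : t ≠ 1) (hE : (cubic t).eval y ≠ 0) (ht : t ∈ F)
    (h₀ : κ₀ ∈ F) (h₁ : κ₁ ∈ F) (hθ : θ ∈ F) (hy : y ∈ F)
    (hp : momentum t κ₀ κ₁ θ y z ∈ F) : z ∈ F := by
  have h1 := sub_ne_zero.2 ht1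
  have : z = (2 * (cubic t).eval y * momentum t κ₀ κ₁ θ y z - (linTerm t κ₀ κ₁ θ).eval y)
      / (t * (t - 1)) := by
    rw [momentum]
    field_simp
    ring
  rw [this]
  exact div_mem (sub_mem (mul_mem (mul_mem (ofNat_mem F 2) (eval_cubic_mem ht hy)) hp)
    (eval_linTerm_mem ht h₀ h₁ hθ hy)) (mul_mem ht (sub_mem ht (one_mem F)))

/-- A family of pairs, each of which adds two algebraically independent elements to the preceding
ones, is algebraically independent. -/
theorem algebraicIndependent_sumElim {σ : Type*} [Finite σ] (K : Subfield L) (a b : σ → L)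
    (ha : ∀ (J : Finset σ), ∀ i ∉ J, a i ∉ algSpan (K ∪ (a '' J ∪ b '' J)))
    (hb : ∀ (J : Finset σ), ∀ i ∉ J, b i ∉ algSpan (insert (a i) (K ∪ (a '' J ∪ b '' J)))) :
    AlgebraicIndependent K (Sum.elim a b) := by
  classical
  have := Fintype.ofFinite σ
  have key (J : Finset σ) :
      AlgebraicIndepOn K (Sum.elim a b) (Sum.inl '' (J : Set σ) ∪ Sum.inr '' (J : Set σ)) := by
    induction J using Finset.induction_on with
    | empty =>
      simp only [Finset.coe_empty, Set.image_empty, Set.union_empty]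
      exact algebraicIndependent_empty_type_iff.2 (FaithfulSMul.algebraMap_injective K L)
    | insert i J hi ih =>
      have e : (Sum.inl '' (↑(insert i J) : Set σ) ∪ Sum.inr '' (↑(insert i J) : Set σ) :
          Set (σ ⊕ σ)) = insert (Sum.inr i) (insert (Sum.inl i) (Sum.inl '' J ∪ Sum.inr '' J)) := by
        rw [Finset.coe_insert, Set.image_insert_eq, Set.image_insert_eq, Set.insert_union,
          Set.union_insert, Set.insert_comm]
      have e' : Sum.elim a b '' (Sum.inl '' J ∪ Sum.inr '' J) = a '' J ∪ b '' J := by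
        simp [Set.image_union, Set.image_image]
      rw [e, AlgebraicIndepOn.insert_iff (by simp [hi]), AlgebraicIndepOn.insert_iff (by simp [hi])]
      refine ⟨⟨ih, ?_⟩, ?_⟩
      rotate_left
      · rw [Set.image_insert_eq, e', Transcendental, isAlgebraic_adjoin_iff_mem_algSpan,
          Sum.elim_inl, Sum.elim_inr, Set.union_insert]
        exact hb J i hi
      · rw [e', Transcendental, isAlgebraic_adjoin_iff_mem_algSpan, Sum.elim_inl]
        exact ha J i hi
  rw [← AlgebraicIndepOn.univ]
  convert key Finset.univ using 1
  simp [Set.range_inl_union_range_inr]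

theorem not_algebraicIndependent_pair (K : Subfield L) {n : ℕ} {a b : Fin n → L} {i j : Fin n}
    (hij : i ≠ j) (h : a i ∈ algSpan (K ∪ {a j, b j})) :
    ∃ i j : Fin n, i < j ∧ ¬ AlgebraicIndependent K ![a i, b i, a j, b j] := by
  rw [← isAlgebraic_adjoin_iff_mem_algSpan] at h
  rcases hij.lt_or_gt with hlt | hlt
  · refine ⟨i, j, hlt, fun hind ↦ hind.transcendental_adjoin (s := {2, 3}) (i := 0) (by simp) ?_⟩
    rwa [Set.image_pair]
  · refine ⟨j, i, hlt, fun hind ↦ hind.transcendental_adjoin (s := {0, 1}) (i := 2) (by simp) ?_⟩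
    rwa [Set.image_pair]

end

section
variable {L : Type*} [Field L] [CharZero L]

theorem exists_pair_of_not_algebraicIndependent {D : Der L} {t κ₀ κ₁ θ ρ : L}
    {K : Subfield L} (hKD : ∀ a ∈ K, D a ∈ K) (hKt : t ∈ K) (h₀ : κ₀ ∈ K)
    (h₁ : κ₁ ∈ K) (hθ : θ ∈ K) (hρ : ρ ∈ K)
    (hgp : GenericParams (Der.comb (t * (t - 1)) 0 D D) t κ₀ κ₁ θ ρ (ρ * (κ₀ + κ₁ + θ - 1 - ρ)))
    {n : ℕ} (hn : 2 ≤ n) {y : Fin n → L} (hE : ∀ i, (cubic t).eval (y i) ≠ 0)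
    (h : ∀ i, IsHamiltonian (Der.comb (t * (t - 1)) 0 D D) t κ₀ κ₁ θ
      (ρ * (κ₀ + κ₁ + θ - 1 - ρ)) (y i) (momentum t κ₀ κ₁ θ (y i) (D (y i))))
    (hdep : ¬ AlgebraicIndependent K (Sum.elim y (fun i ↦ D (y i)))) :
    ∃ i j : Fin n, i < j ∧ ¬ AlgebraicIndependent K ![y i, D (y i), y j, D (y j)] := by
  set d := Der.comb (t * (t - 1)) 0 D D
  set p : Fin n → L := fun i ↦ momentum t κ₀ κ₁ θ (y i) (D (y i))
  have mem {T : Set L} {x : L} (hx : x ∈ K) : x ∈ algSpan (K ∪ T) :=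
    subset_algSpan _ (Or.inl hx)
  have memK {x : L} (hx : x ∈ K) : x ∈ algSpan (K : Set L) := subset_algSpan _ hx
  have hS : IsDifferentialBase d t κ₀ κ₁ θ ρ (K : Set L) := by
    refine ⟨fun x hx ↦ d.mem_algSpan_of_forall (subset_algSpan _) (fun s hs ↦ memK ?_) hx,
      memK hKt, memK h₀, memK h₁, memK hθ, memK hρ⟩
    rw [Der.comb_apply]
    exact add_mem (mul_mem (mul_mem hKt (sub_mem hKt K.one_mem)) (hKD s hs))
      (mul_mem K.zero_mem (hKD s hs))
  have hpD (i : Fin n) {T : Set L} (hy : y i ∈ algSpan (K ∪ T)) (hDy : D (y i) ∈ algSpan (K ∪ T)) :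
      p i ∈ algSpan (K ∪ T) :=
    momentum_mem (mem hKt) (mem h₀) (mem h₁) (mem hθ) hy hDy
  have hle (J : Finset (Fin n)) : algSpan (K ∪ (y '' J ∪ (fun i ↦ D (y i)) '' J)) ≤
      algSpan (K ∪ (y '' J ∪ p '' J)) := by
    refine algSpan_le ?_
    rintro _ (hx | ⟨i, hi, rfl⟩ | ⟨i, hi, rfl⟩)
    · exact mem hx
    · exact subset_algSpan _ (Or.inr (Or.inl ⟨i, hi, rfl⟩))
    · exact mem_of_momentum_mem hgp.t_ne_zero hgp.t_ne_one (hE i) (mem hKt) (mem h₀) (mem h₁)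
        (mem hθ) (subset_algSpan _ (Or.inr (Or.inl ⟨i, hi, rfl⟩)))
        (subset_algSpan _ (Or.inr (Or.inr ⟨i, hi, rfl⟩)))
  obtain ⟨J, i, hi, hmem⟩ : ∃ J : Finset (Fin n), ∃ i ∉ J,
      y i ∈ algSpan (K ∪ (y '' J ∪ p '' J)) := by
    by_contra! hcon
    refine hdep (algebraicIndependent_sumElim K _ _ (fun J i hi hm ↦ hcon J i hi (hle J hm))
      fun J i hi hm ↦ ?_)
    refine (h i).notMem_algSpan (hS.union_image hgp h J) hgp (hcon J i hi) ?_
    rw [← Set.union_insert] at hm ⊢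
    refine hpD i (subset_algSpan _ (by simp)) (algSpan_le ?_ hm)
    rw [Set.union_insert, Set.union_insert]
    refine Set.insert_subset (subset_algSpan _ (by simp)) fun x hx ↦ ?_
    exact algSpan_mono (Set.subset_insert _ _) (hle J (subset_algSpan _ hx))
  obtain ⟨i, hy⟩ | ⟨i, j, hij, hy⟩ := IsHamiltonian.exists_pair hS hgp h hE J hi hmem
  · have : Nontrivial (Fin n) := Fin.nontrivial_iff_two_le.2 hn
    obtain ⟨j, hij⟩ := exists_ne i
    exact not_algebraicIndependent_pair K hij.symm (algSpan_mono Set.subset_union_left hy)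
  · refine not_algebraicIndependent_pair K (b := fun i ↦ D (y i)) hij (algSpan_le ?_ hy)
    have hj : y j ∈ algSpan (K ∪ {y j, D (y j)}) := subset_algSpan _ (by simp)
    exact Set.insert_subset (hpD j hj (subset_algSpan _ (by simp)))
      (Set.insert_subset hj fun x hx ↦ mem hx)

end

end PainleveVI

/-- Geometric triviality part of Proposition 3.18 for generic `P_VI`: for `α, β, γ, δ ∈ ℂ`
algebraically independent over `ℚ`, if solutions `y₁, …, yₙ` (each `∉ {0, 1, t}`) of the
sixth Painlevé equation are such that `y₁, y₁', …, yₙ, yₙ'` are algebraically dependent over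
a differential subfield `K`, then already some pair `yᵢ, yᵢ', yⱼ, yⱼ'` (`i < j`) is
algebraically dependent over `K`. -/
theorem painleveVI_geometrically_trivial
    (α β γ δ : ℂ) (hind : AlgebraicIndependent ℚ ![α, β, γ, δ])
    (L : Type*) [Field L] [Algebra ℂ L]
    (D : L → L)
    (hD_add : ∀ a b : L, D (a + b) = D a + D b)
    (hD_mul : ∀ a b : L, D (a * b) = a * D b + b * D a)
    (hD_const : ∀ c : ℂ, D (algebraMap ℂ L c) = 0)
    (t : L) (hDt : D t = 1)
    (K : Subfield L)
    (hK_const : ∀ c : ℂ, algebraMap ℂ L c ∈ K)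
    (hK_t : t ∈ K)
    (hK_D : ∀ a ∈ K, D a ∈ K)
    (n : ℕ) (hn : 2 ≤ n)
    (y : Fin n → L)
    (hy0 : ∀ i : Fin n, y i ≠ 0) (hy1 : ∀ i : Fin n, y i ≠ 1) (hyt : ∀ i : Fin n, y i ≠ t)
    (hsol : ∀ i : Fin n,
      D (D (y i)) = (1 / 2) * (1 / y i + 1 / (y i - 1) + 1 / (y i - t)) * (D (y i)) ^ 2
        - (1 / t + 1 / (t - 1) + 1 / (y i - t)) * D (y i)
        + (y i * (y i - 1) * (y i - t) / (t ^ 2 * (t - 1) ^ 2))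
          * (algebraMap ℂ L α + algebraMap ℂ L β * t / (y i) ^ 2
            + algebraMap ℂ L γ * (t - 1) / (y i - 1) ^ 2
            + algebraMap ℂ L δ * t * (t - 1) / (y i - t) ^ 2))
    (hdep : ¬ AlgebraicIndependent K (Sum.elim y (fun i => D (y i)))) :
    ∃ i j : Fin n, i < j ∧
      ¬ AlgebraicIndependent K ![y i, D (y i), y j, D (y j)] := by
  have : CharZero L := charZero_of_injective_algebraMap (algebraMap ℂ L).injective
  have h2 : algebraMap ℂ L 2 = 2 := map_ofNat _ 2
  let D' : PainleveVI.Der L := ⟨D, hD_add, hD_mul⟩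
  have ht0 : t ≠ 0 := by
    rintro rfl
    exact zero_ne_one ((map_zero D').symm.trans hDt)
  have ht1 : t ≠ 1 := by
    rintro rfl
    exact zero_ne_one ((PainleveVI.Der.map_one D').symm.trans hDt)
  obtain ⟨κ₀, κ₁, θ, ρ, rfl, rfl, rfl, rfl, hgen⟩ := PainleveVI.exists_generic_parameters hind
  refine PainleveVI.exists_pair_of_not_algebraicIndependent (D := D') hK_D hK_t (hK_const κ₀)
    (hK_const κ₁) (hK_const θ) (hK_const ρ) ⟨?_, ht0, ht1, ?_, rfl, ?_⟩ hn
    (fun i ↦ PainleveVI.eval_cubic_ne_zero (hy0 i) (hy1 i) (hyt i)) (fun i ↦ ?_) hdep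
  · rw [PainleveVI.Der.comb_apply, show D' t = 1 from hDt]
    ring
  · rw [PainleveVI.Der.comb_apply, show D' (algebraMap ℂ L ρ) = 0 from hD_const ρ]
    ring
  · intro n₀ n₁ n₂ n₃ n₄ hrel
    refine hgen n₀ n₁ n₂ n₃ n₄ ((algebraMap ℂ L).injective ?_)
    simpa [h2] using hrel
  · refine PainleveVI.isHamiltonian_momentum hDt (hD_const κ₀) (hD_const κ₁) (hD_const θ) ht0 ht1
      (hy0 i) (hy1 i) (hyt i) ?_
    have h := hsol i
    simp only [map_div₀, map_sub, map_add, map_mul, map_neg, map_pow, map_one, h2] at h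
    exact h
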